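/- Let f(x,y) ∈ ℤ[x,y] be an irreducible homogeneous polynomial of degree d, let b be a fixed non-zero integer and A_1,...,A_r fixed positive integers, and assume d > r ≥ 2. Then the equation b·(n_1!·A_1^{n_1})···(n_r!·A_r^{n_r}) = f(x,y) has only finitely many solutions in positive integers n_1,...,n_r and integers x, y. -/

import Mathlib

section

namespace Thue
open Polynomial

lemma powmod_bound (g : ℤ[X]) (hg : g.Monic) :
    ∃ c : ℕ, 1 ≤ c ∧ ∀ e i, |(X ^ e %ₘ g).coeff i| ≤ (c : ℤ) ^ e := by
  by_cases hg1 : g = 1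
  · exact ⟨1, le_rfl, by intro e i; simp [hg1]⟩
  have hd : 0 < g.natDegree := by
    rcases Nat.eq_zero_or_pos g.natDegree with h | h
    · exact absurd (hg.natDegree_eq_zero.mp h) hg1
    · exact h
  set H : ℕ := ∑ i ∈ Finset.range (g.natDegree + 1), (g.coeff i).natAbs with hH
  have hgc : ∀ i, |g.coeff i| ≤ (H : ℤ) := by
    intro i
    by_cases hi : i < g.natDegree + 1
    · rw [Int.abs_eq_natAbs]
      have := Finset.single_le_sum (f := fun i => (g.coeff i).natAbs) (fun _ _ => Nat.zero_le _)
        (Finset.mem_range.mpr hi)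
      exact_mod_cast this
    · rw [coeff_eq_zero_of_natDegree_lt (by omega)]; simp
  refine ⟨1 + H, by omega, ?_⟩
  intro e
  induction e with
  | zero =>
    intro i
    rw [pow_zero, (modByMonic_eq_self_iff hg).2]
    · rw [coeff_one]; split_ifs <;> simp
    · rw [degree_one, degree_eq_natDegree hg.ne_zero]; exact_mod_cast hd
  | succ e ih =>
    have key : X ^ (e + 1) %ₘ g = X * (X ^ e %ₘ g) - C ((X ^ e %ₘ g).coeff (g.natDegree - 1)) * g := by
      set r := X ^ e %ₘ g with hr
      have hrdeg : r.degree < g.degree := degree_modByMonic_lt _ hg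
      have hrn : r.natDegree < g.natDegree := natDegree_modByMonic_lt _ hg hg1
      refine ((div_modByMonic_unique (X * (X ^ e /ₘ g) + C (r.coeff (g.natDegree - 1))) _ hg ⟨?_, ?_⟩).2)
      · have := modByMonic_add_div (X ^ e) g
        rw [pow_succ, mul_comm (X ^ e)]
        rw [← hr] at this
        linear_combination X * this
      · rw [degree_eq_natDegree hg.ne_zero, degree_lt_iff_coeff_zero]
        intro m hm
        rcases hm.lt_or_eq with h | h
        · obtain ⟨m, rfl⟩ : ∃ m', m = m' + 1 := ⟨m - 1, by omega⟩
          rw [coeff_sub, coeff_X_mul, coeff_C_mul, coeff_eq_zero_of_natDegree_lt h,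
            coeff_eq_zero_of_natDegree_lt (by omega)]; simp
        · subst h
          have h2 : X * r = X * r := rfl
          obtain ⟨m, hm'⟩ : ∃ m', g.natDegree = m' + 1 := ⟨g.natDegree - 1, by omega⟩
          have : g.coeff g.natDegree = 1 := hg
          rw [coeff_sub, coeff_C_mul, this, hm', coeff_X_mul]; simp
    intro i
    rw [key, coeff_sub, coeff_C_mul]
    have h1 : |(X * (X ^ e %ₘ g)).coeff i| ≤ (1 + H : ℤ) ^ e := by
      cases i with
      | zero => simp; positivity
      | succ i => rw [coeff_X_mul]; exact_mod_cast ih i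
    have h2 : |(X ^ e %ₘ g).coeff (g.natDegree - 1) * g.coeff i| ≤ (1 + H : ℤ) ^ e * H := by
      rw [abs_mul]
      exact mul_le_mul (by exact_mod_cast ih _) (hgc i) (abs_nonneg _) (by positivity)
    calc _ ≤ _ := abs_sub _ _
      _ ≤ (1 + H : ℤ) ^ e + (1 + H : ℤ) ^ e * H := add_le_add h1 h2
      _ = _ := by push_cast; ring

attribute [local instance] Matrix.seminormedAddCommGroup

/-- auxiliary polynomials -/
lemma siegel_aux (g : ℤ[X]) (hg : g.Monic) (hd : 0 < g.natDegree) (T : ℕ) (hT : 0 < T) :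
    ∃ H : ℕ, 1 ≤ H ∧ ∀ k : ℕ, 0 < k → ∃ A B : ℤ[X],
      (A ≠ 0 ∨ B ≠ 0) ∧ A.degree < (g.natDegree * T * k + k : ℕ) ∧
      B.degree < (g.natDegree * T * k + k : ℕ) ∧
      (∀ i, |A.coeff i| ≤ (H : ℤ) ^ k) ∧ (∀ i, |B.coeff i| ≤ (H : ℤ) ^ k) ∧
      ∀ j < 2 * T * k, g ∣ hasseDeriv j A + X * hasseDeriv j B := by
  obtain ⟨c, hc1, hc⟩ := powmod_bound g hg
  set d := g.natDegree with hdd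
  refine ⟨(8 * c) ^ ((d * T + 1) * (d * T)), Nat.one_le_pow _ _ (by omega), ?_⟩
  intro k hk
  set N := d * T * k + k with hN
  let M : Matrix (Fin (2 * T * k) × Fin d) (Fin 2 × Fin N) ℤ :=
    fun a b => (((b.2 : ℕ).choose a.1 : ℕ) : ℤ) * (X ^ ((b.2 : ℕ) - a.1 + b.1) %ₘ g).coeff a.2
  obtain ⟨t, ht0, htM, htn⟩ := Int.Matrix.exists_ne_zero_int_vec_norm_le M
    (by simp only [Fintype.card_prod, Fintype.card_fin]; nlinarith)
    (by simp only [Fintype.card_prod, Fintype.card_fin]; positivity)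
  have hMn : ‖M‖ ≤ ((2 * c : ℕ) : ℝ) ^ N := by
    rw [Matrix.norm_le_iff (by positivity)]
    intro a b
    rw [Int.norm_eq_abs]
    have h1 : |M a b| ≤ ((2 * c : ℕ) : ℤ) ^ N := by
      simp only [M]
      rw [abs_mul, Nat.abs_cast, Nat.cast_mul, mul_pow]
      refine mul_le_mul ?_ ((hc _ _).trans ?_) (abs_nonneg _) (by positivity)
      · have : (b.2 : ℕ).choose a.1 ≤ 2 ^ N :=
          (Nat.choose_le_two_pow _ _).trans (Nat.pow_le_pow_right (by norm_num) b.2.2.le)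
        exact_mod_cast this
      · have : c ^ ((b.2 : ℕ) - a.1 + b.1) ≤ c ^ N :=
          Nat.pow_le_pow_right hc1 (by have := b.2.2; have := b.1.2; omega)
        exact_mod_cast this
    exact_mod_cast h1
  have htb : ∀ b, |t b| ≤ (((8 * c) ^ ((d * T + 1) * (d * T)) : ℕ) : ℤ) ^ k := by
    intro b
    have h1 : |(t b : ℝ)| ≤ ‖t‖ := by
      rw [← Int.norm_eq_abs]; exact norm_le_pi_norm t b
    have h2 := h1.trans htn
    have h3 : ((Fintype.card (Fin (2 * T * k) × Fin d) : ℝ) /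
      ((Fintype.card (Fin 2 × Fin N) : ℝ) - (Fintype.card (Fin (2 * T * k) × Fin d) : ℝ)))
        = ((d * T : ℕ) : ℝ) := by
      simp only [Fintype.card_prod, Fintype.card_fin, hN]
      push_cast
      have : (k : ℝ) ≠ 0 := by positivity
      rw [show (2 * ((d : ℝ) * T * k + k) - 2 * T * k * d) = 2 * k by ring]
      field_simp
    rw [h3, Real.rpow_natCast] at h2
    have h4 : (Fintype.card (Fin 2 × Fin N) : ℝ) * max 1 ‖M‖ ≤ ((8 * c : ℕ) : ℝ) ^ N := by
      have hm : max 1 ‖M‖ ≤ ((2 * c : ℕ) : ℝ) ^ N := by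
        refine max_le ?_ hMn
        exact one_le_pow₀ (by exact_mod_cast (by omega : 1 ≤ 2 * c))
      have hn : (Fintype.card (Fin 2 × Fin N) : ℝ) ≤ (4 : ℝ) ^ N := by
        simp only [Fintype.card_prod, Fintype.card_fin]
        have h5 : N < 2 ^ N := Nat.lt_two_pow_self
        have h6 : 2 ≤ 2 ^ N := by
          calc 2 = 2 ^ 1 := rfl
            _ ≤ 2 ^ N := Nat.pow_le_pow_right (by norm_num) (by omega)
        have : 2 * N ≤ 4 ^ N := by
          rw [show (4 : ℕ) = 2 * 2 from rfl, mul_pow]; exact Nat.mul_le_mul h6 h5.le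
        exact_mod_cast this
      calc _ ≤ (4 : ℝ) ^ N * ((2 * c : ℕ) : ℝ) ^ N := by gcongr
        _ = _ := by rw [← mul_pow]; congr 1; push_cast; ring
    have h7 : |(t b : ℝ)| ≤ (((8 * c : ℕ) : ℝ) ^ N) ^ (d * T) := h2.trans (by gcongr)
    have h8 : |(t b : ℝ)| ≤ ((((8 * c) ^ ((d * T + 1) * (d * T)) : ℕ) : ℤ) ^ k : ℤ) := by
      refine h7.trans (le_of_eq ?_)
      push_cast
      rw [← pow_mul, ← pow_mul, hN]
      congr 1
      ring
    exact_mod_cast h8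
  let P : Fin 2 → ℤ[X] := fun s => ∑ e : Fin N, C (t (s, e)) * X ^ (e : ℕ)
  have hPc : ∀ s i, (P s).coeff i = if h : i < N then t (s, ⟨i, h⟩) else 0 := by
    intro s i
    simp only [P, finsetSum_coeff, coeff_C_mul_X_pow]
    split_ifs with h
    · rw [Finset.sum_eq_single ⟨i, h⟩]
      · simp
      · intro b _ hb; rw [if_neg]; rintro rfl; exact hb rfl
      · simp
    · refine Finset.sum_eq_zero ?_
      intro b _; rw [if_neg]; rintro rfl; exact h b.2
  have hPdeg : ∀ s, (P s).degree < (N : ℕ) := by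
    intro s
    rw [degree_lt_iff_coeff_zero]
    intro m hm
    rw [hPc, dif_neg (by omega)]
  have hPb : ∀ s i, |(P s).coeff i| ≤ (((8 * c) ^ ((d * T + 1) * (d * T)) : ℕ) : ℤ) ^ k := by
    intro s i
    rw [hPc]
    split_ifs
    · exact htb _
    · simp; positivity
  refine ⟨P 0, P 1, ?_, hPdeg 0, hPdeg 1, hPb 0, hPb 1, ?_⟩
  · by_contra hcon
    push Not at hcon
    apply ht0
    ext ⟨s, e⟩
    have : (P s).coeff e = t (s, e) := by rw [hPc, dif_pos e.2]
    rw [← this]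
    fin_cases s
    · simp [hcon.1]
    · simp [hcon.2]
  · intro j hj
    rw [← modByMonic_eq_zero_iff_dvd hg]
    have key : ∀ s : Fin 2, (X ^ (s : ℕ) * hasseDeriv j (P s)) %ₘ g =
        ∑ e : Fin N, C (t (s, e) * ((e : ℕ).choose j : ℕ)) * (X ^ ((e : ℕ) - j + s) %ₘ g) := by
      intro s
      have : X ^ (s : ℕ) * hasseDeriv j (P s) =
          ∑ e : Fin N, (t (s, e) * ((e : ℕ).choose j : ℕ)) • (X : ℤ[X]) ^ ((e : ℕ) - j + s) := by
        simp only [P, map_sum, Finset.mul_sum]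
        refine Finset.sum_congr rfl fun e _ => ?_
        rw [C_mul_X_pow_eq_monomial, hasseDeriv_monomial, ← C_mul_X_pow_eq_monomial, smul_eq_C_mul,
          pow_add, mul_comm (t _) _]
        simp
        ring
      rw [this]
      change modByMonicHom g _ = _
      rw [map_sum]
      refine Finset.sum_congr rfl fun e _ => ?_
      rw [map_smul, smul_eq_C_mul]
      rfl
    have k0 := key 0
    have k1 := key 1
    simp only [Fin.val_zero, pow_zero, one_mul, Fin.val_one, pow_one] at k0 k1
    rw [add_modByMonic, k0, k1]
    ext i
    by_cases hi : i < d
    · have := congrFun htM (⟨j, hj⟩, ⟨i, hi⟩)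
      simp only [Matrix.mulVec, dotProduct, Fintype.sum_prod_type, Fin.sum_univ_two, M] at this
      rw [coeff_add, finsetSum_coeff, finsetSum_coeff, coeff_zero]
      simp only [coeff_C_mul]
      simp only [Fin.val_zero, Fin.val_one, Pi.zero_apply] at this
      rw [← this]
      congr 1 <;> refine Finset.sum_congr rfl fun e _ => by ring
    · rw [← k0, ← k1, coeff_add, coeff_zero]
      have hg1 : g ≠ 1 := by rintro rfl; simp at hdd; omega
      have hlt : ∀ p : ℤ[X], (p %ₘ g).coeff i = 0 := fun p =>
        coeff_eq_zero_of_natDegree_lt ((natDegree_modByMonic_lt _ hg hg1).trans_le (by omega))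
      rw [hlt, hlt, add_zero]

end Thue

end

section

namespace Thue
open Polynomial

lemma pow_dvd_of_hasse {R : Type*} [CommRing R] (P : R[X]) (a : R) (n : ℕ)
    (h : ∀ j < n, (hasseDeriv j P).eval a = 0) : (X - C a) ^ n ∣ P := by
  rw [X_sub_C_pow_dvd_iff]
  change X ^ n ∣ taylor a P
  rw [X_pow_dvd_iff]
  intro j hj
  rw [taylor_coeff, h j hj]

lemma hasse_map {R S : Type*} [CommRing R] [CommRing S] (f : R →+* S) (P : R[X]) (j : ℕ) :
    hasseDeriv j (P.map f) = (hasseDeriv j P).map f := by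
  ext i
  simp [hasseDeriv_coeff]

lemma hasse_C_mul {R : Type*} [CommRing R] (a : R) (P : R[X]) (j : ℕ) :
    hasseDeriv j (C a * P) = C a * hasseDeriv j P := by
  rw [← smul_eq_C_mul, map_smul, smul_eq_C_mul]

lemma natDegree_eq_of_wronskian (A B : ℚ[X]) (hA : A ≠ 0) (hB : B ≠ 0)
    (h : derivative A * B = A * derivative B) : A.natDegree = B.natDegree := by
  have aux : ∀ P : ℚ[X], P ≠ 0 → derivative P = 0 → P.natDegree = 0 :=
    fun P _ h => derivative_eq_zero.mp h
  by_cases hA' : derivative A = 0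
  · rw [hA', zero_mul] at h
    have : derivative B = 0 := by
      rcases mul_eq_zero.mp h.symm with h | h
      · exact absurd h hA
      · exact h
    rw [aux A hA hA', aux B hB this]
  · by_cases hB' : derivative B = 0
    · rw [hB', mul_zero] at h
      rcases mul_eq_zero.mp h with h | h
      · exact absurd h hA'
      · exact absurd h hB
    · have h1 := congrArg leadingCoeff h
      rw [leadingCoeff_mul, leadingCoeff_mul, leadingCoeff_derivative, leadingCoeff_derivative] at h1
      have h2 : A.leadingCoeff ≠ 0 := leadingCoeff_ne_zero.mpr hA
      have h3 : B.leadingCoeff ≠ 0 := leadingCoeff_ne_zero.mpr hB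
      have h4 : (A.natDegree : ℚ) = B.natDegree := by
        have h5 : (A.leadingCoeff * B.leadingCoeff) ≠ 0 := mul_ne_zero h2 h3
        apply mul_left_cancel₀ h5
        linear_combination h1
      exact_mod_cast h4

lemma proportional (A B : ℚ[X]) (hB : B ≠ 0)
    (h : derivative A * B = A * derivative B) : ∃ c : ℚ, A = C c * B := by
  by_cases hA : A = 0
  · exact ⟨0, by simp [hA]⟩
  have hdeg := natDegree_eq_of_wronskian A B hA hB h
  refine ⟨A.leadingCoeff / B.leadingCoeff, ?_⟩
  set c := A.leadingCoeff / B.leadingCoeff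
  have h3 : B.leadingCoeff ≠ 0 := leadingCoeff_ne_zero.mpr hB
  by_contra hne
  have hE : A - C c * B ≠ 0 := sub_ne_zero.mpr hne
  have hE2 : derivative (A - C c * B) * B = (A - C c * B) * derivative B := by
    simp only [derivative_sub, derivative_mul, derivative_C]
    linear_combination h
  have h4 := natDegree_eq_of_wronskian _ B hE hB hE2
  have h5 : (A - C c * B).coeff B.natDegree = 0 := by
    rw [coeff_sub, coeff_C_mul, ← hdeg]
    simp only [c, coeff_natDegree]
    rw [hdeg]
    simp only [coeff_natDegree]
    field_simp
    ring
  rw [← h4] at h5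
  exact hE (leadingCoeff_eq_zero.mp h5)

/-- roots of multiplicity count -/
lemma sum_mult_le (W : ℂ[X]) (hW : W ≠ 0) (s : Finset ℂ) (e : ℂ → ℕ)
    (h : ∀ a ∈ s, (X - C a) ^ (e a) ∣ W) : ∑ a ∈ s, e a ≤ W.natDegree := by
  have h1 : ∏ a ∈ s, (X - C a) ^ (e a) ∣ W := by
    refine Finset.prod_dvd_of_coprime ?_ h
    intro a _ b _ hab
    exact (isCoprime_X_sub_C_of_isUnit_sub (sub_ne_zero.mpr hab).isUnit).pow
  have h2 := natDegree_le_of_dvd h1 hW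
  rw [natDegree_prod_of_monic _ _ (fun a _ => (monic_X_sub_C a).pow _)] at h2
  simpa [natDegree_pow] using h2

lemma nonvanish (g : ℤ[X]) (hg : g.Monic) (hirr : Irreducible g) (hd : 2 ≤ g.natDegree)
    (A B : ℤ[X]) (hAB : A ≠ 0 ∨ B ≠ 0) (N n S : ℕ) (hA : A.degree < N) (hB : B.degree < N)
    (hNn : N ≤ g.natDegree * n) (hS : 2 * N ≤ S + g.natDegree * (n - 1))
    (hdvd : ∀ j < n, g ∣ hasseDeriv j A + X * hasseDeriv j B) (β y : ℚ) :
    ∃ j ≤ S, ((hasseDeriv j A).map (Int.castRingHom ℂ) +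
      C (y : ℂ) * (hasseDeriv j B).map (Int.castRingHom ℂ)).eval (β : ℂ) ≠ 0 := by
  set φ := Int.castRingHom ℂ
  set A' := A.map φ with hA'
  set B' := B.map φ with hB'
  have hφ : Function.Injective φ := Int.cast_injective
  have hgQ : Irreducible (g.map (Int.castRingHom ℚ)) :=
    (IsPrimitive.Int.irreducible_iff_irreducible_map_cast hg.isPrimitive).mp hirr
  have hgC : g.map φ = (g.map (Int.castRingHom ℚ)).map (algebraMap ℚ ℂ) := by
    rw [map_map]; congr 1
  have hsep : (g.map φ).Separable := by
    rw [hgC]; exact hgQ.separable.map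
  have hcard : (g.map φ).roots.toFinset.card = g.natDegree := by
    rw [Multiset.toFinset_card_of_nodup (nodup_roots hsep),
      ← (IsAlgClosed.splits (g.map φ)).natDegree_eq_card_roots, hg.natDegree_map]
  set s := (g.map φ).roots.toFinset with hs
  have hg0 : g.map φ ≠ 0 := (hg.map φ).ne_zero
  have hroot : ∀ a ∈ s, (g.map φ).eval a = 0 := by
    intro a ha
    rw [hs, Multiset.mem_toFinset, mem_roots hg0] at ha
    exact ha
  have hnotrat : ∀ q : ℚ, (q : ℂ) ∉ s := by
    intro q hq
    have h1 := hroot _ hq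
    rw [hgC, show (q : ℂ) = algebraMap ℚ ℂ q by simp, eval_map_algebraMap, aeval_algebraMap_apply]
      at h1
    have h2 : (g.map (Int.castRingHom ℚ)).IsRoot q := by
      rw [map_eq_zero] at h1
      simpa using h1
    have h3 := degree_eq_one_of_irreducible_of_root hgQ h2
    rw [hg.degree_map, degree_eq_natDegree hg.ne_zero] at h3
    have : g.natDegree = 1 := by exact_mod_cast h3
    omega
  have hP : ∀ a ∈ s, (X - C a) ^ n ∣ A' + C a * B' := by
    intro a ha
    apply pow_dvd_of_hasse
    intro j hj
    obtain ⟨q, hq⟩ := hdvd j hj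
    have := congrArg (fun p => (p.map φ).eval a) hq
    simp only [Polynomial.map_add, Polynomial.map_mul, map_X, eval_add, eval_mul, eval_X, hroot a ha,
      zero_mul] at this
    rw [map_add, hasse_C_mul, hA', hB', hasse_map, hasse_map]
    simpa using this
  have hbig : ∀ P : ℤ[X], P.degree < N → (∀ a ∈ s, (X - C a) ^ n ∣ P.map φ) → P = 0 := by
    intro P hPd h
    by_contra hP0
    have hP0' : P.map φ ≠ 0 := (Polynomial.map_ne_zero_iff hφ).mpr hP0
    have := sum_mult_le _ hP0' s (fun _ => n) h
    rw [Finset.sum_const, hcard, smul_eq_mul, natDegree_map_eq_of_injective hφ] at this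
    have h2 : P.natDegree < N := (natDegree_lt_iff_degree_lt hP0).mpr hPd
    omega
  -- the Wronskian
  set W := derivative A * B - A * derivative B with hW
  have hW0 : W ≠ 0 := by
    intro hW0
    by_cases hB0 : B = 0
    · have hA0 : A = 0 := by
        apply hbig A hA
        intro a ha
        have := hP a ha
        rw [hB', hB0] at this
        simpa using this
      simp [hA0, hB0] at hAB
    · have hinj : Function.Injective (Int.castRingHom ℚ) := Int.cast_injective
      obtain ⟨c, hc⟩ := proportional (A.map (Int.castRingHom ℚ)) (B.map (Int.castRingHom ℚ))
        ((Polynomial.map_ne_zero_iff hinj).mpr hB0) (by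
          rw [derivative_map, derivative_map, ← Polynomial.map_mul, ← Polynomial.map_mul,
            sub_eq_zero.mp hW0])
      have hc' : A' = C (c : ℂ) * B' := by
        have := congrArg (fun p => p.map (algebraMap ℚ ℂ)) hc
        simp only [Polynomial.map_mul, map_map, map_C] at this
        rw [RingHom.ext_int ((algebraMap ℚ ℂ).comp (Int.castRingHom ℚ)) φ, eq_ratCast] at this
        rw [hA', hB']
        exact this
      apply hB0
      apply hbig B hB
      intro a ha
      have h1 := hP a ha
      rw [hc', ← add_mul, ← C_add] at h1
      have h2 : (c : ℂ) + a ≠ 0 := by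
        intro h
        have : a = ((-c : ℚ) : ℂ) := by push_cast; linear_combination h
        rw [this] at ha
        exact hnotrat _ ha
      rw [← (isUnit_C.mpr h2.isUnit).dvd_mul_left (u := C ((c : ℂ) + a))]
      exact h1
  by_contra hcon
  push Not at hcon
  have hlast : (X - C (β : ℂ)) ^ (S + 1) ∣ A' + C (y : ℂ) * B' := by
    apply pow_dvd_of_hasse
    intro j hj
    rw [map_add, hasse_C_mul, hA', hB', hasse_map, hasse_map]
    exact hcon j (by omega)
  have hWd : ∀ (m : ℕ) (a t : ℂ), (X - C a) ^ (m + 1) ∣ A' + C t * B' → (X - C a) ^ m ∣ W.map φ := by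
    intro m a t ⟨Q, hQ⟩
    have h1 : W.map φ = derivative (A' + C t * B') * B' - (A' + C t * B') * derivative B' := by
      simp only [hW, Polynomial.map_sub, Polynomial.map_mul, ← derivative_map, derivative_add,
        derivative_mul, derivative_C, ← hA', ← hB']
      ring
    rw [h1, hQ]
    refine dvd_sub ?_ ?_
    · apply Dvd.dvd.mul_right
      rw [derivative_mul, derivative_X_sub_C_pow]
      refine dvd_add ?_ ?_
      · exact ((Dvd.intro_left _ rfl)).mul_right _
      · exact (pow_dvd_pow _ (by omega)).mul_right _
    · exact ((pow_dvd_pow _ (by omega)).mul_right _).mul_right _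
  have hW0' : W.map φ ≠ 0 := (Polynomial.map_ne_zero_iff hφ).mpr hW0
  have hn : 0 < N := by
    rcases Nat.eq_zero_or_pos N with h | h
    · subst h
      simp at hA hB
      simp [hA, hB] at hAB
    · exact h
  have hn' : 0 < n := by
    rcases Nat.eq_zero_or_pos n with h | h
    · subst h; omega
    · exact h
  have hcount := sum_mult_le (W.map φ) hW0' (insert (β : ℂ) s)
    (fun a => if a = (β : ℂ) then S else n - 1) (by
      intro a ha
      rcases Finset.mem_insert.mp ha with h | h
      · subst h
        simp only [if_true]
        exact hWd _ _ _ hlast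
      · rw [if_neg (by rintro rfl; exact hnotrat _ h)]
        apply hWd _ _ a
        rw [Nat.sub_add_cancel hn']
        exact hP a h)
  rw [Finset.sum_insert (hnotrat β), Finset.sum_congr rfl (g := fun _ => n - 1) (by
    intro a ha; rw [if_neg (by rintro rfl; exact hnotrat _ ha)])] at hcount
  rw [Finset.sum_const, hcard, smul_eq_mul, if_pos rfl, natDegree_map_eq_of_injective hφ] at hcount
  have hAn : A.natDegree + 1 ≤ N := by
    by_cases h : A = 0
    · simp [h]; omega
    · exact (natDegree_lt_iff_degree_lt h).mpr hA
  have hBn : B.natDegree + 1 ≤ N := by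
    by_cases h : B = 0
    · simp [h]; omega
    · exact (natDegree_lt_iff_degree_lt h).mpr hB
  have hWn : W.natDegree ≤ 2 * N - 2 := by
    refine (natDegree_sub_le _ _).trans (max_le ?_ ?_)
    · refine natDegree_mul_le.trans ?_
      have := natDegree_derivative_le A
      omega
    · refine natDegree_mul_le.trans ?_
      have := natDegree_derivative_le B
      omega
  omega

end Thue

end

section

namespace Thue
open Polynomial

lemma hasse_eval_bound (P : ℂ[X]) (N m : ℕ) (hP : P.degree < N) (K : ℝ)
    (hc : ∀ i, ‖P.coeff i‖ ≤ K) (z : ℂ) :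
    ‖(hasseDeriv m P).eval z‖ ≤ N * (2 ^ N * K * (1 + ‖z‖) ^ N) := by
  have hK : 0 ≤ K := (norm_nonneg _).trans (hc 0)
  have hdeg : (hasseDeriv m P).degree < N := by
    rw [degree_lt_iff_coeff_zero] at hP ⊢
    intro i hi
    rw [hasseDeriv_coeff, hP _ (by omega), mul_zero]
  by_cases hz : hasseDeriv m P = 0
  · rw [hz]; simp; positivity
  rw [eval_eq_sum_range' ((natDegree_lt_iff_degree_lt hz).mpr hdeg)]
  refine (norm_sum_le _ _).trans ?_
  refine (Finset.sum_le_sum (g := fun _ => (2 ^ N * K * (1 + ‖z‖) ^ N)) ?_).trans (by simp)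
  intro i hi
  rw [Finset.mem_range] at hi
  rw [norm_mul, norm_pow]
  have h1 : ‖z‖ ^ i ≤ (1 + ‖z‖) ^ N :=
    (pow_le_pow_left₀ (norm_nonneg _) (by linarith) _).trans
      (pow_le_pow_right₀ (by linarith [norm_nonneg z]) hi.le)
  refine mul_le_mul ?_ h1 (by positivity) (by positivity)
  rw [hasseDeriv_coeff]
  by_cases h : i + m < N
  · rw [norm_mul]
    refine mul_le_mul ?_ (hc _) (norm_nonneg _) (by positivity)
    rw [Complex.norm_natCast]
    have : (i + m).choose m ≤ 2 ^ N :=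
      (Nat.choose_le_two_pow _ _).trans (Nat.pow_le_pow_right (by norm_num) h.le)
    exact_mod_cast this
  · rw [(degree_lt_iff_coeff_zero _ _).mp hP _ (by omega)]
    simp; positivity

lemma hasse_van_bound (P : ℂ[X]) (N n j : ℕ) (hP : P.degree < N) (K : ℝ)
    (hc : ∀ i, ‖P.coeff i‖ ≤ K) (a z : ℂ) (hz : ‖z - a‖ ≤ 1)
    (hv : ∀ i < n, (hasseDeriv i P).eval a = 0) :
    ‖(hasseDeriv j P).eval z‖ ≤ N * (2 ^ N * (N * (2 ^ N * K * (1 + ‖a‖) ^ N))) * ‖z - a‖ ^ (n - j) := by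
  have hK : 0 ≤ K := (norm_nonneg _).trans (hc 0)
  set Q := hasseDeriv j P with hQ
  have hdeg : Q.degree < N := by
    rw [degree_lt_iff_coeff_zero] at hP ⊢
    intro i hi
    rw [hasseDeriv_coeff, hP _ (by omega), mul_zero]
  have h0 : Q.eval z = (taylor a Q).eval (z - a) := by
    rw [taylor_eval]; simp
  rw [h0]
  by_cases hT : taylor a Q = 0
  · rw [hT]; simp; positivity
  have hdegT : (taylor a Q).natDegree < N := by
    rw [natDegree_taylor]
    have : Q ≠ 0 := by rintro h; rw [h] at hT; simp at hT
    exact (natDegree_lt_iff_degree_lt this).mpr hdeg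
  rw [eval_eq_sum_range' hdegT]
  refine (norm_sum_le _ _).trans ?_
  rw [mul_assoc]
  refine (Finset.sum_le_sum (g := fun _ => (2 ^ N * (N * (2 ^ N * K * (1 + ‖a‖) ^ N))) * ‖z - a‖ ^ (n - j)) ?_).trans (by simp)
  intro i hi
  rw [Finset.mem_range] at hi
  rw [norm_mul, norm_pow, taylor_coeff]
  have hcomp : (hasseDeriv i Q) = ((i + j).choose i) • hasseDeriv (i + j) P := by
    have := congrArg (fun L => L P) (hasseDeriv_comp (R := ℂ) i j)
    simpa using this
  rw [hcomp]
  by_cases h : i + j < n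
  · rw [eval_smul, hv _ h]; simp; positivity
  by_cases h' : N ≤ i + j
  · have : hasseDeriv (i + j) P = 0 := by
      ext l
      rw [hasseDeriv_coeff, (degree_lt_iff_coeff_zero _ _).mp hP _ (by omega)]; simp
    rw [this]; simp; positivity
  refine mul_le_mul ?_ (pow_le_pow_of_le_one (norm_nonneg _) hz (by omega)) (by positivity) (by positivity)
  rw [eval_smul, nsmul_eq_mul, norm_mul, Complex.norm_natCast]
  refine mul_le_mul ?_ (hasse_eval_bound P N _ hP K hc a) (norm_nonneg _) (by positivity)
  have : (i + j).choose i ≤ 2 ^ N :=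
    (Nat.choose_le_two_pow _ _).trans (Nat.pow_le_pow_right (by norm_num) (by omega))
  exact_mod_cast this

lemma int_eval_denom (P : ℤ[X]) (N : ℕ) (hP : P.degree < N) (p q : ℤ) (hq : q ≠ 0) :
    ∃ z : ℤ, (q : ℂ) ^ N * (P.map (Int.castRingHom ℂ)).eval ((p : ℂ) / q) = z := by
  have hq' : (q : ℂ) ≠ 0 := by exact_mod_cast hq
  refine ⟨∑ i ∈ Finset.range N, P.coeff i * p ^ i * q ^ (N - i), ?_⟩
  by_cases h0 : P = 0
  · simp [h0]
  have hn : (P.map (Int.castRingHom ℂ)).natDegree < N :=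
    natDegree_map_le.trans_lt ((natDegree_lt_iff_degree_lt h0).mpr hP)
  rw [eval_eq_sum_range' hn, Finset.mul_sum]
  push_cast
  refine Finset.sum_congr rfl fun i hi => ?_
  rw [Finset.mem_range] at hi
  rw [coeff_map, div_pow]
  obtain ⟨t, rfl⟩ := Nat.exists_eq_add_of_lt hi
  rw [show i + t + 1 - i = t + 1 by omega, show i + t + 1 = i + (t + 1) by ring, pow_add]
  simp
  field_simp

end Thue

end

section

namespace Thue
open Polynomial

lemma gap (g : ℤ[X]) (hg : g.Monic) (hirr : Irreducible g) (hd : 2 ≤ g.natDegree) (T : ℕ) (hT : 0 < T)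
    (α : ℂ) (hα : (g.map (Int.castRingHom ℂ)).eval α = 0) :
    ∃ M : ℝ, 1 ≤ M ∧ ∀ k : ℕ, 0 < k → ∀ p₁ q₁ p₂ q₂ : ℤ, 0 < q₁ → 0 < q₂ →
      ‖(p₁ : ℂ) / q₁ - α‖ ≤ 1 →
      1 ≤ (q₁ : ℝ) ^ (g.natDegree * T * k + k) * q₂ * (M ^ k *
        (‖(p₁ : ℂ) / q₁ - α‖ ^ (2 * T * k - (2 * k + g.natDegree)) + ‖(p₂ : ℂ) / q₂ - α‖)) := by
  obtain ⟨H, hH1, hH⟩ := siegel_aux g hg (by omega) T hT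
  set d := g.natDegree with hdd
  set a : ℝ := ‖α‖ with ha
  have ha0 : 0 ≤ a := norm_nonneg _
  refine ⟨(16 * (2 + a) ^ 2) ^ (d * T + 1) * H, ?_, ?_⟩
  · have h1 : (1 : ℝ) ≤ (16 * (2 + a) ^ 2) ^ (d * T + 1) := one_le_pow₀ (by nlinarith)
    have h2 : (1 : ℝ) ≤ H := by exact_mod_cast hH1
    nlinarith
  intro k hk p₁ q₁ p₂ q₂ hq₁ hq₂ hβ
  obtain ⟨A, B, hAB, hAd, hBd, hAc, hBc, hdvd⟩ := hH k hk
  set N := d * T * k + k with hN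
  set φ := Int.castRingHom ℂ with hφ
  have hS : 2 * N ≤ (2 * k + d) + d * (2 * T * k - 1) := by
    have : 1 ≤ 2 * T * k := by have := Nat.mul_pos hT hk; nlinarith
    obtain ⟨t, ht⟩ := Nat.exists_eq_add_of_le this
    rw [ht]
    simp only [Nat.add_sub_cancel_left]
    have : d * (2 * T * k) = d * (1 + t) := by rw [ht]
    nlinarith
  have hNn : N ≤ d * (2 * T * k) := by
    have h1 : 1 ≤ d * T := Nat.mul_pos (by omega) hT
    nlinarith
  obtain ⟨j, hj, hne⟩ := nonvanish g hg hirr hd A B hAB N (2 * T * k) (2 * k + d) hAd hBd hNn hS hdvd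
    ((p₁ : ℚ) / q₁) ((p₂ : ℚ) / q₂)
  push_cast at hne
  set β₁ : ℂ := (p₁ : ℂ) / q₁ with hβ₁
  set β₂ : ℂ := (p₂ : ℂ) / q₂ with hβ₂
  rw [eval_add, eval_mul, eval_C] at hne
  set EA := ((hasseDeriv j A).map φ).eval β₁ with hEA
  set EB := ((hasseDeriv j B).map φ).eval β₁ with hEB
  have hdegh : ∀ P : ℤ[X], P.degree < N → (hasseDeriv j P).degree < N := by
    intro P hP
    rw [degree_lt_iff_coeff_zero] at hP ⊢
    intro i hi
    rw [hasseDeriv_coeff, hP _ (by omega), mul_zero]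
  -- lower bound
  have hlow : 1 ≤ (q₁ : ℝ) ^ N * q₂ * ‖EA + β₂ * EB‖ := by
    obtain ⟨z1, hz1⟩ := int_eval_denom _ N (hdegh A hAd) p₁ q₁ hq₁.ne'
    obtain ⟨z2, hz2⟩ := int_eval_denom _ N (hdegh B hBd) p₁ q₁ hq₁.ne'
    have hq2' : (q₂ : ℂ) ≠ 0 := by exact_mod_cast hq₂.ne'
    have hq1' : (q₁ : ℂ) ≠ 0 := by exact_mod_cast hq₁.ne'
    have hz : (q₁ : ℂ) ^ N * q₂ * (EA + β₂ * EB) = ((z1 * q₂ + p₂ * z2 : ℤ) : ℂ) := by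
      push_cast
      rw [← hz1, ← hz2, hβ₂]
      field_simp
      rfl
    have hz0 : (z1 * q₂ + p₂ * z2 : ℤ) ≠ 0 := by
      intro h0
      rw [h0, Int.cast_zero] at hz
      exact (mul_ne_zero (mul_ne_zero (pow_ne_zero _ hq1') hq2') hne) hz
    have h1 : (1 : ℝ) ≤ ‖((z1 * q₂ + p₂ * z2 : ℤ) : ℂ)‖ := by
      rw [Complex.norm_intCast]
      exact_mod_cast Int.one_le_abs hz0
    rw [← hz, norm_mul, norm_mul, norm_pow, Complex.norm_intCast, Complex.norm_intCast] at h1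
    rw [abs_of_pos (by exact_mod_cast hq₁), abs_of_pos (by exact_mod_cast hq₂)] at h1
    exact h1
  refine hlow.trans ?_
  have hq1r : (0 : ℝ) < q₁ := by exact_mod_cast hq₁
  have hq2r : (0 : ℝ) < q₂ := by exact_mod_cast hq₂
  refine mul_le_mul_of_nonneg_left ?_ (by positivity)
  -- upper bound
  set P : ℂ[X] := A.map φ + C α * B.map φ with hP
  have hcoef : ∀ Q : ℤ[X], (∀ i, |Q.coeff i| ≤ (H : ℤ) ^ k) → ∀ i, ‖(Q.map φ).coeff i‖ ≤ (H : ℝ) ^ k := by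
    intro Q hQ i
    rw [coeff_map, hφ, eq_intCast, Complex.norm_intCast]
    exact_mod_cast hQ i
  have hPc : ∀ i, ‖P.coeff i‖ ≤ (H : ℝ) ^ k * (1 + a) := by
    intro i
    rw [hP, coeff_add, coeff_C_mul]
    refine (norm_add_le _ _).trans ?_
    rw [norm_mul, mul_add, mul_one, mul_comm (_ ^ k) a]
    exact add_le_add (hcoef A hAc i) (mul_le_mul_of_nonneg_left (hcoef B hBc i) ha0)
  have hdmap : ∀ Q : ℤ[X], Q.degree < N → (Q.map φ).degree < N := fun Q h => degree_map_le.trans_lt h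
  have hPd : P.degree < N := by
    refine (degree_add_le _ _).trans_lt (max_lt (hdmap A hAd) ?_)
    rw [← smul_eq_C_mul]
    exact (degree_smul_le _ _).trans_lt (hdmap B hBd)
  have hPv : ∀ i < 2 * T * k, (hasseDeriv i P).eval α = 0 := by
    intro i hi
    obtain ⟨q, hq⟩ := hdvd i hi
    have := congrArg (fun p => (p.map φ).eval α) hq
    simp only [Polynomial.map_add, Polynomial.map_mul, map_X, eval_add, eval_mul, eval_X, hα,
      zero_mul] at this
    rw [hP, map_add, hasse_C_mul, hasse_map, hasse_map]
    simpa using this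
  have h1 := hasse_van_bound P N (2 * T * k) j hPd _ hPc α β₁ hβ hPv
  have h2 := hasse_eval_bound (B.map φ) N j (hdmap B hBd) _ (hcoef B hBc) β₁
  have hsplit : EA + β₂ * EB = (hasseDeriv j P).eval β₁ + (β₂ - α) * (hasseDeriv j (B.map φ)).eval β₁ := by
    rw [hP, map_add, hasse_C_mul, hasse_map, hasse_map, eval_add, eval_mul, eval_C]
    ring
  have hbn : ‖β₁‖ ≤ a + 1 := by
    calc ‖β₁‖ = ‖(β₁ - α) + α‖ := by ring_nf
      _ ≤ ‖β₁ - α‖ + ‖α‖ := norm_add_le _ _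
      _ ≤ a + 1 := by linarith
  have hN0 : N ≠ 0 := by rw [hN]; omega
  have hN2 : (N : ℝ) ≤ 2 ^ N := by exact_mod_cast (Nat.lt_two_pow_self (n := N)).le
  have h2a : (1 : ℝ) ≤ 2 + a := by linarith
  have hM : ((16 * (2 + a) ^ 2) ^ (d * T + 1) * (H : ℝ)) ^ k
      = 2 ^ N * (2 ^ N * (2 ^ N * (2 ^ N * ((H : ℝ) ^ k * (2 + a) ^ N) * (2 + a) ^ N))) := by
    rw [mul_pow, ← pow_mul, mul_pow, show (d * T + 1) * k = N by rw [hN]; ring, ← pow_mul,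
      show (16 : ℝ) = 2 * 2 * (2 * 2) by norm_num, mul_pow, mul_pow, mul_comm 2 N, pow_mul, sq]
    ring
  have hone : (1 : ℝ) ≤ 2 ^ N := one_le_pow₀ (by norm_num)
  have honea : (1 : ℝ) ≤ (2 + a) ^ N := one_le_pow₀ h2a
  have hHk : (1 : ℝ) ≤ (H : ℝ) ^ k := one_le_pow₀ (by exact_mod_cast hH1)
  rw [hsplit, mul_add]
  refine (norm_add_le _ _).trans (add_le_add ?_ ?_)
  · refine h1.trans ?_
    refine mul_le_mul ?_ (pow_le_pow_of_le_one (norm_nonneg _) hβ (by omega)) (by positivity) (by positivity)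
    rw [hM]
    have e1 : (1 + a) ≤ (2 + a) ^ N :=
      (by linarith : 1 + a ≤ 2 + a).trans (le_self_pow₀ h2a hN0)
    have e2 : (1 + a) ^ N ≤ (2 + a) ^ N := pow_le_pow_left₀ (by linarith) (by linarith) _
    rw [← ha]
    gcongr
  · rw [norm_mul, mul_comm]
    refine mul_le_mul_of_nonneg_right ?_ (norm_nonneg _)
    refine h2.trans ?_
    rw [hM]
    have e2 : (1 + ‖β₁‖) ^ N ≤ (2 + a) ^ N :=
      pow_le_pow_left₀ (by positivity) (by linarith) _
    calc (N : ℝ) * (2 ^ N * (H : ℝ) ^ k * (1 + ‖β₁‖) ^ N)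
        ≤ 2 ^ N * (2 ^ N * (H : ℝ) ^ k * (2 + a) ^ N) := by gcongr
      _ = 2 ^ N * (1 * (1 * (2 ^ N * ((H : ℝ) ^ k * (2 + a) ^ N) * 1))) := by ring
      _ ≤ 2 ^ N * (2 ^ N * (2 ^ N * (2 ^ N * ((H : ℝ) ^ k * (2 + a) ^ N) * (2 + a) ^ N))) :=
        mul_le_mul_of_nonneg_left (mul_le_mul hone (mul_le_mul hone
          (mul_le_mul_of_nonneg_left honea (by positivity)) (by positivity) (by positivity))
          (by positivity) (by positivity)) (by positivity)

end Thue

end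

section

namespace Thue
open Polynomial

lemma bounded_approx (g : ℤ[X]) (hg : g.Monic) (hirr : Irreducible g) (hd : 3 ≤ g.natDegree)
    (α : ℂ) (hα : (g.map (Int.castRingHom ℂ)).eval α = 0) (C0 : ℝ) (hC0 : 1 ≤ C0) :
    ∃ Y : ℤ, ∀ p q : ℤ, 0 < q → ‖(p : ℂ) / q - α‖ ≤ C0 / (q : ℝ) ^ g.natDegree → q ≤ Y := by
  set d := g.natDegree with hdd
  obtain ⟨M, hM1, hM⟩ := gap g hg hirr (by omega) (3 * d) (by omega) α hα
  rw [← hdd] at hM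
  by_contra! hcon
  obtain ⟨Y1, hY1⟩ := exists_int_gt (2 + C0 + M * C0 ^ (6 * d))
  obtain ⟨p₁, q₁, hq₁, ha₁, hb₁⟩ := hcon Y1
  have hCp : 1 ≤ C0 ^ (6 * d) := one_le_pow₀ hC0
  have hq1Y : 2 + C0 + M * C0 ^ (6 * d) < (q₁ : ℝ) := hY1.trans (by exact_mod_cast hb₁)
  have hMC : 0 ≤ M * C0 ^ (6 * d) := by positivity
  have hq12 : (2 : ℝ) ≤ q₁ := by linarith
  have hq1C : C0 ≤ (q₁ : ℝ) := by linarith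
  have hq1MC : M * C0 ^ (6 * d) ≤ (q₁ : ℝ) := by linarith
  have hq1M : M ≤ (q₁ : ℝ) := by nlinarith
  obtain ⟨p₂, q₂, hq₂, ha₂, hb₂⟩ := hcon ((q₁ ^ (6 * d)) ^ (d ^ 2 + 6 * d + 2))
  -- naturals
  lift q₁ to ℕ using hq₁.le
  lift q₂ to ℕ using hq₂.le
  have hq1n : 2 ≤ q₁ := by exact_mod_cast hq12
  set Q := q₁ ^ (6 * d) with hQ
  have hQ1 : 1 < Q := Nat.one_lt_pow (by omega) (by omega)
  have hq2n : Q ^ (d ^ 2 + 6 * d + 2) < q₂ := by exact_mod_cast hb₂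
  have hq20 : q₂ ≠ 0 := by omega
  set k := Nat.log Q q₂ with hk
  have hk1 : Q ^ k ≤ q₂ := Nat.pow_log_le_self _ hq20
  have hk2 : q₂ < Q ^ (k + 1) := Nat.lt_pow_succ_log_self hQ1 _
  have hkE : d ^ 2 + 6 * d + 2 ≤ k := Nat.le_log_of_pow_le hQ1 hq2n.le
  have hx1 : ‖(p₁ : ℂ) / (q₁ : ℤ) - α‖ ≤ 1 := by
    refine ha₁.trans ?_
    rw [div_le_one (by positivity)]
    exact hq1C.trans (le_self_pow₀ (by linarith) (by omega))
  have main := hM k (by omega) p₁ q₁ p₂ q₂ hq₁ hq₂ hx1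
  push_cast at main ha₁ ha₂ hq12 hq1C hq1MC hq1M hx1
  set x : ℝ := (q₁ : ℝ) with hx
  set z : ℝ := (q₂ : ℝ) with hz
  have hx0 : 0 < x := by linarith
  have hz0 : 0 < z := by rw [hz]; exact_mod_cast hq₂
  have hz1 : x ^ (6 * d * k) ≤ z := by
    rw [pow_mul, hx, hz]; exact_mod_cast hk1
  have hz2 : z ≤ x ^ (6 * d * (k + 1)) := by
    rw [pow_mul, hx, hz]; exact_mod_cast hk2.le
  set u := ‖(p₁ : ℂ) / (q₁ : ℂ) - α‖ with hu
  set v := ‖(p₂ : ℂ) / (q₂ : ℂ) - α‖ with hv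
  have hu0 : 0 ≤ u := norm_nonneg _
  set W := x ^ (d * (3 * d) * k + k) * z * M ^ k with hW
  have hW0 : 0 < W := by positivity
  set s := 2 * (3 * d) * k - (2 * k + d) with hs
  have hs' : s + (2 * k + d) = 6 * d * k := by
    have : 2 * k + d ≤ 2 * (3 * d) * k := by nlinarith
    have h6 : 2 * (3 * d) * k = 6 * d * k := by ring
    omega
  have main2 : 1 ≤ W * u ^ s + W * v := by
    calc (1 : ℝ) ≤ _ := main
      _ = _ := by rw [hW]; ring
  have hx1' : 1 ≤ x := by linarith
  have hxd : 0 < x ^ d := by positivity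
  rcases le_or_gt (1 / 2) (W * u ^ s) with h | h
  · have h1 : u ^ s ≤ C0 ^ s / (x ^ d) ^ s := by
      rw [← div_pow]; exact pow_le_pow_left₀ hu0 ha₁ _
    have h2 : 1 / 2 ≤ W * (C0 ^ s / (x ^ d) ^ s) := h.trans (by gcongr)
    have h3 : (x ^ d) ^ s ≤ 2 * (W * C0 ^ s) := by
      rw [mul_div_assoc', le_div_iff₀ (by positivity)] at h2
      linarith
    have h4 : W * C0 ^ s ≤ x ^ (d * (3 * d) * k + k) * x ^ (6 * d * (k + 1)) * x ^ k := by
      calc W * C0 ^ s ≤ W * C0 ^ (6 * d * k) := by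
            gcongr
            omega
        _ = x ^ (d * (3 * d) * k + k) * z * (M * C0 ^ (6 * d)) ^ k := by
            rw [hW, mul_pow, ← pow_mul]; ring
        _ ≤ _ := by gcongr
    have h5 : x ^ (d * s) ≤ x ^ (1 + (d * (3 * d) * k + k) + (6 * d * (k + 1)) + k) := by
      calc x ^ (d * s) = (x ^ d) ^ s := pow_mul _ _ _
        _ ≤ 2 * (W * C0 ^ s) := h3
        _ ≤ x * (x ^ (d * (3 * d) * k + k) * x ^ (6 * d * (k + 1)) * x ^ k) := by gcongr
        _ = _ := by ring
    have h6 := (pow_le_pow_iff_right₀ (by linarith : 1 < x)).1 h5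
    zify at h6 hs' hkE hd
    have hs'' : (s : ℤ) = 6 * d * k - 2 * k - d := by linarith
    rw [hs''] at h6
    have h7 : (0:ℤ) ≤ ((d:ℤ) - 3) * (3 * d + 1) * k := by
      have : (0:ℤ) ≤ (d:ℤ) - 3 := by linarith
      positivity
    nlinarith
  · have h' : 1 / 2 ≤ W * v := by linarith
    have h2 : 1 / 2 ≤ W * (C0 / z ^ d) := h'.trans (by gcongr)
    have h3 : z ^ d ≤ 2 * (W * C0) := by
      rw [mul_div_assoc', le_div_iff₀ (by positivity)] at h2
      linarith
    have h4 : z ^ (d - 1) ≤ x ^ (2 + (d * (3 * d) * k + k) + k) := by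
      have : z ^ d = z ^ (d - 1) * z := by
        rw [← pow_succ]; congr 1; omega
      refine le_of_mul_le_mul_right ?_ hz0
      rw [← this]
      calc z ^ d ≤ 2 * (W * C0) := h3
        _ = 2 * (x ^ (d * (3 * d) * k + k) * z * M ^ k * C0) := by rw [hW]
        _ ≤ x * (x ^ (d * (3 * d) * k + k) * z * x ^ k * x) := by gcongr
        _ = _ := by ring
    have h5 : x ^ (6 * d * k * (d - 1)) ≤ x ^ (2 + (d * (3 * d) * k + k) + k) := by
      rw [pow_mul]
      exact (pow_le_pow_left₀ (by positivity) hz1 _).trans h4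
    have h6 := (pow_le_pow_iff_right₀ (by linarith : 1 < x)).1 h5
    obtain ⟨e, he⟩ := Nat.exists_eq_add_of_le (show 1 ≤ d by omega)
    have : d - 1 = e := by omega
    rw [this] at h6
    zify at h6 hkE hd he
    have he' : (e : ℤ) = d - 1 := by linarith
    rw [he'] at h6
    have h7 : (0:ℤ) ≤ ((d:ℤ) - 3) * (3 * d + 1) * k := by
      have : (0:ℤ) ≤ (d:ℤ) - 3 := by linarith
      positivity
    nlinarith

end Thue

end

section

namespace Thue
open Polynomial IntermediateField

/-- approximations to roots of non-monic irreducible polynomials -/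
lemma bounded_approx' (g : ℤ[X]) (hirr : Irreducible g) (hd : 3 ≤ g.natDegree)
    (θ : ℂ) (hθ : (g.map (Int.castRingHom ℂ)).eval θ = 0) (C0 : ℝ) (hC0 : 1 ≤ C0) :
    ∃ Y : ℤ, ∀ p q : ℤ, 0 < q → ‖(p : ℂ) / q - θ‖ ≤ C0 / (q : ℝ) ^ g.natDegree → q ≤ Y := by
  have hg0 : g ≠ 0 := hirr.ne_zero
  set a := g.leadingCoeff with ha
  have ha0 : a ≠ 0 := leadingCoeff_ne_zero.2 hg0
  have haev : aeval θ g = 0 := by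
    rw [← eval_map_algebraMap]; exact hθ
  set α : ℂ := a • θ with hα
  have hintg : IsIntegral ℤ α := isIntegral_leadingCoeff_smul g θ haev
  have hmon := minpoly.monic hintg
  have hmirr := minpoly.irreducible hintg
  have hdeg : (minpoly ℤ α).natDegree = g.natDegree := by
    have hprim : g.IsPrimitive := hirr.isPrimitive (by omega)
    have hirrQ : Irreducible (g.map (Int.castRingHom ℚ)) :=
      (IsPrimitive.Int.irreducible_iff_irreducible_map_cast hprim).1 hirr
    have h1 : (minpoly ℤ α).natDegree = (minpoly ℚ α).natDegree := by
      rw [minpoly.isIntegrallyClosed_eq_field_fractions' ℚ hintg, natDegree_map_eq_of_injective]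
      exact Int.cast_injective
    have h2 : (minpoly ℚ θ).natDegree = g.natDegree := by
      rw [← minpoly.eq_of_irreducible hirrQ (x := θ)]
      · rw [natDegree_mul_C, natDegree_map_eq_of_injective]
        · exact Int.cast_injective
        · simpa using (Polynomial.map_ne_zero_iff (f := Int.castRingHom ℚ) Int.cast_injective).2 hg0
      · rw [← haev]
        rw [aeval_def, eval₂_map, aeval_def]
        congr 1
    have haC : (a : ℂ) ≠ 0 := by exact_mod_cast ha0
    have hadj : ℚ⟮α⟯ = ℚ⟮θ⟯ := by
      apply le_antisymm
      · rw [adjoin_simple_le_iff, hα]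
        exact zsmul_mem (mem_adjoin_simple_self ℚ θ) a
      · rw [adjoin_simple_le_iff]
        have : θ = (a : ℂ)⁻¹ * α := by rw [hα, zsmul_eq_mul]; field_simp
        rw [this]
        exact mul_mem (inv_mem (intCast_mem _ a)) (mem_adjoin_simple_self ℚ α)
    have hiα : IsIntegral ℚ α := hintg.tower_top
    have hiθ : IsIntegral ℚ θ := by
      have : θ = (a : ℂ)⁻¹ * α := by rw [hα, zsmul_eq_mul]; field_simp
      rw [this]
      refine IsIntegral.mul ?_ hiα
      have : (a : ℂ)⁻¹ = algebraMap ℚ ℂ ((a : ℚ)⁻¹) := by simp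
      rw [this]; exact isIntegral_algebraMap
    rw [h1, ← h2, ← adjoin.finrank hiα, ← adjoin.finrank hiθ, hadj]
  have hC1 : 1 ≤ C0 * |(a : ℝ)| := by
    have : (1 : ℝ) ≤ |(a : ℝ)| := by exact_mod_cast Int.one_le_abs ha0
    nlinarith
  obtain ⟨Y, hY⟩ := bounded_approx (minpoly ℤ α) hmon hmirr (hdeg ▸ hd) α
    ((eval_map_algebraMap (minpoly ℤ α) α).trans (minpoly.aeval ℤ α)) _ hC1
  refine ⟨Y, fun p q hq h => hY (a * p) q hq ?_⟩
  rw [hdeg]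
  have : ((a * p : ℤ) : ℂ) / q - α = a * ((p : ℂ) / q - θ) := by
    rw [hα, zsmul_eq_mul]; push_cast; ring
  rw [this, norm_mul, Complex.norm_intCast, mul_comm, mul_div_right_comm]
  exact mul_le_mul_of_nonneg_right h (abs_nonneg _)

/-- the binary form attached to a polynomial -/
def form (g : ℤ[X]) (x y : ℤ) : ℤ :=
  ∑ i ∈ Finset.range (g.natDegree + 1), g.coeff i * x ^ i * y ^ (g.natDegree - i)

lemma form_eq (g : ℤ[X]) (x y : ℤ) (hy : y ≠ 0) :
    ((form g x y : ℤ) : ℂ) = (y : ℂ) ^ g.natDegree * (g.map (Int.castRingHom ℂ)).eval ((x : ℂ) / y) := by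
  have hy' : (y : ℂ) ≠ 0 := by exact_mod_cast hy
  rw [eval_map, eval₂_eq_sum_range, form, Finset.mul_sum]
  push_cast
  refine Finset.sum_congr rfl fun i hi => ?_
  have hi' : i ≤ g.natDegree := by simpa [Nat.lt_succ_iff] using hi
  obtain ⟨e, he⟩ := Nat.exists_eq_add_of_le hi'
  rw [he, Nat.add_sub_cancel_left, pow_add, div_pow]
  simp only [eq_intCast]
  field_simp

lemma bounded_y (g : ℤ[X]) (hirr : Irreducible g) (hd : 3 ≤ g.natDegree) (m : ℤ) :
    ∃ Y : ℤ, ∀ x y : ℤ, y ≠ 0 → form g x y = m → |y| ≤ Y := by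
  classical
  set φ := Int.castRingHom ℂ with hφ
  have hg0 : g ≠ 0 := hirr.ne_zero
  have hinj : Function.Injective φ := Int.cast_injective
  set s := (g.map φ).roots with hs
  have hprim : g.IsPrimitive := hirr.isPrimitive (by omega)
  have hnodup : s.Nodup := by
    have hirrQ : Irreducible (g.map (Int.castRingHom ℚ)) :=
      (IsPrimitive.Int.irreducible_iff_irreducible_map_cast hprim).1 hirr
    have hsep := hirrQ.separable
    have := (hsep.map (f := algebraMap ℚ ℂ))
    rw [Polynomial.map_map] at this
    exact nodup_roots this
  have hcard : s.toFinset.card = g.natDegree := by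
    rw [Multiset.toFinset_card_of_nodup hnodup, hs,
      ← natDegree_map_eq_of_injective hinj g]
    exact (IsAlgClosed.splits (g.map φ)).natDegree_eq_card_roots.symm
  have heval : ∀ t : ℂ, (g.map φ).eval t = g.leadingCoeff * ∏ r ∈ s.toFinset, (t - r) := by
    intro t
    have h := (IsAlgClosed.splits (g.map φ)).eq_prod_roots
    conv_lhs => rw [h]
    rw [eval_mul, eval_C, leadingCoeff_map_of_injective hinj, eval_multiset_prod, Multiset.map_map,
      Finset.prod, Multiset.toFinset_val, hnodup.dedup]
    simp [hφ, hs]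
  -- separation
  obtain ⟨δ, hδ0, hδ1, hδ⟩ : ∃ δ : ℝ, 0 < δ ∧ δ ≤ 1 ∧ ∀ r ∈ s.toFinset, ∀ r' ∈ s.toFinset, r ≠ r' →
      2 * δ ≤ ‖r - r'‖ := by
    have hfin : (s.toFinset ×ˢ s.toFinset).Nonempty := by
      have : s.toFinset.Nonempty := by rw [← Finset.card_pos]; omega
      exact this.product this
    obtain ⟨z, hz, hmin⟩ := Finset.exists_min_image (s.toFinset ×ˢ s.toFinset)
      (fun z => if z.1 = z.2 then (1 : ℝ) else min 1 ‖z.1 - z.2‖) hfin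
    set μ := (if z.1 = z.2 then (1 : ℝ) else min 1 ‖z.1 - z.2‖) with hμ
    have hμ0 : 0 < μ := by
      rw [hμ]; split_ifs with h
      · exact one_pos
      · exact lt_min one_pos (norm_pos_iff.2 (sub_ne_zero.2 h))
    have hμ1 : μ ≤ 1 := by
      rw [hμ]; split_ifs with h
      · exact le_rfl
      · exact min_le_left _ _
    refine ⟨μ / 2, by linarith, by linarith, fun r hr r' hr' hne => ?_⟩
    have := hmin (r, r') (Finset.mem_product.2 ⟨hr, hr'⟩)
    simp only [hne, if_false] at this
    have := this.trans (min_le_right _ _)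
    linarith
  set C0 : ℝ := 1 + |(m : ℝ)| / δ ^ (g.natDegree - 1) with hC0
  have hC01 : 1 ≤ C0 := by rw [hC0]; linarith [show 0 ≤ |(m : ℝ)| / δ ^ (g.natDegree - 1) by positivity]
  have hY : ∀ r : ℂ, ∃ Y : ℤ, r ∈ s.toFinset → ∀ p q : ℤ, 0 < q →
      ‖(p : ℂ) / q - r‖ ≤ C0 / (q : ℝ) ^ g.natDegree → q ≤ Y := by
    intro r
    by_cases hr : r ∈ s.toFinset
    · obtain ⟨Y, hY⟩ := bounded_approx' g hirr hd r (by
        have : r ∈ (g.map φ).roots := Multiset.mem_toFinset.1 hr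
        exact (mem_roots'.1 this).2) C0 hC01
      exact ⟨Y, fun _ => hY⟩
    · exact ⟨0, fun h => absurd h hr⟩
  choose Y hY using hY
  refine ⟨∑ r ∈ s.toFinset, |Y r|, fun x y hy hxy => ?_⟩
  have hyR : (0 : ℝ) < |(y : ℝ)| := abs_pos.2 (by exact_mod_cast hy)
  obtain ⟨r, hr, hrmin⟩ := Finset.exists_min_image s.toFinset (fun r => ‖(x : ℂ) / y - r‖)
    (by rw [← Finset.card_pos]; omega)
  have hother : ∀ r' ∈ s.toFinset.erase r, δ ≤ ‖(x : ℂ) / y - r'‖ := by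
    intro r' hr'
    rw [Finset.mem_erase] at hr'
    have h1 := hδ r hr r' hr'.2 (Ne.symm hr'.1)
    have h2 := hrmin r' hr'.2
    have h3 : ‖r - r'‖ ≤ ‖(x : ℂ) / y - r'‖ + ‖(x : ℂ) / y - r‖ := by
      calc ‖r - r'‖ = ‖((x : ℂ) / y - r') - ((x : ℂ) / y - r)‖ := by ring_nf
        _ ≤ _ := norm_sub_le _ _
    linarith
  have key : ‖(x : ℂ) / y - r‖ ≤ C0 / |(y : ℝ)| ^ g.natDegree := by
    have h1 := form_eq g x y hy
    rw [hxy, heval, ← Finset.mul_prod_erase _ _ hr] at h1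
    have h2 := congrArg norm h1
    rw [norm_mul, norm_mul, norm_mul, norm_pow, Complex.norm_intCast, Complex.norm_intCast,
      Complex.norm_intCast, norm_prod] at h2
    have h3 : δ ^ (g.natDegree - 1) ≤ ∏ r' ∈ s.toFinset.erase r, ‖(x : ℂ) / y - r'‖ := by
      calc δ ^ (g.natDegree - 1) = ∏ r' ∈ s.toFinset.erase r, δ := by
            rw [Finset.prod_const, Finset.card_erase_of_mem hr, hcard]
        _ ≤ _ := Finset.prod_le_prod (fun _ _ => hδ0.le) hother
    have h4 : (1 : ℝ) ≤ |(g.leadingCoeff : ℝ)| := by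
      exact_mod_cast Int.one_le_abs (leadingCoeff_ne_zero.2 hg0)
    set D := δ ^ (g.natDegree - 1) with hD
    have hD0 : 0 < D := by positivity
    set u := ‖(x : ℂ) / y - r‖ with hu
    have hu0 : 0 ≤ u := norm_nonneg _
    have h5 : |(y : ℝ)| ^ g.natDegree * (1 * (u * D)) ≤ |(m : ℝ)| := by
      rw [h2]; gcongr
    rw [le_div_iff₀ (by positivity), hC0]
    have h6 : |(y : ℝ)| ^ g.natDegree * u ≤ |(m : ℝ)| / D := by
      rw [le_div_iff₀ hD0]; linarith
    linarith
  have hle : |y| ≤ Y r := by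
    rcases lt_or_gt_of_ne hy with h | h
    · rw [abs_of_neg h]
      refine hY r hr (-x) (-y) (by omega) ?_
      push_cast
      rw [neg_div_neg_eq]
      rw [abs_of_neg (by exact_mod_cast h)] at key
      exact key
    · rw [abs_of_pos h]
      refine hY r hr x y h ?_
      rw [abs_of_pos (by exact_mod_cast h)] at key
      exact key
  exact (hle.trans (le_abs_self _)).trans (Finset.single_le_sum (f := fun r => |Y r|) (fun _ _ => abs_nonneg _) hr)

theorem thue (g : ℤ[X]) (hirr : Irreducible g) (hd : 3 ≤ g.natDegree) (m : ℤ) :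
    {p : ℤ × ℤ | form g p.1 p.2 = m}.Finite := by
  obtain ⟨Y, hY⟩ := bounded_y g hirr hd m
  have hsub : {p : ℤ × ℤ | form g p.1 p.2 = m} ⊆
      ⋃ y ∈ Set.Icc (-|Y|) |Y|, (fun x => (x, y)) '' {x | form g x y = m} := by
    rintro ⟨x, y⟩ h
    have h : form g x y = m := h
    simp only [Set.mem_iUnion, Set.mem_image]
    refine ⟨y, ?_, x, h, rfl⟩
    rw [Set.mem_Icc, ← abs_le]
    by_cases hy : y = 0
    · simp [hy]
    · exact (hY x y hy h).trans (le_abs_self _)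
  refine Set.Finite.subset (Set.Finite.biUnion (Set.finite_Icc _ _) fun y _ => Set.Finite.image _ ?_) hsub
  set P : ℤ[X] := (∑ i ∈ Finset.range (g.natDegree + 1), C (g.coeff i * y ^ (g.natDegree - i)) * X ^ i) - C m
    with hP
  have hP0 : P ≠ 0 := by
    intro h0
    have := congrArg (fun p => p.coeff g.natDegree) h0
    simp only [hP, coeff_sub, finsetSum_coeff, coeff_C_mul, coeff_X_pow, coeff_zero, coeff_C] at this
    rw [Finset.sum_eq_single g.natDegree] at this
    · have h3 : g.natDegree ≠ 0 := by omega
      simp [h3] at this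
      exact hirr.ne_zero this
    · intro b _ hb
      rw [if_neg (Ne.symm hb)]; simp
    · simp
  refine (P.roots.toFinset.finite_toSet).subset fun x hx => ?_
  have hx : form g x y = m := hx
  simp only [Finset.mem_coe, Multiset.mem_toFinset, mem_roots hP0, IsRoot.def]
  rw [hP, eval_sub, eval_finsetSum, eval_C, ← hx, form, sub_eq_zero]
  refine Finset.sum_congr rfl fun i _ => ?_
  simp; ring

end Thue

end

section

namespace PIT
open MeasureTheory

/-- unit boxes -/
def ubox {ι : Type*} (n : ι → ℤ) : Set (ι → ℝ) :=
  Set.pi Set.univ (fun i => Set.Ico (n i : ℝ) ((n i : ℝ) + 1))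

lemma mem_ubox {ι : Type*} (n : ι → ℤ) (x : ι → ℝ) : x ∈ ubox n ↔ ∀ i, ⌊x i⌋ = n i := by
  simp [ubox, Int.floor_eq_iff]

lemma lattice_sum {ι : Type*} [Fintype ι] [Nonempty ι] (W : (ι → ℝ) → ℝ) (L B : ℝ) (hL : 0 ≤ L) (hB : 0 ≤ B)
    (hLip : ∀ x y, |W x - W y| ≤ L * ‖x - y‖) (hsupp : ∀ x, B < ‖x‖ → W x = 0) :
    ∃ C : ℝ, 0 ≤ C ∧ ∀ R : ℝ, 1 ≤ R →
      |∑' n : ι → ℤ, W (fun i => (n i : ℝ) / R) - R ^ Fintype.card ι * ∫ x, W x| ≤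
        C * R ^ (Fintype.card ι - 1) := by
  classical
  set d := Fintype.card ι with hd
  have hd0 : 0 < d := Fintype.card_pos
  refine ⟨L * (2 * B + 5) ^ d, by positivity, fun R hR => ?_⟩
  have hR0 : 0 < R := by linarith
  set g : (ι → ℝ) → ℝ := fun x => W (R⁻¹ • x) with hg
  have hcont : Continuous W := by
    have : LipschitzWith (Real.toNNReal L) W := by
      refine LipschitzWith.of_dist_le_mul fun x y => ?_
      rw [Real.dist_eq, dist_eq_norm, Real.coe_toNNReal L hL]
      exact hLip x y
    exact this.continuous
  have hcs : HasCompactSupport W := by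
    refine HasCompactSupport.intro (isCompact_closedBall (0 : ι → ℝ) B) fun x hx => ?_
    exact hsupp x (by simpa using hx)
  have hgc : Continuous g := hcont.comp (continuous_const_smul _)
  have hgcs : HasCompactSupport g := hcs.comp_smul (inv_ne_zero hR0.ne')
  have hgi : Integrable g := hgc.integrable_of_hasCompactSupport hgcs
  have hgsupp : ∀ x, R * B < ‖x‖ → g x = 0 := by
    intro x hx
    refine hsupp _ ?_
    rw [norm_smul, norm_inv, Real.norm_of_nonneg hR0.le, lt_inv_mul_iff₀ hR0]
    exact hx
  have hgint : ∫ x, g x = R ^ d * ∫ x, W x := by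
    rw [hg, Measure.integral_comp_smul]
    simp [hd, abs_of_pos hR0]
  have hgn : ∀ n : ι → ℤ, W (fun i => (n i : ℝ) / R) = g (fun i => (n i : ℝ)) := by
    intro n
    simp only [hg]
    congr 1
    ext i
    simp [div_eq_inv_mul]
  simp_rw [hgn]
  rw [← hgint]
  -- splitting the integral
  set K : ℤ := ⌈R * B⌉ + 1 with hK
  have hRB : 0 ≤ R * B := by positivity
  have hK1 : R * B + 1 ≤ K := by
    rw [hK]; push_cast; linarith [Int.le_ceil (R * B)]
  have hK2 : (K : ℝ) ≤ R * B + 2 := by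
    rw [hK]; push_cast; linarith [Int.ceil_lt_add_one (R * B)]
  have hK0 : 0 ≤ K := by
    have : (0 : ℝ) ≤ K := by linarith
    exact_mod_cast this
  set S : Finset (ι → ℤ) := Fintype.piFinset (fun _ => Finset.Icc (-K) K) with hS
  have hbm : ∀ n : ι → ℤ, MeasurableSet (ubox n) := fun n =>
    MeasurableSet.univ_pi fun i => measurableSet_Ico
  have hbd : Pairwise (Function.onFun Disjoint (ubox (ι := ι))) := by
    intro n m hnm
    rw [Function.onFun, Set.disjoint_left]
    intro x hx hx'
    rw [mem_ubox] at hx hx'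
    exact hnm (funext fun i => (hx i).symm.trans (hx' i))
  have hbu : (⋃ n : ι → ℤ, ubox n) = Set.univ := by
    refine Set.eq_univ_of_forall fun x => ?_
    exact Set.mem_iUnion.2 ⟨fun i => ⌊x i⌋, (mem_ubox _ _).2 fun i => rfl⟩
  have hvol : ∀ n : ι → ℤ, volume.real (ubox n) = 1 := by
    intro n
    rw [measureReal_def, ubox, Real.volume_pi_Ico]
    simp
  have hout : ∀ n ∉ S, ∀ x ∈ ubox n, g x = 0 := by
    intro n hn x hx
    rw [hS, Fintype.mem_piFinset] at hn
    push Not at hn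
    obtain ⟨i, hi⟩ := hn
    apply hgsupp
    refine lt_of_lt_of_le ?_ (norm_le_pi_norm x i)
    rw [mem_ubox] at hx
    have hxi := hx i
    rw [Int.floor_eq_iff] at hxi
    rw [Finset.mem_Icc, not_and_or, not_le, not_le] at hi
    rw [Real.norm_eq_abs]
    rcases hi with hi | hi
    · have : n i + 1 ≤ -K := by omega
      have : (n i : ℝ) + 1 ≤ -K := by exact_mod_cast this
      have := neg_le_abs (x i)
      linarith
    · have : (K : ℝ) < n i := by exact_mod_cast hi
      have := le_abs_self (x i)
      linarith
  have hmemn : ∀ n : ι → ℤ, (fun i => (n i : ℝ)) ∈ ubox n := fun n => by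
    rw [mem_ubox]; intro i; simp
  have hsum1 : ∑' n : ι → ℤ, g (fun i => (n i : ℝ)) = ∑ n ∈ S, g (fun i => (n i : ℝ)) :=
    tsum_eq_sum fun n hn => hout n hn _ (hmemn n)
  have hsum2 : ∫ x, g x = ∑ n ∈ S, ∫ x in ubox n, g x := by
    rw [← setIntegral_univ, ← hbu, integral_iUnion hbm hbd hgi.integrableOn]
    exact tsum_eq_sum fun n hn => setIntegral_eq_zero_of_forall_eq_zero (hout n hn)
  rw [hsum1, hsum2, ← Finset.sum_sub_distrib]
  have hterm : ∀ n : ι → ℤ, |g (fun i => (n i : ℝ)) - ∫ x in ubox n, g x| ≤ L / R := by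
    intro n
    have h1 : g (fun i => (n i : ℝ)) - ∫ x in ubox n, g x
        = ∫ x in ubox n, (g (fun i => (n i : ℝ)) - g x) := by
      rw [integral_sub _ hgi.integrableOn, setIntegral_const, hvol, one_smul]
      refine integrableOn_const ?_
      have := hvol n
      intro h
      rw [measureReal_def, h] at this
      simp at this
    rw [h1, ← Real.norm_eq_abs]
    have := norm_setIntegral_le_of_norm_le_const (μ := volume) (s := ubox n) (C := L / R)
      (f := fun x => g (fun i => (n i : ℝ)) - g x) ?_ ?_
    · rwa [hvol, mul_one] at this
    · have := hvol n
      rw [measureReal_def] at this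
      by_contra h
      rw [not_lt, top_le_iff] at h
      rw [h] at this; simp at this
    · intro x hx
      rw [Real.norm_eq_abs]
      refine (hLip _ _).trans ?_
      rw [← smul_sub, norm_smul, norm_inv, Real.norm_of_nonneg hR0.le, div_eq_mul_inv]
      refine mul_le_mul_of_nonneg_left ?_ hL
      refine mul_le_of_le_one_right (by positivity) ?_
      rw [pi_norm_le_iff_of_nonneg zero_le_one]
      intro i
      rw [mem_ubox] at hx
      have hxi := hx i
      rw [Int.floor_eq_iff] at hxi
      rw [Pi.sub_apply, Real.norm_eq_abs, abs_le]
      constructor <;> linarith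
  refine (Finset.abs_sum_le_sum_abs _ _).trans ?_
  refine (Finset.sum_le_card_nsmul _ _ _ fun n _ => hterm n).trans ?_
  have hcard : (S.card : ℝ) ≤ ((2 * B + 5) * R) ^ d := by
    rw [hS, Fintype.card_piFinset]
    simp only [Finset.prod_const, Finset.card_univ, Int.card_Icc]
    push_cast
    rw [← hd]
    refine pow_le_pow_left₀ (by positivity) ?_ _
    have : (((K + 1 - -K).toNat : ℤ) : ℝ) = 2 * K + 1 := by
      rw [Int.toNat_of_nonneg (by omega)]; push_cast; ring
    have h2 : (((K + 1 - -K).toNat : ℕ) : ℝ) = 2 * K + 1 := by exact_mod_cast this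
    rw [h2]
    nlinarith
  rw [nsmul_eq_mul]
  have hRd : R ^ d = R ^ (d - 1) * R := by rw [← pow_succ]; congr 1; omega
  calc (S.card : ℝ) * (L / R) ≤ ((2 * B + 5) * R) ^ d * (L / R) := by gcongr
    _ = L * (2 * B + 5) ^ d * R ^ (d - 1) := by
      rw [mul_pow, hRd]; field_simp

end PIT

end

section

namespace PIT
open NumberField NumberField.mixedEmbedding NumberField.InfinitePlace NumberField.Units
  NumberField.Units.dirichletUnitTheorem Module

/-- the hat function -/
noncomputable def hat (v : ℝ) : ℝ := max 0 (1 - |v|)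

lemma hat_nonneg (v : ℝ) : 0 ≤ hat v := le_max_left _ _
lemma hat_le_one (v : ℝ) : hat v ≤ 1 := max_le zero_le_one (by linarith [abs_nonneg v])
lemma hat_eq_zero {v : ℝ} (h : 1 ≤ |v|) : hat v = 0 := max_eq_left (by linarith)
lemma abs_lt_of_hat {v : ℝ} (h : hat v ≠ 0) : |v| < 1 := by
  by_contra h'
  exact h (hat_eq_zero (not_lt.1 h'))
lemma hat_lip (u v : ℝ) : |hat u - hat v| ≤ |u - v| := by
  unfold hat
  refine (abs_max_sub_max_le_max _ _ _ _).trans ?_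
  rw [sub_self, abs_zero, sub_sub_sub_cancel_left]
  refine max_le (abs_nonneg _) ?_
  rw [abs_sub_comm u v]
  exact abs_abs_sub_abs_le _ _
lemma hat_cont : Continuous hat := by unfold hat; fun_prop

lemma prod_diff {ι : Type*} (s : Finset ι) (a b : ι → ℝ) (ha : ∀ i, 0 ≤ a i ∧ a i ≤ 1)
    (hb : ∀ i, 0 ≤ b i ∧ b i ≤ 1) :
    |∏ i ∈ s, a i - ∏ i ∈ s, b i| ≤ ∑ i ∈ s, |a i - b i| := by
  classical
  induction s using Finset.induction_on with
  | empty => simp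
  | insert i s hi ih =>
    rw [Finset.prod_insert hi, Finset.prod_insert hi, Finset.sum_insert hi]
    have h1 : a i * ∏ j ∈ s, a j - b i * ∏ j ∈ s, b j
      = (a i - b i) * ∏ j ∈ s, a j + b i * (∏ j ∈ s, a j - ∏ j ∈ s, b j) := by ring
    rw [h1]
    refine (abs_add_le _ _).trans (add_le_add ?_ ?_)
    · rw [abs_mul]
      refine mul_le_of_le_one_right (abs_nonneg _) ?_
      rw [abs_of_nonneg (Finset.prod_nonneg fun j _ => (ha j).1)]
      exact Finset.prod_le_one (fun j _ => (ha j).1) fun j _ => (ha j).2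
    · rw [abs_mul, abs_of_nonneg (hb i).1]
      exact (mul_le_of_le_one_left (abs_nonneg _) (hb i).2).trans ih

open scoped Classical

variable (K : Type*) [Field K] [NumberField K]

/-- basis of the log space given by units -/
noncomputable def ubasis : Basis (Fin (rank K)) ℝ (logSpace K) :=
  (basisUnitLattice K).ofZLatticeBasis ℝ _

/-- the unit partition function -/
noncomputable def uphi (z : mixedSpace K) : ℝ :=
  ∏ j, hat ((ubasis K).equivFun (logMap z) j)

noncomputable def wfun (z : mixedSpace K) : ℝ :=
  if mixedEmbedding.norm z = 0 then 0 else hat (Real.log (mixedEmbedding.norm z)) * uphi K z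

lemma uphi_nonneg (z : mixedSpace K) : 0 ≤ uphi K z := Finset.prod_nonneg fun _ _ => hat_nonneg _
lemma uphi_le_one (z : mixedSpace K) : uphi K z ≤ 1 :=
  Finset.prod_le_one (fun _ _ => hat_nonneg _) fun _ _ => hat_le_one _
lemma wfun_nonneg (z : mixedSpace K) : 0 ≤ wfun K z := by
  unfold wfun
  split_ifs
  · exact le_rfl
  · exact mul_nonneg (hat_nonneg _) (uphi_nonneg _ _)
lemma wfun_le_one (z : mixedSpace K) : wfun K z ≤ 1 := by
  unfold wfun
  split_ifs
  · exact zero_le_one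
  · exact mul_le_one₀ (hat_le_one _) (uphi_nonneg _ _) (uphi_le_one _ _)

lemma log_norm_eq {z : mixedSpace K} (hz : mixedEmbedding.norm z ≠ 0) :
    Real.log (mixedEmbedding.norm z) = ∑ w, (mult w : ℝ) * Real.log (normAtPlace w z) := by
  rw [mixedEmbedding.norm_apply, Real.log_prod]
  · simp
  · intro w _
    exact pow_ne_zero _ (mixedEmbedding.norm_ne_zero_iff.1 hz w)

lemma wfun_supp : ∃ B : ℝ, 0 ≤ B ∧ ∀ z : mixedSpace K, wfun K z ≠ 0 →
    ∀ w, |Real.log (normAtPlace w z)| ≤ B := by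
  set e := (ubasis K).equivFunL with he
  obtain ⟨C, hC0, hC⟩ : ∃ C : ℝ, 0 ≤ C ∧ ∀ v, ‖e.symm v‖ ≤ C * ‖v‖ :=
    ⟨‖(e.symm : (Fin (rank K) → ℝ) →L[ℝ] logSpace K)‖, norm_nonneg _,
      (e.symm : (Fin (rank K) → ℝ) →L[ℝ] logSpace K).le_opNorm⟩
  have hd : 0 < (finrank ℚ K : ℝ) := by exact_mod_cast finrank_pos
  refine ⟨(C + 1) + (1 + ∑ w : InfinitePlace K, (mult w : ℝ) * (C + 1)), by positivity, fun z hz => ?_⟩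
  unfold wfun at hz
  split_ifs at hz with h0
  · exact absurd rfl hz
  have h1 := abs_lt_of_hat (left_ne_zero_of_mul hz)
  have h2 := right_ne_zero_of_mul hz
  unfold uphi at h2
  rw [Finset.prod_ne_zero_iff] at h2
  have h3 : ‖logMap z‖ ≤ C := by
    have := hC (e (logMap z))
    rw [ContinuousLinearEquiv.symm_apply_apply] at this
    refine this.trans (mul_le_of_le_one_right hC0 ?_)
    rw [pi_norm_le_iff_of_nonneg zero_le_one]
    intro j
    exact (abs_lt_of_hat (h2 j (Finset.mem_univ _))).le
  have h4 : ∀ w : InfinitePlace K, w ≠ w₀ → |Real.log (normAtPlace w z)| ≤ C + 1 := by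
    intro w hw
    have h5 := (norm_le_pi_norm (logMap z) ⟨w, hw⟩).trans h3
    rw [logMap_apply, Real.norm_eq_abs, abs_mul] at h5
    have hm : (1 : ℝ) ≤ |(mult w : ℝ)| := by
      rw [Nat.abs_cast]; exact_mod_cast mult_pos
    have h6 : |Real.log (normAtPlace w z) - Real.log (mixedEmbedding.norm z) * (finrank ℚ K : ℝ)⁻¹| ≤ C :=
      (le_mul_of_one_le_left (abs_nonneg _) hm).trans h5
    have h7 : |Real.log (mixedEmbedding.norm z) * (finrank ℚ K : ℝ)⁻¹| ≤ 1 := by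
      rw [abs_mul, abs_inv, abs_of_pos hd]
      have : (finrank ℚ K : ℝ)⁻¹ ≤ 1 := inv_le_one_of_one_le₀ (by exact_mod_cast finrank_pos)
      exact mul_le_one₀ h1.le (by positivity) this
    have := abs_sub_abs_le_abs_sub (Real.log (normAtPlace w z)) (Real.log (mixedEmbedding.norm z) * (finrank ℚ K : ℝ)⁻¹)
    linarith
  have hS : 0 ≤ ∑ w : InfinitePlace K, (mult w : ℝ) * (C + 1) := by positivity
  intro w
  by_cases hw : w = w₀
  · have h8 := log_norm_eq K h0
    rw [← Finset.add_sum_erase _ _ (Finset.mem_univ (w₀ : InfinitePlace K))] at h8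
    have h9 : |∑ w ∈ Finset.univ.erase (w₀ : InfinitePlace K), (mult w : ℝ) * Real.log (normAtPlace w z)|
        ≤ ∑ w : InfinitePlace K, (mult w : ℝ) * (C + 1) := by
      refine (Finset.abs_sum_le_sum_abs _ _).trans ?_
      refine le_trans ?_ (Finset.sum_le_sum_of_subset_of_nonneg (Finset.erase_subset (w₀ : InfinitePlace K) Finset.univ)
        fun _ _ _ => by positivity)
      refine Finset.sum_le_sum fun w hw => ?_
      rw [abs_mul, Nat.abs_cast]
      exact mul_le_mul_of_nonneg_left (h4 w (Finset.ne_of_mem_erase hw)) (by positivity)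
    have hm : (1 : ℝ) ≤ (mult (w₀ : InfinitePlace K) : ℝ) := by exact_mod_cast mult_pos
    have h10 : |(mult (w₀ : InfinitePlace K) : ℝ) * Real.log (normAtPlace w₀ z)| ≤
        1 + ∑ w : InfinitePlace K, (mult w : ℝ) * (C + 1) := by
      have h11 : (mult (w₀ : InfinitePlace K) : ℝ) * Real.log (normAtPlace w₀ z)
        = Real.log (mixedEmbedding.norm z) - ∑ w ∈ Finset.univ.erase (w₀ : InfinitePlace K), (mult w : ℝ) * Real.log (normAtPlace w z) := by
        linarith
      rw [h11]
      exact (abs_sub _ _).trans (add_le_add h1.le h9)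
    rw [hw]
    rw [abs_mul, Nat.abs_cast] at h10
    have h12 := (le_mul_of_one_le_left (abs_nonneg (Real.log (normAtPlace (w₀ : InfinitePlace K) z))) hm).trans h10
    linarith
  · have := h4 w hw
    linarith

lemma normAtPlace_le_norm (w : InfinitePlace K) (z : mixedSpace K) : normAtPlace w z ≤ ‖z‖ := by
  rw [norm_eq_sup'_normAtPlace]
  exact Finset.le_sup' (fun w => normAtPlace w z) (Finset.mem_univ w)

lemma normAtPlace_sub_le (w : InfinitePlace K) (z z' : mixedSpace K) :
    normAtPlace w z - normAtPlace w z' ≤ ‖z - z'‖ := by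
  have h1 := normAtPlace_add_le w (z - z') z'
  rw [sub_add_cancel] at h1
  linarith [normAtPlace_le_norm K w (z - z')]

lemma log_lip {a b m : ℝ} (hm : 0 < m) (ha : m ≤ a) (hb : m ≤ b) :
    |Real.log a - Real.log b| ≤ m⁻¹ * |a - b| := by
  have key : ∀ a b : ℝ, m ≤ a → m ≤ b → Real.log a - Real.log b ≤ m⁻¹ * |a - b| := by
    intro a b ha hb
    have ha0 : 0 < a := by linarith
    have hb0 : 0 < b := by linarith
    rw [← Real.log_div ha0.ne' hb0.ne']
    refine (Real.log_le_sub_one_of_pos (by positivity)).trans ?_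
    have : a / b - 1 = b⁻¹ * (a - b) := by field_simp
    rw [this]
    exact (mul_le_mul_of_nonneg_left (le_abs_self _) (by positivity)).trans
        (mul_le_mul_of_nonneg_right (inv_anti₀ hm hb) (abs_nonneg _))
  rw [abs_le']
  refine ⟨key a b ha hb, ?_⟩
  have := key b a hb ha
  rw [abs_sub_comm] at this
  linarith

lemma wfun_bdd : ∃ B : ℝ, 0 ≤ B ∧ ∀ z : mixedSpace K, B < ‖z‖ → wfun K z = 0 := by
  obtain ⟨B, hB0, hB⟩ := wfun_supp K
  refine ⟨Real.exp B, by positivity, fun z hz => ?_⟩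
  by_contra h
  have h1 := hB z h
  rw [norm_eq_sup'_normAtPlace] at hz
  obtain ⟨w, -, hw⟩ := (Finset.lt_sup'_iff _).1 hz
  have h2 := (abs_le.1 (h1 w)).2
  have hp : 0 < normAtPlace w z := (Real.exp_pos B).trans hw
  rw [Real.log_le_iff_le_exp hp] at h2
  linarith

lemma wfun_lip : ∃ L : ℝ, 0 ≤ L ∧ ∀ z z' : mixedSpace K, |wfun K z - wfun K z'| ≤ L * ‖z - z'‖ := by
  obtain ⟨B, hB0, hB⟩ := wfun_supp K
  set e := (ubasis K).equivFunL with he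
  obtain ⟨C, hC0, hC⟩ : ∃ C : ℝ, 0 ≤ C ∧ ∀ v, ‖e v‖ ≤ C * ‖v‖ :=
    ⟨‖(e : logSpace K →L[ℝ] (Fin (rank K) → ℝ))‖, norm_nonneg _,
      (e : logSpace K →L[ℝ] (Fin (rank K) → ℝ)).le_opNorm⟩
  have hd : 0 < (finrank ℚ K : ℝ) := by exact_mod_cast finrank_pos
  set m := Real.exp (-B) / 2 with hm
  have hm0 : 0 < m := by positivity
  set D : ℝ := ∑ w : InfinitePlace K, (mult w : ℝ) with hD
  have hD0 : 0 ≤ D := by positivity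
  have hmD : ∀ w : InfinitePlace K, (mult w : ℝ) ≤ D := fun w =>
    Finset.single_le_sum (f := fun w : InfinitePlace K => (mult w : ℝ)) (fun _ _ => by positivity) (Finset.mem_univ w)
  set L : ℝ := D * m⁻¹ + rank K * (C * (D * (m⁻¹ + D * m⁻¹))) + m⁻¹ with hL
  have hL0 : 0 ≤ L := by positivity
  have key : ∀ z z' : mixedSpace K, wfun K z ≠ 0 → |wfun K z - wfun K z'| ≤ L * ‖z - z'‖ := by
    intro z z' hz
    rcases le_or_gt m ‖z - z'‖ with h | h
    · have h1 : |wfun K z - wfun K z'| ≤ 1 := by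
        rw [abs_le]
        constructor <;> linarith [wfun_nonneg K z, wfun_nonneg K z', wfun_le_one K z, wfun_le_one K z']
      have h2 : 1 ≤ m⁻¹ * ‖z - z'‖ := by
        rw [le_inv_mul_iff₀ hm0]; linarith
      have h3 : m⁻¹ * ‖z - z'‖ ≤ L * ‖z - z'‖ := by
        refine mul_le_mul_of_nonneg_right ?_ (norm_nonneg _)
        rw [hL]
        linarith [show 0 ≤ D * m⁻¹ + rank K * (C * (D * (m⁻¹ + D * m⁻¹))) by positivity]
      linarith
    · set t := ‖z - z'‖ with ht
      have ht0 : 0 ≤ t := norm_nonneg _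
      have hn0 : mixedEmbedding.norm z ≠ 0 := by
        intro h0
        exact hz (by unfold wfun; rw [if_pos h0])
      have hz1 : ∀ w, 2 * m ≤ normAtPlace w z := by
        intro w
        have h1 := (abs_le.1 (hB z hz w)).1
        have hp : 0 < normAtPlace w z :=
          lt_of_le_of_ne (normAtPlace_nonneg _ _) (Ne.symm (mixedEmbedding.norm_ne_zero_iff.1 hn0 w))
        rw [Real.le_log_iff_exp_le hp] at h1
        rw [hm]; linarith
      have hz2 : ∀ w, m ≤ normAtPlace w z' := by
        intro w
        have := normAtPlace_sub_le K w z z'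
        linarith [hz1 w]
      have hn0' : mixedEmbedding.norm z' ≠ 0 :=
        mixedEmbedding.norm_ne_zero_iff.2 fun w => (hm0.trans_le (hz2 w)).ne'
      have hlog : ∀ w, |Real.log (normAtPlace w z) - Real.log (normAtPlace w z')| ≤ m⁻¹ * t := by
        intro w
        refine (log_lip hm0 (by linarith [hz1 w]) (hz2 w)).trans ?_
        refine mul_le_mul_of_nonneg_left ?_ (by positivity)
        rw [abs_le']
        refine ⟨normAtPlace_sub_le K w z z', ?_⟩
        have := normAtPlace_sub_le K w z' z
        rw [norm_sub_rev] at this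
        linarith
      have hlogn : |Real.log (mixedEmbedding.norm z) - Real.log (mixedEmbedding.norm z')| ≤ D * m⁻¹ * t := by
        rw [log_norm_eq K hn0, log_norm_eq K hn0', ← Finset.sum_sub_distrib]
        refine (Finset.abs_sum_le_sum_abs _ _).trans ?_
        rw [hD, mul_assoc, Finset.sum_mul]
        refine Finset.sum_le_sum fun w _ => ?_
        rw [← mul_sub, abs_mul, Nat.abs_cast]
        exact mul_le_mul_of_nonneg_left (hlog w) (by positivity)
      have hlm : ‖logMap z - logMap z'‖ ≤ D * (m⁻¹ + D * m⁻¹) * t := by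
        rw [pi_norm_le_iff_of_nonneg (by positivity)]
        intro w
        rw [Pi.sub_apply, logMap_apply, logMap_apply, ← mul_sub, Real.norm_eq_abs, abs_mul, Nat.abs_cast, mul_assoc]
        refine mul_le_mul (hmD _) ?_ (abs_nonneg _) hD0
        rw [sub_sub_sub_comm, ← sub_mul]
        refine (abs_sub _ _).trans ?_
        rw [add_mul]
        refine add_le_add (hlog _) ?_
        rw [abs_mul, abs_inv, abs_of_pos hd]
        have : (finrank ℚ K : ℝ)⁻¹ ≤ 1 := inv_le_one_of_one_le₀ (by exact_mod_cast finrank_pos)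
        exact (mul_le_of_le_one_right (abs_nonneg _) this).trans hlogn
      have hphi : |uphi K z - uphi K z'| ≤ rank K * (C * (D * (m⁻¹ + D * m⁻¹))) * t := by
        unfold uphi
        refine (prod_diff _ _ _ (fun i => ⟨hat_nonneg _, hat_le_one _⟩) (fun i => ⟨hat_nonneg _, hat_le_one _⟩)).trans ?_
        refine (Finset.sum_le_card_nsmul _ _ (C * (D * (m⁻¹ + D * m⁻¹)) * t) fun j _ => ?_).trans ?_
        · refine (hat_lip _ _).trans ?_
          have h1 : ‖e (logMap z - logMap z')‖ ≤ C * (D * (m⁻¹ + D * m⁻¹) * t) :=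
            (hC _).trans (mul_le_mul_of_nonneg_left hlm hC0)
          have h2 := (norm_le_pi_norm (e (logMap z - logMap z')) j).trans h1
          rw [map_sub] at h2
          rw [mul_assoc]
          exact h2
        · simp [mul_assoc]
      unfold wfun
      rw [if_neg hn0, if_neg hn0']
      have := prod_diff (Finset.univ : Finset (Fin 2)) ![hat (Real.log (mixedEmbedding.norm z)), uphi K z]
        ![hat (Real.log (mixedEmbedding.norm z')), uphi K z'] (by
          intro i; fin_cases i
          · exact ⟨hat_nonneg _, hat_le_one _⟩
          · exact ⟨uphi_nonneg _ _, uphi_le_one _ _⟩) (by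
          intro i; fin_cases i
          · exact ⟨hat_nonneg _, hat_le_one _⟩
          · exact ⟨uphi_nonneg _ _, uphi_le_one _ _⟩)
      simp only [Fin.prod_univ_two, Fin.sum_univ_two, Matrix.cons_val_zero, Matrix.cons_val_one] at this
      refine this.trans ?_
      have h1 := (hat_lip (Real.log (mixedEmbedding.norm z)) (Real.log (mixedEmbedding.norm z'))).trans hlogn
      have h2 : 0 ≤ m⁻¹ * t := by positivity
      rw [hL]
      linarith
  refine ⟨L, hL0, fun z z' => ?_⟩
  by_cases hz : wfun K z = 0
  · by_cases hz' : wfun K z' = 0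
    · rw [hz, hz', sub_self, abs_zero]; positivity
    · rw [abs_sub_comm, norm_sub_rev]; exact key z' z hz'
  · exact key z z' hz

lemma sum_hat (c : ℝ) : ∑ k ∈ Finset.Icc (-⌊c⌋ - 1) (-⌊c⌋), hat (c + k) = 1 := by
  have h : Finset.Icc (-⌊c⌋ - 1) (-⌊c⌋) = {-⌊c⌋ - 1, -⌊c⌋} := by
    ext x; simp only [Finset.mem_Icc, Finset.mem_insert, Finset.mem_singleton]; omega
  have h1 := Int.floor_le c
  have h2 := Int.lt_floor_add_one c
  rw [h, Finset.sum_pair (by omega)]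
  unfold hat
  push_cast
  rw [abs_of_nonpos (by linarith), abs_of_nonneg (by linarith), max_eq_right (by linarith),
    max_eq_right (by linarith)]
  ring

lemma hat_out (c : ℝ) (k : ℤ) (hk : k ∉ Finset.Icc (-⌊c⌋ - 1) (-⌊c⌋)) : hat (c + k) = 0 := by
  apply hat_eq_zero
  have h1 := Int.floor_le c
  have h2 := Int.lt_floor_add_one c
  rw [Finset.mem_Icc, not_and_or, not_le, not_le] at hk
  rcases hk with hk | hk
  · have : (k : ℝ) + 1 ≤ -⌊c⌋ - 1 := by exact_mod_cast hk
    rw [abs_of_nonpos (by linarith)]; linarith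
  · have : (-⌊c⌋ : ℝ) + 1 ≤ k := by exact_mod_cast hk
    rw [abs_of_nonneg (by linarith)]; linarith

lemma hasSum_hat {n : ℕ} (c : Fin n → ℝ) : HasSum (fun k : Fin n → ℤ => ∏ j, hat (c j + k j)) 1 := by
  have h1 : ∑ k ∈ Fintype.piFinset (fun j => Finset.Icc (-⌊c j⌋ - 1) (-⌊c j⌋)), ∏ j, hat (c j + k j) = 1 := by
    rw [← Finset.prod_univ_sum (fun j => Finset.Icc (-⌊c j⌋ - 1) (-⌊c j⌋)) (fun j k => hat (c j + k))]
    exact Finset.prod_eq_one fun j _ => sum_hat (c j)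
  rw [← h1]
  refine hasSum_sum_of_ne_finset_zero fun k hk => ?_
  rw [Fintype.mem_piFinset] at hk
  push Not at hk
  obtain ⟨j, hj⟩ := hk
  exact Finset.prod_eq_zero (Finset.mem_univ j) (hat_out _ _ hj)

/-- units as torsion times lattice -/
noncomputable def unitsEquiv : (torsion K × (Fin (rank K) → ℤ)) ≃ (𝓞 K)ˣ :=
  Equiv.ofBijective (fun p => (p.1 : (𝓞 K)ˣ) * ∏ i, fundSystem K i ^ p.2 i) (by
    constructor
    · intro p q h
      exact (exist_unique_eq_mul_prod K _).unique rfl h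
    · intro x
      obtain ⟨p, hp, -⟩ := exist_unique_eq_mul_prod K x
      exact ⟨p, hp.symm⟩)

lemma uphi_unit (p : torsion K × (Fin (rank K) → ℤ)) (z : mixedSpace K) (hz : mixedEmbedding.norm z ≠ 0) :
    uphi K (unitsEquiv K p • z) = ∏ j, hat ((ubasis K).equivFun (logMap z) j + p.2 j) := by
  unfold uphi
  have h : logMap (unitsEquiv K p • z) = logMap z + ∑ i, (p.2 i : ℝ) • (ubasis K) i := by
    have h1 : unitsEquiv K p • z = (p.1 : (𝓞 K)ˣ) • ((∏ i, fundSystem K i ^ p.2 i) • z) := by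
      rw [← mul_smul]; rfl
    rw [h1, logMap_torsion_smul _ p.1.2, logMap_unit_smul _ hz, add_comm]
    congr 1
    rw [ofMul_prod, map_sum]
    refine Finset.sum_congr rfl fun i _ => ?_
    rw [ofMul_zpow, map_zsmul, logEmbedding_fundSystem, ubasis, Basis.ofZLatticeBasis_apply,
      Int.cast_smul_eq_zsmul]
  refine Finset.prod_congr rfl fun j _ => ?_
  rw [h, map_add, Pi.add_apply]
  congr 2
  rw [map_sum, Finset.sum_apply]
  simp [Finsupp.single_apply]

lemma hasSum_snd {α β : Type*} [Finite α] (g : β → ℝ) (hg : ∀ k, 0 ≤ g k) (S : ℝ) (h : HasSum g S) :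
    HasSum (fun p : α × β => g p.2) (Nat.card α * S) := by
  have h3 : HasSum (fun _ : α => (1 : ℝ)) (Nat.card α) := by
    have := Fintype.ofFinite α
    have := hasSum_fintype (fun _ : α => (1 : ℝ))
    rw [Nat.card_eq_fintype_card]
    simpa using this
  have h4 := h3.mul h (h3.summable.mul_of_nonneg h.summable (fun _ => zero_le_one) hg)
  simpa only [one_mul] using h4

lemma hasSum_uphi (z : mixedSpace K) (hz : mixedEmbedding.norm z ≠ 0) :
    HasSum (fun u : (𝓞 K)ˣ => uphi K (u • z)) (torsionOrder K) := by
  rw [← (unitsEquiv K).hasSum_iff]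
  have h1 : (fun u : (𝓞 K)ˣ => uphi K (u • z)) ∘ (unitsEquiv K)
      = fun p => (fun k : Fin (rank K) → ℤ =>
          ∏ j, hat ((ubasis K).equivFun (logMap z) j + k j)) p.2 := by
    funext p; exact uphi_unit K p z hz
  rw [h1]
  have h2 := hasSum_hat (fun j => (ubasis K).equivFun (logMap z) j)
  have h4 := hasSum_snd (α := torsion K) _
    (fun k => Finset.prod_nonneg fun _ _ => hat_nonneg _) _ h2
  rw [mul_one] at h4
  exact h4

end PIT

end

section

namespace PIT
open NumberField NumberField.mixedEmbedding NumberField.InfinitePlace NumberField.Units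
  NumberField.Units.dirichletUnitTheorem Module
open scoped nonZeroDivisors Classical

variable (K : Type*) [Field K] [NumberField K]

lemma wfun_smul (R : ℝ) (hR : 0 < R) (z : mixedSpace K) (hz : mixedEmbedding.norm z ≠ 0) :
    wfun K (R⁻¹ • z) = hat (Real.log (mixedEmbedding.norm z / R ^ finrank ℚ K)) * uphi K z := by
  have h1 : mixedEmbedding.norm (R⁻¹ • z) = mixedEmbedding.norm z / R ^ finrank ℚ K := by
    rw [mixedEmbedding.norm_smul, abs_of_pos (inv_pos.2 hR), inv_pow, div_eq_inv_mul]
  have h2 : mixedEmbedding.norm z / R ^ finrank ℚ K ≠ 0 := div_ne_zero hz (pow_ne_zero _ hR.ne')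
  unfold wfun
  rw [h1, if_neg h2]
  unfold uphi
  rw [logMap_real_smul hz (inv_ne_zero hR.ne')]

lemma lattice_sum_basis {ι E : Type*} [Fintype ι] [Nonempty ι] [NormedAddCommGroup E] [NormedSpace ℝ E]
    (b : Basis ι ℝ E) (W : E → ℝ) (L B : ℝ) (hL : 0 ≤ L) (hB : 0 ≤ B)
    (hLip : ∀ x y, |W x - W y| ≤ L * ‖x - y‖) (hsupp : ∀ x, B < ‖x‖ → W x = 0) :
    ∃ c C : ℝ, 0 ≤ C ∧ ∀ R : ℝ, 1 ≤ R →
    |∑' n : ι → ℤ, W (R⁻¹ • ∑ i, n i • b i) - c * R ^ Fintype.card ι|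
      ≤ C * R ^ (Fintype.card ι - 1) := by
  have : FiniteDimensional ℝ E := b.finiteDimensional_of_finite
  let e : (ι → ℝ) ≃L[ℝ] E := b.equivFun.symm.toContinuousLinearEquiv
  obtain ⟨C, hC, h⟩ := lattice_sum (fun x => W (e x)) (L * ‖(e : (ι → ℝ) →L[ℝ] E)‖)
    (‖(e.symm : E →L[ℝ] (ι → ℝ))‖ * B) (by positivity) (by positivity)
    (fun x y => by
      refine (hLip _ _).trans ?_
      rw [← map_sub, mul_assoc]
      exact mul_le_mul_of_nonneg_left (ContinuousLinearMap.le_opNorm (e : (ι → ℝ) →L[ℝ] E) _) hL)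
    (fun x hx => by
      refine hsupp _ ?_
      by_contra hcon
      have := ContinuousLinearMap.le_opNorm (e.symm : E →L[ℝ] (ι → ℝ)) (e x)
      simp only [ContinuousLinearEquiv.coe_coe, ContinuousLinearEquiv.symm_apply_apply] at this
      have h2 := mul_le_mul_of_nonneg_left (not_lt.1 hcon)
        (norm_nonneg (e.symm : E →L[ℝ] (ι → ℝ)))
      linarith)
  refine ⟨∫ x, W (e x), C, hC, fun R hR => ?_⟩
  have h3 := h R hR
  rw [mul_comm (∫ x, W (e x))]
  refine (le_of_eq ?_).trans h3
  congr 2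
  refine tsum_congr fun n => ?_
  congr 1
  have h4 : (fun i => (n i : ℝ) / R) = R⁻¹ • (fun i => (n i : ℝ)) := by
    funext i; simp [div_eq_inv_mul]
  rw [h4, map_smul]
  congr 1
  have h5 : e (fun i => (n i : ℝ)) = ∑ i, (n i : ℝ) • b i := by
    change b.equivFun.symm _ = _
    rw [Basis.equivFun_symm_apply]
  rw [h5]
  simp_rw [Int.cast_smul_eq_zsmul]

lemma lat_sum_frac (I : (FractionalIdeal (𝓞 K)⁰ K)ˣ) : ∃ c C : ℝ, 0 ≤ C ∧ ∀ R : ℝ, 1 ≤ R →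
    |∑' a : ((I : FractionalIdeal (𝓞 K)⁰ K) : Submodule (𝓞 K) K), wfun K (R⁻¹ • mixedEmbedding K (a : K))
      - c * R ^ finrank ℚ K| ≤ C * R ^ (finrank ℚ K - 1) := by
  obtain ⟨L, hL, hLip⟩ := wfun_lip K
  obtain ⟨B, hB, hsupp⟩ := wfun_bdd K
  have hcard : Fintype.card (Free.ChooseBasisIndex ℤ I) = finrank ℚ K := by
    rw [← finrank_eq_card_chooseBasisIndex, fractionalIdeal_rank, RingOfIntegers.rank]
  have : Nonempty (Free.ChooseBasisIndex ℤ I) := by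
    rw [← Fintype.card_pos_iff, hcard]; exact finrank_pos
  obtain ⟨c, C, hC, h⟩ := lattice_sum_basis (fractionalIdealLatticeBasis K I) (wfun K) L B hL hB
    hLip hsupp
  refine ⟨c, C, hC, fun R hR => ?_⟩
  have h3 := h R hR
  rw [hcard] at h3
  have h4 : ∑' a : ((I : FractionalIdeal (𝓞 K)⁰ K) : Submodule (𝓞 K) K), wfun K (R⁻¹ • mixedEmbedding K (a : K)) =
      ∑' n : Free.ChooseBasisIndex ℤ I → ℤ,
        wfun K (R⁻¹ • ∑ i, n i • fractionalIdealLatticeBasis K I i) := by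
    rw [← (fractionalIdealBasis K I.1).equivFun.symm.toEquiv.tsum_eq]
    refine tsum_congr fun n => ?_
    have h5 : mixedEmbedding K ((((fractionalIdealBasis K I.1).equivFun.symm n :
        ((I : FractionalIdeal (𝓞 K)⁰ K) : Submodule (𝓞 K) K))) : K)
        = ∑ i, n i • fractionalIdealLatticeBasis K I i := by
      rw [Basis.equivFun_symm_apply]
      have h6 : ∀ i, fractionalIdealLatticeBasis K I i
          = mixedEmbedding K (fractionalIdealBasis K I.1 i : K) := fun i => by
        rw [fractionalIdealLatticeBasis_apply, basisOfFractionalIdeal_apply]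
      simp_rw [h6, ← map_zsmul, ← map_sum]
      congr 1
      rw [← Submodule.subtype_apply, map_sum]
      rfl
    exact congrArg (fun z => wfun K (R⁻¹ • z)) h5
  rw [h4]
  exact h3

/-- the summand: `hat (log (N I / X))` -/
noncomputable def hI (X : ℝ) (I : (Ideal (𝓞 K))⁰) : ℝ :=
  hat (Real.log ((Ideal.absNorm (I : Ideal (𝓞 K)) : ℝ) / X))

lemma absNorm_pos' (I : (Ideal (𝓞 K))⁰) : (0 : ℝ) < Ideal.absNorm (I : Ideal (𝓞 K)) :=
  Nat.cast_pos.2 (Ideal.absNorm_pos_of_nonZeroDivisors I)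

lemma hI_nonneg (X : ℝ) (I : (Ideal (𝓞 K))⁰) : 0 ≤ hI K X I := hat_nonneg _

lemma hI_supp (X : ℝ) (hX : 0 < X) (I : (Ideal (𝓞 K))⁰) (h : hI K X I ≠ 0) :
    (Ideal.absNorm (I : Ideal (𝓞 K)) : ℝ) ≤ Real.exp 1 * X := by
  have h1 := (abs_lt.1 (abs_lt_of_hat h)).2
  have h2 : 0 < (Ideal.absNorm (I : Ideal (𝓞 K)) : ℝ) / X := div_pos (absNorm_pos' K I) hX
  rw [Real.log_lt_iff_lt_exp h2, div_lt_iff₀ hX] at h1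
  exact h1.le

lemma hI_finite (X : ℝ) (hX : 0 < X) : (Function.support (hI K X)).Finite := by
  refine (Ideal.finite_setOfPred_absNorm_le₀ (S := 𝓞 K) ⌊Real.exp 1 * X⌋₊).subset fun I hI => ?_
  exact Nat.le_floor (hI_supp K X hX I hI)

lemma norm_emb (x : 𝓞 K) :
    mixedEmbedding.norm (mixedEmbedding K (x : K)) = Ideal.absNorm (Ideal.span {x}) := by
  rw [norm_eq_norm, Ideal.absNorm_span_singleton, ← Algebra.coe_norm_int, Nat.cast_natAbs]
  push_cast
  rfl

lemma tsum_principal (J : (Ideal (𝓞 K))⁰) (R : ℝ) (hR : 0 < R) :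
    ∑' a : ((FractionalIdeal.mk0 K J : FractionalIdeal (𝓞 K)⁰ K) : Submodule (𝓞 K) K),
      wfun K (R⁻¹ • mixedEmbedding K (a : K)) =
    torsionOrder K * ∑' I : {I : (Ideal (𝓞 K))⁰ // J ∣ I ∧ (I : Ideal (𝓞 K)).IsPrincipal},
      hI K (R ^ finrank ℚ K) I := by
  set P := {I : (Ideal (𝓞 K))⁰ // J ∣ I ∧ (I : Ideal (𝓞 K)).IsPrincipal} with hP
  have hX : 0 < R ^ finrank ℚ K := pow_pos hR _
  have hgen : ∀ I : P, ∃ g : 𝓞 K, (I.1 : Ideal (𝓞 K)) = Ideal.span {g} := fun I => by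
    obtain ⟨g, hg⟩ := I.2.2.principal
    exact ⟨g, hg⟩
  choose g hg using hgen
  have hg0 : ∀ I, g I ≠ 0 := fun I h => by
    have := nonZeroDivisors.coe_ne_zero I.1
    rw [hg, h] at this
    simp at this
  have hmem : ∀ p : P × (𝓞 K)ˣ, algebraMap (𝓞 K) K (p.2 * g p.1) ∈
      ((FractionalIdeal.mk0 K J : FractionalIdeal (𝓞 K)⁰ K) : Submodule (𝓞 K) K) := fun p => by
    rw [FractionalIdeal.mem_coe, FractionalIdeal.coe_mk0, FractionalIdeal.mem_coeIdeal]
    refine ⟨_, ?_, rfl⟩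
    have h1 : (J : Ideal (𝓞 K)) ∣ (p.1.1 : Ideal (𝓞 K)) :=
      nonZeroDivisors_dvd_iff_dvd_coe.1 p.1.2.1
    have h2 := Ideal.le_of_dvd h1
    refine Ideal.mul_mem_left _ _ (h2 ?_)
    rw [hg]
    exact Ideal.mem_span_singleton_self _
  let φ : P × (𝓞 K)ˣ →
      ((FractionalIdeal.mk0 K J : FractionalIdeal (𝓞 K)⁰ K) : Submodule (𝓞 K) K) :=
    fun p => ⟨algebraMap (𝓞 K) K (p.2 * g p.1), hmem p⟩
  have hφ : Function.Injective φ := by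
    intro p q h
    have h0 : algebraMap (𝓞 K) K (p.2 * g p.1) = algebraMap (𝓞 K) K (q.2 * g q.1) := by
      have h' := Subtype.ext_iff.1 h
      exact h'
    have h1 : (p.2 : 𝓞 K) * g p.1 = q.2 * g q.1 :=
      FaithfulSMul.algebraMap_injective (𝓞 K) K h0
    have h2 : (p.1.1 : Ideal (𝓞 K)) = q.1.1 := by
      rw [hg, hg, ← Ideal.span_singleton_mul_left_unit p.2.isUnit, h1,
        Ideal.span_singleton_mul_left_unit q.2.isUnit]
    have h3 : p.1 = q.1 := Subtype.ext (Subtype.ext h2)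
    rw [h3] at h1
    exact Prod.ext h3 (Units.ext (mul_right_cancel₀ (hg0 _) h1))
  have hval : ∀ p : P × (𝓞 K)ˣ, wfun K (R⁻¹ • mixedEmbedding K ((φ p : K))) =
      hI K (R ^ finrank ℚ K) p.1.1 * uphi K (p.2 • mixedEmbedding K (g p.1 : K)) := fun p => by
    have h1 : mixedEmbedding K (φ p : K) = p.2 • mixedEmbedding K (g p.1 : K) := by
      rw [unitSMul_smul, ← map_mul, ← map_mul]
    have h2 : mixedEmbedding.norm (p.2 • mixedEmbedding K (g p.1 : K))
        = Ideal.absNorm (p.1.1 : Ideal (𝓞 K)) := by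
      rw [norm_unit_smul, norm_emb, hg]
    rw [h1, wfun_smul K R hR _ (by rw [h2]; exact (absNorm_pos' K _).ne'), h2, hI]
  rw [← hφ.tsum_eq (f := fun a => wfun K (R⁻¹ • mixedEmbedding K (a : K)))]
  swap
  · intro a ha
    obtain ⟨x, hx, hxa⟩ := (FractionalIdeal.mem_coeIdeal _).1
      (show (a : K) ∈ ((J : Ideal (𝓞 K)) : FractionalIdeal (𝓞 K)⁰ K) by
        rw [← FractionalIdeal.coe_mk0, ← FractionalIdeal.mem_coe]; exact a.2)
    have hx0 : x ≠ 0 := by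
      rintro rfl
      apply ha
      simp only
      rw [← hxa, map_zero, map_zero, smul_zero, wfun]
      simp
    have h1 : Ideal.span {x} ∈ (Ideal (𝓞 K))⁰ := by
      rw [mem_nonZeroDivisors_iff_ne_zero]; simpa using hx0
    let I : P := ⟨⟨Ideal.span {x}, h1⟩, by
      rw [nonZeroDivisors_dvd_iff_dvd_coe, Ideal.dvd_iff_le]
      exact (Ideal.span_singleton_le_iff_mem _).2 hx, ⟨x, rfl⟩⟩
    have h2 : Ideal.span {x} = Ideal.span {g I} := hg I
    obtain ⟨u, hu⟩ := Ideal.span_singleton_eq_span_singleton.1 h2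
    refine ⟨(I, u⁻¹), Subtype.ext ?_⟩
    rw [← hxa]
    change algebraMap (𝓞 K) K _ = _
    congr 1
    rw [← hu]
    simp only
    rw [mul_comm x, ← mul_assoc, Units.inv_mul, one_mul]
  simp_rw [hval]
  have hz : ∀ I : P, mixedEmbedding.norm (mixedEmbedding K (g I : K)) ≠ 0 := fun I => by
    rw [norm_emb, ← hg]; exact (absNorm_pos' K _).ne'
  have hs1 : ∀ I : P, HasSum (fun u : (𝓞 K)ˣ => hI K (R ^ finrank ℚ K) I.1 *
      uphi K (u • mixedEmbedding K (g I : K))) (hI K (R ^ finrank ℚ K) I.1 * torsionOrder K) :=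
    fun I => (hasSum_uphi K _ (hz I)).mul_left _
  have hfin : (Function.support fun I : P => hI K (R ^ finrank ℚ K) I.1).Finite :=
    (hI_finite K _ hX).preimage Subtype.val_injective.injOn
  have hsum : Summable (fun p : P × (𝓞 K)ˣ => hI K (R ^ finrank ℚ K) p.1.1 *
      uphi K (p.2 • mixedEmbedding K (g p.1 : K))) := by
    rw [summable_prod_of_nonneg]
    · refine ⟨fun I => (hs1 I).summable, ?_⟩
      simp_rw [(hs1 _).tsum_eq]
      exact (summable_of_hasFiniteSupport hfin).mul_right _
    · intro p
      exact mul_nonneg (hI_nonneg K _ _) (uphi_nonneg K _)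
  rw [hsum.tsum_prod]
  simp_rw [(hs1 _).tsum_eq]
  rw [tsum_mul_right, mul_comm]

lemma tsum_class (C : ClassGroup (𝓞 K)) (J : (Ideal (𝓞 K))⁰) (hJ : ClassGroup.mk0 J = C⁻¹) (X : ℝ) :
    ∑' I : {I : (Ideal (𝓞 K))⁰ // ClassGroup.mk0 I = C}, hI K X I =
    ∑' I : {I : (Ideal (𝓞 K))⁰ // J ∣ I ∧ (I : Ideal (𝓞 K)).IsPrincipal},
      hI K (X * Ideal.absNorm (J : Ideal (𝓞 K))) I := by
  let e : {I : (Ideal (𝓞 K))⁰ // ClassGroup.mk0 I = C} ≃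
      {I : (Ideal (𝓞 K))⁰ // J ∣ I ∧ (I : Ideal (𝓞 K)).IsPrincipal} :=
    ((Equiv.dvd J).subtypeEquiv (q := fun I => (I.1 : Ideal (𝓞 K)).IsPrincipal) fun I ↦ (by
      rw [← ClassGroup.mk0_eq_one_iff (SetLike.coe_mem _)]
      simp_rw [Equiv.dvd_apply, Submonoid.coe_mul, ← Submonoid.mul_def, _root_.map_mul, hJ,
        inv_mul_eq_one, eq_comm])).trans
    (Equiv.subtypeSubtypeEquivSubtypeInter (fun I : (Ideal (𝓞 K))⁰ ↦ J ∣ I)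
      (fun I => (I : Ideal (𝓞 K)).IsPrincipal))
  rw [← e.tsum_eq]
  refine tsum_congr fun I => ?_
  have h1 : (e I).1 = J * I.1 := rfl
  rw [h1, hI, hI, Submonoid.coe_mul, map_mul, Nat.cast_mul]
  congr 2
  rw [mul_comm X, mul_div_mul_left _ _ (absNorm_pos' K J).ne']

lemma tsum_fiber {α β : Type*} [Fintype β] (f : α → ℝ) (g : α → β) (hs : Summable f) :
    ∑' a, f a = ∑ b, ∑' a : {a // g a = b}, f a := by
  rw [← (Equiv.sigmaFiberEquiv g).tsum_eq, Summable.tsum_sigma, tsum_fintype]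
  · rfl
  · exact (Equiv.summable_iff (Equiv.sigmaFiberEquiv g)).2 hs

/-- smoothed ideal counting function -/
noncomputable def TT (X : ℝ) : ℝ := ∑' I : (Ideal (𝓞 K))⁰, hI K X I

lemma TT_eq_sum (X : ℝ) (hX : 0 < X) :
    TT K X = ∑ C : ClassGroup (𝓞 K), ∑' I : {I : (Ideal (𝓞 K))⁰ // ClassGroup.mk0 I = C}, hI K X I := by
  have hs : Summable (hI K X) := summable_of_hasFiniteSupport (hI_finite K X hX)
  exact tsum_fiber _ _ hs

lemma class_asymp (C : ClassGroup (𝓞 K)) : ∃ c M : ℝ, 0 ≤ M ∧ ∀ X : ℝ, 1 ≤ X →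
    |∑' I : {I : (Ideal (𝓞 K))⁰ // ClassGroup.mk0 I = C}, hI K X I - c * X|
      ≤ M * X ^ (1 - 1 / (finrank ℚ K : ℝ)) := by
  obtain ⟨J, hJ⟩ := ClassGroup.mk0_surjective C⁻¹
  obtain ⟨c, M, hM, h⟩ := lat_sum_frac K (FractionalIdeal.mk0 K J)
  set N : ℝ := ((Ideal.absNorm (J : Ideal (𝓞 K)) : ℕ) : ℝ) with hN
  have hN1 : 1 ≤ N := by
    rw [hN]; exact_mod_cast Ideal.absNorm_pos_of_nonZeroDivisors J
  have hN0 : 0 < N := by linarith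
  set d := finrank ℚ K with hd
  have hd0 : 0 < d := finrank_pos
  have hd0' : (0 : ℝ) < d := by exact_mod_cast hd0
  have ht : (0 : ℝ) < torsionOrder K := by exact_mod_cast torsionOrder_pos K
  refine ⟨c * N / torsionOrder K, M * N ^ (1 - 1 / (d : ℝ)) / torsionOrder K, by positivity, fun X hX => ?_⟩
  have hX0 : 0 < X := by linarith
  have hXN : 1 ≤ X * N := by nlinarith
  set R := (X * N) ^ (1 / (d : ℝ)) with hR
  have hR1 : 1 ≤ R := Real.one_le_rpow hXN (by positivity)
  have hRd : R ^ d = X * N := by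
    rw [hR, ← Real.rpow_natCast, ← Real.rpow_mul (by positivity), one_div_mul_cancel hd0'.ne',
      Real.rpow_one]
  have hRd1 : R ^ (d - 1) = X ^ (1 - 1 / (d : ℝ)) * N ^ (1 - 1 / (d : ℝ)) := by
    rw [hR, ← Real.rpow_natCast, ← Real.rpow_mul (by positivity), Nat.cast_sub hd0, Nat.cast_one,
      ← Real.mul_rpow hX0.le hN0.le]
    congr 1
    field_simp
  have h1 := h R hR1
  rw [tsum_principal K J R (by linarith), ← hd, hRd, hRd1, ← tsum_class K C J hJ X] at h1
  set S := ∑' I : {I : (Ideal (𝓞 K))⁰ // ClassGroup.mk0 I = C}, hI K X I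
  have h2 : S - c * N / torsionOrder K * X
      = (torsionOrder K * S - c * (X * N)) / torsionOrder K := by
    field_simp
  rw [h2, abs_div, abs_of_pos ht, div_le_iff₀ ht]
  refine h1.trans (le_of_eq ?_)
  field_simp

theorem TT_asymp : ∃ c M : ℝ, 0 ≤ M ∧ ∀ X : ℝ, 1 ≤ X →
    |TT K X - c * X| ≤ M * X ^ (1 - 1 / (finrank ℚ K : ℝ)) := by
  choose c M hM h using class_asymp K
  refine ⟨∑ C, c C, ∑ C, M C, Finset.sum_nonneg fun C _ => hM C, fun X hX => ?_⟩
  rw [TT_eq_sum K X (by linarith), Finset.sum_mul, Finset.sum_mul, ← Finset.sum_sub_distrib]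
  exact (Finset.abs_sum_le_sum_abs _ _).trans (Finset.sum_le_sum fun C _ => h C X hX)

end PIT

end

section

namespace PIT
open Complex MeasureTheory Set Filter Topology

lemma tri_int (s : ℂ) (hs : s ≠ 0) :
    ∫ v : ℝ, (hat v : ℂ) * Complex.exp (s * v)
      = (Complex.exp s + Complex.exp (-s) - 2) / s ^ 2 := by
  have h0 : ∫ v : ℝ, (hat v : ℂ) * Complex.exp (s * v)
      = ∫ v in (-1 : ℝ)..1, (hat v : ℂ) * Complex.exp (s * v) := by
    rw [intervalIntegral.integral_of_le (by norm_num), ← integral_indicator measurableSet_Ioc]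
    congr 1
    funext v
    by_cases hv : v ∈ Ioc (-1 : ℝ) 1
    · rw [indicator_of_mem hv]
    · rw [indicator_of_notMem hv, hat_eq_zero, ofReal_zero, zero_mul]
      rw [mem_Ioc, not_and_or, not_lt, not_le] at hv
      rcases hv with hv | hv
      · rw [le_abs]; right; linarith
      · rw [le_abs]; left; linarith
  have hcont : Continuous fun v : ℝ => (hat v : ℂ) * Complex.exp (s * v) := by
    have := hat_cont
    fun_prop
  rw [h0, ← intervalIntegral.integral_add_adjacent_intervals (b := 0)
    (hcont.intervalIntegrable _ _) (hcont.intervalIntegrable _ _)]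
  have hd : ∀ v : ℝ, HasDerivAt (fun v : ℝ => Complex.exp (s * v)) (s * Complex.exp (s * v)) v := by
    intro v
    have h1 : HasDerivAt (fun v : ℂ => Complex.exp (s * v)) (Complex.exp (s * v) * (s * 1)) v :=
      ((hasDerivAt_id (v : ℂ)).const_mul s).cexp
    have := h1.comp_ofReal
    rwa [mul_one, mul_comm] at this
  have hid : ∀ v : ℝ, HasDerivAt (fun v : ℝ => (v : ℂ)) 1 v := fun v => (hasDerivAt_id (v : ℂ)).comp_ofReal
  have h1 : ∫ v in (-1 : ℝ)..0, (hat v : ℂ) * Complex.exp (s * v)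
      = (1 / s - 1 / s ^ 2) + Complex.exp (-s) / s ^ 2 := by
    have e1 : ∫ v in (-1 : ℝ)..0, (hat v : ℂ) * Complex.exp (s * v)
      = ∫ v in (-1 : ℝ)..0, (1 + (v : ℂ)) * Complex.exp (s * v) := by
      refine intervalIntegral.integral_congr fun v hv => ?_
      rw [uIcc_of_le (by norm_num)] at hv
      have : hat v = 1 + v := by
        unfold hat
        rw [abs_of_nonpos hv.2, max_eq_right] <;> linarith [hv.1]
      simp only [this]; push_cast; ring
    rw [e1, intervalIntegral.integral_eq_sub_of_hasDerivAt
      (f := fun v : ℝ => (1 + (v : ℂ)) * Complex.exp (s * v) / s - Complex.exp (s * v) / s ^ 2)]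
    · simp
    · intro v _
      convert! (((((hid v).const_add 1).mul (hd v)).div_const s).sub ((hd v).div_const (s ^ 2))) using 1
      field_simp
      ring
    · exact (by fun_prop : Continuous fun v : ℝ => (1 + (v : ℂ)) * Complex.exp (s * v)).intervalIntegrable _ _
  have h2 : ∫ v in (0 : ℝ)..1, (hat v : ℂ) * Complex.exp (s * v)
      = Complex.exp s / s ^ 2 - (1 / s + 1 / s ^ 2) := by
    have e1 : ∫ v in (0 : ℝ)..1, (hat v : ℂ) * Complex.exp (s * v)
      = ∫ v in (0 : ℝ)..1, (1 - (v : ℂ)) * Complex.exp (s * v) := by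
      refine intervalIntegral.integral_congr fun v hv => ?_
      rw [uIcc_of_le (by norm_num)] at hv
      have : hat v = 1 - v := by
        unfold hat
        rw [abs_of_nonneg hv.1, max_eq_right]; linarith [hv.2]
      simp only [this]; push_cast; ring
    rw [e1, intervalIntegral.integral_eq_sub_of_hasDerivAt
      (f := fun v : ℝ => (1 - (v : ℂ)) * Complex.exp (s * v) / s + Complex.exp (s * v) / s ^ 2)]
    · simp
    · intro v _
      convert! (((((hid v).const_sub 1).mul (hd v)).div_const s).add ((hd v).div_const (s ^ 2))) using 1
      field_simp
      ring
    · exact (by fun_prop : Continuous fun v : ℝ => (1 - (v : ℂ)) * Complex.exp (s * v)).intervalIntegrable _ _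
  rw [h1, h2]
  field_simp
  ring

/-- the multiplicative hat -/
noncomputable def HH (t : ℝ) : ℂ := (hat (Real.log t) : ℂ)

lemma mellin_HH (s : ℂ) (hs : s ≠ 0) :
    mellin HH s = (Complex.exp s + Complex.exp (-s) - 2) / s ^ 2 := by
  rw [← tri_int s hs, mellin_eq_fourier, Real.fourier_real_eq_integral_exp_smul, ← integral_neg_eq_self]
  congr 1
  funext v
  simp only [HH, neg_neg, mul_neg, Real.log_exp, smul_eq_mul, real_smul, Complex.ofReal_exp]
  rw [← mul_assoc, ← Complex.exp_add, mul_comm]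
  congr 2
  have : (Real.pi : ℂ) ≠ 0 := ofReal_ne_zero.2 Real.pi_ne_zero
  push_cast
  conv_rhs => rw [← re_add_im s]
  field_simp
  ring

lemma kk_ne_zero (s : ℂ) (hs : 0 < s.re) : mellin HH s ≠ 0 := by
  have hs0 : s ≠ 0 := by rintro rfl; simp at hs
  rw [mellin_HH s hs0]
  refine div_ne_zero ?_ (pow_ne_zero _ hs0)
  have h1 : Complex.exp s + Complex.exp (-s) - 2 = Complex.exp (-s) * (Complex.exp s - 1) ^ 2 := by
    have : Complex.exp (-s) * Complex.exp s = 1 := by rw [← Complex.exp_add]; simp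
    linear_combination (2 - Complex.exp s) * this
  rw [h1]
  refine mul_ne_zero (Complex.exp_ne_zero _) (pow_ne_zero _ ?_)
  rw [sub_ne_zero]
  intro h
  have := congrArg norm h
  rw [Complex.norm_exp, norm_one] at this
  have h2 := Real.one_lt_exp_iff.2 hs
  linarith

lemma HH_cont : ContinuousOn HH (Ioi 0) := by
  unfold HH
  refine continuous_ofReal.comp_continuousOn (hat_cont.comp_continuousOn ?_)
  exact Real.continuousOn_log.mono fun x hx => (ne_of_gt hx)

lemma HH_zero_of_ge {t : ℝ} (ht : Real.exp 1 ≤ t) : HH t = 0 := by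
  have : 0 < t := (Real.exp_pos 1).trans_le ht
  rw [HH, hat_eq_zero, ofReal_zero]
  rw [le_abs]; left
  rwa [Real.le_log_iff_exp_le this]

lemma HH_zero_of_le {t : ℝ} (ht0 : 0 < t) (ht : t ≤ Real.exp (-1)) : HH t = 0 := by
  rw [HH, hat_eq_zero, ofReal_zero]
  rw [le_abs]; right
  rw [le_neg]
  rwa [Real.log_le_iff_le_exp ht0]

lemma HH_top (a : ℝ) : HH =O[atTop] fun t => t ^ (-a) := by
  have : HH =ᶠ[atTop] 0 := by
    filter_upwards [eventually_ge_atTop (Real.exp 1)] with t ht using HH_zero_of_ge ht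
  exact this.trans_isBigO (Asymptotics.isBigO_zero _ _)

lemma HH_bot (b : ℝ) : HH =O[𝓝[>] 0] fun t => t ^ (-b) := by
  have : HH =ᶠ[𝓝[>] 0] 0 := by
    filter_upwards [Ioc_mem_nhdsGT (Real.exp_pos (-1))] with t ht using HH_zero_of_le ht.1 ht.2
  exact this.trans_isBigO (Asymptotics.isBigO_zero _ _)

lemma HH_conv (s : ℂ) : MellinConvergent HH s :=
  mellinConvergent_of_isBigO_rpow (a := s.re + 1) (b := s.re - 1)
    (HH_cont.locallyIntegrableOn measurableSet_Ioi) (HH_top _) (by linarith) (HH_bot _) (by linarith)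

lemma kk_diff (s : ℂ) : DifferentiableAt ℂ (mellin HH) s :=
  mellin_differentiableAt_of_isBigO_rpow (a := s.re + 1) (b := s.re - 1)
    (HH_cont.locallyIntegrableOn measurableSet_Ioi) (HH_top _) (by linarith) (HH_bot _) (by linarith)

end PIT

end

section

namespace PIT
open Complex MeasureTheory Set Filter Topology

section
variable (a : ℕ → ℝ)

/-- theta -/
noncomputable def Th (t : ℝ) : ℂ := ∑' n : ℕ, (a n : ℂ) * HH (n * t)

lemma Th_eq_sum (h0 : a 0 = 0) (N : ℕ) (t : ℝ) (ht : 0 < t) (hN : Real.exp 1 ≤ N * t) :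
    Th a t = ∑ n ∈ Finset.range N, (a n : ℂ) * HH (n * t) := by
  refine tsum_eq_sum fun n hn => ?_
  rw [Finset.mem_range, not_lt] at hn
  rw [HH_zero_of_ge, mul_zero]
  refine hN.trans (mul_le_mul_of_nonneg_right (by exact_mod_cast hn) ht.le)

lemma Th_cont (h0 : a 0 = 0) : ContinuousOn (Th a) (Ioi 0) := by
  intro t ht
  have ht : 0 < t := ht
  refine ContinuousAt.continuousWithinAt ?_
  obtain ⟨N, hN⟩ := exists_nat_ge (Real.exp 1 / (t / 2))
  rw [div_le_iff₀ (by linarith)] at hN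
  have hev : Th a =ᶠ[𝓝 t] fun t => ∑ n ∈ Finset.range N, (a n : ℂ) * HH (n * t) := by
    filter_upwards [lt_mem_nhds (show t / 2 < t by linarith)] with x hx
    refine Th_eq_sum a h0 N x (by linarith) (hN.trans ?_)
    exact mul_le_mul_of_nonneg_left hx.le (Nat.cast_nonneg N)
  refine ContinuousAt.congr ?_ hev.symm
  refine tendsto_finsetSum _ fun n _ => ?_
  rcases Nat.eq_zero_or_pos n with rfl | hn
  · simp [h0]
  · refine Tendsto.const_mul _ ?_
    have h1 : ContinuousAt HH (n * t) :=
      HH_cont.continuousAt (Ioi_mem_nhds (by positivity))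
    exact (ContinuousAt.comp (f := fun t : ℝ => (n : ℝ) * t) h1 (by fun_prop))

lemma mellin_Th (h0 : a 0 = 0) (ha : ∀ n, 0 ≤ a n) (s : ℂ)
    (hs : LSeriesSummable (fun n => (a n : ℂ)) s) :
    mellin (Th a) s = LSeries (fun n => (a n : ℂ)) s * mellin HH s := by
  have hintg : ∀ n : ℕ, MellinConvergent (fun t => (a n : ℂ) * HH (n * t)) s := fun n => by
    rcases Nat.eq_zero_or_pos n with rfl | hn
    · simp [h0, MellinConvergent]
    · exact MellinConvergent.const_smul
        ((MellinConvergent.comp_mul_left (by exact_mod_cast hn)).2 (HH_conv s)) (a n : ℂ)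
  have hval : ∀ n : ℕ, mellin (fun t => (a n : ℂ) * HH (n * t)) s
      = LSeries.term (fun n => (a n : ℂ)) s n * mellin HH s := fun n => by
    rcases Nat.eq_zero_or_pos n with rfl | hn
    · simp [h0, mellin]
    · have := mellin_const_smul (fun t => HH (n * t)) s (a n : ℂ)
      rw [mellin_comp_mul_left _ _ (by exact_mod_cast hn)] at this
      simp only [smul_eq_mul] at this
      rw [this, LSeries.term_of_ne_zero hn.ne', cpow_neg]
      push_cast
      field_simp
  set G : ℝ → ℝ := fun t => ‖(t : ℂ) ^ (s - 1) • HH t‖ with hG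
  have hnorm : ∀ n : ℕ, ∫ t in Ioi (0 : ℝ), ‖(t : ℂ) ^ (s - 1) • ((a n : ℂ) * HH (n * t))‖
      = ‖LSeries.term (fun n => (a n : ℂ)) s n‖ * ∫ t in Ioi (0 : ℝ), G t := fun n => by
    rcases Nat.eq_zero_or_pos n with rfl | hn
    · simp [h0]
    · have hn' : (0 : ℝ) < n := by exact_mod_cast hn
      have e1 : ∫ t in Ioi (0 : ℝ), ‖(t : ℂ) ^ (s - 1) • ((a n : ℂ) * HH (n * t))‖
          = ∫ t in Ioi (0 : ℝ), (a n * (n : ℝ) ^ (1 - s.re)) * G (n * t) := by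
        refine setIntegral_congr_fun measurableSet_Ioi fun t ht => ?_
        have ht : 0 < t := ht
        simp only [hG, norm_smul, norm_mul]
        rw [norm_cpow_eq_rpow_re_of_pos ht, norm_cpow_eq_rpow_re_of_pos (by positivity),
          Real.mul_rpow hn'.le ht.le, norm_real, Real.norm_of_nonneg (ha n)]
        simp only [sub_re, one_re]
        have : (n : ℝ) ^ (1 - s.re) * (n : ℝ) ^ (s.re - 1) = 1 := by
          rw [← Real.rpow_add hn']; simp
        linear_combination (- a n * t ^ (s.re - 1) * ‖HH (n * t)‖) * this
      rw [e1, integral_const_mul, integral_comp_mul_left_Ioi _ _ hn', mul_zero, smul_eq_mul,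
        ← mul_assoc, LSeries.term_of_ne_zero hn.ne', norm_div, norm_natCast_cpow_of_pos hn,
        norm_real, Real.norm_of_nonneg (ha n), Real.rpow_sub hn', Real.rpow_one]
      congr 1
      field_simp
  have key := hasSum_integral_of_summable_integral_norm (μ := volume.restrict (Ioi 0))
    (F := fun n : ℕ => fun t : ℝ => (t : ℂ) ^ (s - 1) • ((a n : ℂ) * HH (n * t)))
    (fun n => hintg n) (by
      simp_rw [hnorm]
      exact (Summable.norm hs).mul_right _)
  have key2 : HasSum (fun n => LSeries.term (fun n => (a n : ℂ)) s n * mellin HH s)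
      (mellin (Th a) s) := by
    convert! key using 1
    · funext n
      exact (hval n).symm
    · rw [mellin]
      congr 1
      funext t
      simp only [smul_eq_mul, Th]
      rw [tsum_mul_left]
  rw [← key2.tsum_eq, tsum_mul_right]
  rfl

theorem analytic_of_theta (h0 : a 0 = 0) (ha : ∀ n, 0 ≤ a n)
    (hs : ∀ s : ℂ, 1 < s.re → LSeriesSummable (fun n => (a n : ℂ)) s)
    (c M β : ℝ) (hβ : 0 ≤ β) (hβ1 : β < 1)
    (hT : ∀ t : ℝ, 0 < t → t ≤ 1 → ‖Th a t - c * (t⁻¹ : ℝ)‖ ≤ M * t ^ (-β)) :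
    ∃ F : ℂ → ℂ, (∀ s : ℂ, β < s.re → DifferentiableAt ℂ F s) ∧
      ∀ s : ℂ, 1 < s.re → (s - 1) * LSeries (fun n => (a n : ℂ)) s = F s := by
  set D : ℝ → ℂ := indicator (Ioc 0 1) (fun t => (t : ℂ) ^ (-1 : ℂ)) with hD
  set E : ℝ → ℂ := fun t => Th a t - (c : ℂ) • D t with hE
  have hDloc : LocallyIntegrableOn D (Ioi 0) := by
    rw [locallyIntegrableOn_iff isOpen_Ioi.isLocallyClosed]
    intro k hk hkc
    refine IntegrableOn.indicator ?_ measurableSet_Ioc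
    refine ContinuousOn.integrableOn_compact hkc ?_
    intro t ht
    have : 0 < t := hk ht
    refine ContinuousAt.continuousWithinAt ?_
    exact (continuousAt_ofReal_cpow_const _ _ (Or.inr this.ne'))
  have hThloc : LocallyIntegrableOn (Th a) (Ioi 0) :=
    (Th_cont a h0).locallyIntegrableOn measurableSet_Ioi
  have hEloc : LocallyIntegrableOn E (Ioi 0) := hThloc.sub (hDloc.smul (c : ℂ))
  have hThz : ∀ t, Real.exp 1 ≤ t → Th a t = 0 := fun t ht => by
    have ht0 : 0 < t := (Real.exp_pos 1).trans_le ht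
    rw [Th_eq_sum a h0 1 t ht0 (by simpa using ht)]
    simp [h0]
  have hEz : E =ᶠ[atTop] 0 := by
    filter_upwards [eventually_ge_atTop (Real.exp 1)] with t ht
    have h1 : 1 < t := (Real.one_lt_exp_iff.2 one_pos).trans_le ht
    simp only [hE, hThz t ht, hD]
    rw [indicator_of_notMem (fun h => by linarith [h.2])]
    simp
  have hEtop : ∀ r : ℝ, E =O[atTop] fun t => t ^ (-r) := fun r =>
    hEz.trans_isBigO (Asymptotics.isBigO_zero _ _)
  have hThtop : ∀ r : ℝ, Th a =O[atTop] fun t => t ^ (-r) := fun r => by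
    have : Th a =ᶠ[atTop] 0 := by
      filter_upwards [eventually_ge_atTop (Real.exp 1)] with t ht using hThz t ht
    exact this.trans_isBigO (Asymptotics.isBigO_zero _ _)
  have hEbot : E =O[𝓝[>] 0] fun t => t ^ (-β) := by
    refine Asymptotics.IsBigO.of_bound M ?_
    filter_upwards [Ioc_mem_nhdsGT (zero_lt_one' ℝ)] with t ht
    have := hT t ht.1 ht.2
    rw [ofReal_inv] at this
    simp only [hE, hD]
    rw [indicator_of_mem ht, cpow_neg_one, smul_eq_mul, Real.norm_of_nonneg (by have := ht.1; positivity)]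
    exact this
  have hEdiff : ∀ s : ℂ, β < s.re → DifferentiableAt ℂ (mellin E) s := fun s hs =>
    mellin_differentiableAt_of_isBigO_rpow (a := s.re + 1) hEloc (hEtop _) (by linarith) hEbot hs
  have hEconv : ∀ s : ℂ, β < s.re → MellinConvergent E s := fun s hs =>
    mellinConvergent_of_isBigO_rpow (a := s.re + 1) hEloc (hEtop _) (by linarith) hEbot hs
  refine ⟨fun s => ((s - 1) * mellin E s + c) / mellin HH s, fun s hs => ?_, fun s hs1 => ?_⟩
  · have h1 := hEdiff s hs
    have h2 := kk_diff s
    have h3 := kk_ne_zero s (by linarith)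
    fun_prop (disch := assumption)
  · have hk := kk_ne_zero s (by linarith)
    rw [eq_div_iff hk, mul_assoc, ← mellin_Th a h0 ha s (hs s hs1)]
    have hDm := hasMellin_cpow_Ioc (-1) (s := s) (by simpa using hs1)
    have h1 := hasMellin_add (hEconv s (by linarith)) ((hDm.1).const_smul (c : ℂ))
    have h2 := h1.2
    rw [mellin_const_smul, hDm.2] at h2
    have h3 : (fun t => E t + (c : ℂ) • D t) = Th a := by
      funext t; simp [hE]
    have h4 : mellin (Th a) s = mellin E s + (c : ℂ) • (1 / (s + -1)) := by
      rw [← h2, ← h3]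
    rw [h4]
    have : s - 1 ≠ 0 := by
      intro h
      have := congrArg re h
      simp at this
      linarith
    rw [← sub_eq_add_neg, smul_eq_mul]
    field_simp
end

end PIT

end

section

namespace PIT
open Complex MeasureTheory Set Filter Topology NumberField Module
open scoped nonZeroDivisors

variable (K : Type*) [Field K] [NumberField K]

/-- number of nonzero ideals of norm `n` -/
noncomputable def rK (n : ℕ) : ℝ := Nat.card {I : (Ideal (𝓞 K))⁰ // Ideal.absNorm (I : Ideal (𝓞 K)) = n}

lemma rK_zero : rK K 0 = 0 := by
  have : IsEmpty {I : (Ideal (𝓞 K))⁰ // Ideal.absNorm (I : Ideal (𝓞 K)) = 0} :=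
    ⟨fun I => (Ideal.absNorm_pos_of_nonZeroDivisors I.1).ne' I.2⟩
  rw [rK, Nat.card_of_isEmpty, Nat.cast_zero]

lemma rK_nonneg (n : ℕ) : 0 ≤ rK K n := Nat.cast_nonneg _

lemma fin_fiber (n : ℕ) : Finite {I : (Ideal (𝓞 K))⁰ // Ideal.absNorm (I : Ideal (𝓞 K)) = n} := by
  have h := Ideal.finite_setOfPred_absNorm_le₀ (S := 𝓞 K) n
  have h2 : {I : (Ideal (𝓞 K))⁰ | Ideal.absNorm (I : Ideal (𝓞 K)) = n}.Finite :=
    h.subset fun I hI => le_of_eq hI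
  exact h2.to_subtype

lemma rK_eq (n : ℕ) (hn : n ≠ 0) : rK K n = Nat.card {I : Ideal (𝓞 K) // Ideal.absNorm I = n} := by
  rw [rK]
  congr 1
  refine Nat.card_congr ⟨fun I => ⟨I.1.1, I.2⟩, fun I => ⟨⟨I.1, ?_⟩, I.2⟩, fun I => rfl, fun I => rfl⟩
  rw [mem_nonZeroDivisors_iff_ne_zero]
  intro h
  have := I.2
  rw [h] at this
  simp at this
  exact hn this.symm

lemma LSeries_rK (s : ℂ) : LSeries (fun n => (rK K n : ℂ)) s = dedekindZeta K s := by
  refine LSeries_congr (fun {n} hn => ?_) s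
  rw [rK_eq K n hn]
  simp

lemma rK_tendsto : Tendsto (fun n : ℕ => (∑ k ∈ Finset.Icc 1 n, rK K k) / (n : ℝ)) atTop
    (𝓝 (dedekindZeta_residue K)) := by
  refine ((Ideal.tendsto_norm_le_div_atTop₀ K).comp tendsto_natCast_atTop_atTop).congr fun n ↦ ?_
  simp only [Function.comp_apply, Nat.cast_le]
  congr 1
  rw [Finset.sum_congr rfl (fun k hk => rK_eq K k (by have := (Finset.mem_Icc.1 hk).1; omega)),
    ← Nat.cast_sum]
  congr 1
  rw [← add_left_inj 1, ← Ideal.card_norm_le_eq_card_norm_le_add_one,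
    show Finset.Icc 1 n = Finset.Ioc 0 n from Finset.Icc_succ_left_eq_Ioc _ _,
    show 1 = Nat.card {I : Ideal (𝓞 K) // Ideal.absNorm I = 0} by simp [Ideal.absNorm_eq_zero_iff],
    Finset.sum_Ioc_add_eq_sum_Icc (n.zero_le),
    ← Finset.card_preimage_eq_sum_card_image_eq (fun k _ ↦ Ideal.finite_setOfPred_absNorm_eq k)]
  simp [Set.coe_eq_subtype]

lemma rK_summable (s : ℂ) (hs : 1 < s.re) : LSeriesSummable (fun n => (rK K n : ℂ)) s := by
  refine LSeriesSummable_of_sum_norm_bigO_and_nonneg (r := 1) ?_ (rK_nonneg K) zero_le_one hs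
  have h1 := (rK_tendsto K).isBigO_one ℝ
  have h2 := h1.mul (Asymptotics.isBigO_refl (fun n : ℕ => (n : ℝ)) atTop)
  simp only [one_mul] at h2
  simp only [Real.rpow_one]
  refine h2.congr' ?_ EventuallyEq.rfl
  filter_upwards [eventually_ne_atTop 0] with n hn
  field_simp

lemma tsum_fiber_nat {α : Type*} (f : α → ℕ) (hf : ∀ n, Finite {a // f a = n}) (g : ℕ → ℝ)
    (hs : Summable (fun a => g (f a))) :
    HasSum (fun n : ℕ => (Nat.card {a // f a = n} : ℝ) * g n) (∑' a, g (f a)) := by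
  have h1 := ((Equiv.sigmaFiberEquiv f).hasSum_iff.2 hs.hasSum)
  refine h1.sigma fun n => ?_
  have := hf n
  have := Fintype.ofFinite {a // f a = n}
  have h2 := hasSum_fintype (fun c : {a // f a = n} =>
    ((fun a => g (f a)) ∘ (Equiv.sigmaFiberEquiv f)) ⟨n, c⟩)
  convert! h2 using 1
  have h3 : ∀ c : {a // f a = n}, ((fun a => g (f a)) ∘ (Equiv.sigmaFiberEquiv f)) ⟨n, c⟩ = g n := by
    intro c
    change g (f c.1) = g n
    rw [c.2]
  rw [Finset.sum_congr rfl (fun c _ => h3 c)]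
  simp

lemma Th_rK (t : ℝ) (ht : 0 < t) : Th (rK K) t = TT K t⁻¹ := by
  have hs : Summable (hI K t⁻¹) := summable_of_hasFiniteSupport (hI_finite K _ (inv_pos.2 ht))
  have h := tsum_fiber_nat (fun I : (Ideal (𝓞 K))⁰ => Ideal.absNorm (I : Ideal (𝓞 K))) (fin_fiber K)
    (fun n => hat (Real.log (n / t⁻¹))) hs
  have h2 := Complex.hasSum_ofReal.2 h
  rw [Th, TT, ← tsum_congr (fun n => ?_), h2.tsum_eq]
  · rfl
  · rw [HH, div_inv_eq_mul, ofReal_mul]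
    rfl

theorem zeta_analytic : ∃ F : ℂ → ℂ, (∀ s : ℂ, 1 - 1 / (finrank ℚ K : ℝ) < s.re → DifferentiableAt ℂ F s) ∧
    (∀ s : ℂ, 1 < s.re → (s - 1) * LSeries (fun n => (rK K n : ℂ)) s = F s) ∧ F 1 ≠ 0 := by
  obtain ⟨c, M, hM, h⟩ := TT_asymp K
  have hd : (1 : ℝ) ≤ finrank ℚ K := by exact_mod_cast (finrank_pos : 0 < finrank ℚ K)
  have hd2 : 1 / (finrank ℚ K : ℝ) ≤ 1 := by rw [div_le_one (by linarith)]; exact hd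
  have hd3 : 0 < 1 / (finrank ℚ K : ℝ) := by positivity
  obtain ⟨F, hF1, hF2⟩ := analytic_of_theta (rK K) (rK_zero K) (rK_nonneg K) (rK_summable K) c M
    (1 - 1 / (finrank ℚ K : ℝ)) (by linarith) (by linarith) (fun t ht0 ht1 => by
      have h1 := h t⁻¹ ((one_le_inv₀ ht0).2 ht1)
      rw [Th_rK K t ht0, ← ofReal_mul, ← ofReal_sub, norm_real, Real.rpow_neg ht0.le,
        ← Real.inv_rpow ht0.le]
      exact h1)
  refine ⟨F, hF1, hF2, ?_⟩
  have h1 := tendsto_sub_one_mul_dedekindZeta_nhdsGT K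
  have h2 : Tendsto (fun s : ℝ => F s) (𝓝[>] 1) (𝓝 (F 1)) := by
    have h3 : ContinuousAt F ((1 : ℝ) : ℂ) := (hF1 _ (by rw [ofReal_re]; linarith)).continuousAt
    have h4 : ContinuousAt (fun s : ℝ => F s) 1 :=
      ContinuousAt.comp (f := fun s : ℝ => (s : ℂ)) h3 (by fun_prop)
    have h5 := h4.tendsto.mono_left (nhdsWithin_le_nhds (s := Ioi 1))
    simpa using h5
  have h3 : (dedekindZeta_residue K : ℂ) = F 1 := by
    refine tendsto_nhds_unique h1 (h2.congr' ?_)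
    filter_upwards [self_mem_nhdsWithin] with s hs
    rw [← LSeries_rK, hF2 _ (by simpa using hs)]
  rw [← h3]
  exact_mod_cast dedekindZeta_residue_ne_zero K

end PIT

end

section

namespace PIT
open Complex MeasureTheory Set Filter Topology NumberField Module
open scoped nonZeroDivisors

section
variable (K : Type*) [Field K] [NumberField K]
open scoped Classical
open UniqueFactorizationMonoid

/-- nonzero primes of norm at most n -/
noncomputable def Pr (n : ℕ) : Finset (Ideal (𝓞 K)) :=
  (Ideal.finite_setOfPred_absNorm_le (S := 𝓞 K) n).toFinset.filter (fun P => P.IsPrime ∧ P ≠ ⊥)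

/-- ideals of norm n -/
noncomputable def Sn (n : ℕ) : Finset (Ideal (𝓞 K)) :=
  (Ideal.finite_setOfPred_absNorm_eq (S := 𝓞 K) n).toFinset

variable {K} in
lemma mem_Pr {n : ℕ} {P : Ideal (𝓞 K)} : P ∈ Pr K n ↔ Ideal.absNorm P ≤ n ∧ P.IsPrime ∧ P ≠ ⊥ := by
  simp [Pr]

variable {K} in
lemma mem_Sn {n : ℕ} {P : Ideal (𝓞 K)} : P ∈ Sn K n ↔ Ideal.absNorm P = n := by
  simp [Sn]

lemma rK_Sn (n : ℕ) (hn : n ≠ 0) : rK K n = (Sn K n).card := by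
  rw [rK_eq K n hn]
  congr 1
  have h := Nat.card_congr (Equiv.subtypeEquivRight
    (fun I : Ideal (𝓞 K) => (mem_Sn (K := K) (n := n) (P := I)).symm))
  rw [h]
  simp

variable {K} in
lemma two_le_norm {P : Ideal (𝓞 K)} (hP : P.IsPrime) (h0 : P ≠ ⊥) : 2 ≤ Ideal.absNorm P := by
  have h1 : Ideal.absNorm P ≠ 0 := by rwa [Ne, Ideal.absNorm_eq_zero_iff]
  have h2 : Ideal.absNorm P ≠ 1 := by
    rw [Ne, Ideal.absNorm_eq_one_iff]; exact hP.ne_top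
  omega

variable {K} in
lemma log_norm_sum {I : Ideal (𝓞 K)} (hI : I ≠ ⊥) {n : ℕ} (hn : Ideal.absNorm I ≤ n) :
    Real.log (Ideal.absNorm I) = ∑ P ∈ Pr K n, ∑ k ∈ Finset.Icc 1 n,
      if P ^ k ∣ I then Real.log (Ideal.absNorm P) else 0 := by
  have hI0 : Ideal.absNorm I ≠ 0 := by rwa [Ne, Ideal.absNorm_eq_zero_iff]
  have hprod : (normalizedFactors I).prod = I := Ideal.prod_normalizedFactors_eq_self hI
  have hmem : ∀ P ∈ (normalizedFactors I).toFinset, P.IsPrime ∧ P ≠ ⊥ ∧ P ∣ I := by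
    intro P hP
    rw [Multiset.mem_toFinset] at hP
    have h1 := prime_of_normalized_factor P hP
    exact ⟨Ideal.isPrime_of_prime h1, h1.ne_zero, dvd_of_mem_normalizedFactors hP⟩
  have h1 : Real.log (Ideal.absNorm I) = ∑ P ∈ (normalizedFactors I).toFinset,
      (Multiset.count P (normalizedFactors I) : ℝ) * Real.log (Ideal.absNorm P) := by
    conv_lhs => rw [← hprod, Finset.prod_multiset_count, map_prod]
    push_cast
    rw [Real.log_prod]
    · refine Finset.sum_congr rfl fun P hP => ?_
      rw [map_pow, Nat.cast_pow, Real.log_pow]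
    · intro P hP
      have := two_le_norm (hmem P hP).1 (hmem P hP).2.1
      rw [map_pow, Nat.cast_pow]
      positivity
  rw [h1]
  have hsub : (normalizedFactors I).toFinset ⊆ Pr K n := by
    intro P hP
    obtain ⟨h2, h3, h4⟩ := hmem P hP
    rw [mem_Pr]
    exact ⟨(Nat.le_of_dvd (Nat.pos_of_ne_zero hI0) (map_dvd Ideal.absNorm h4)).trans hn, h2, h3⟩
  rw [Finset.sum_subset hsub (fun P _ hP => by
    rw [Multiset.mem_toFinset] at hP
    rw [Multiset.count_eq_zero_of_notMem hP]; simp)]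
  refine Finset.sum_congr rfl fun P hP => ?_
  obtain ⟨-, h2, h3⟩ := mem_Pr.1 hP
  have hirr : Irreducible P := (Ideal.prime_of_isPrime h3 h2).irreducible
  have hdv : ∀ k : ℕ, P ^ k ∣ I ↔ k ≤ Multiset.count P (normalizedFactors I) := by
    intro k
    rw [pow_dvd_iff_le_emultiplicity, emultiplicity_eq_count_normalizedFactors hirr hI,
      normalize_eq]
    exact_mod_cast Iff.rfl
  have hc : Multiset.count P (normalizedFactors I) ≤ n := by
    have h4 := (hdv _).2 le_rfl
    have h5 := Nat.le_of_dvd (Nat.pos_of_ne_zero hI0) (map_dvd Ideal.absNorm h4)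
    rw [map_pow] at h5
    exact (Nat.lt_pow_self (two_le_norm h2 h3)).le.trans (h5.trans hn)
  simp_rw [hdv]
  rw [← Finset.sum_filter, Finset.sum_const, nsmul_eq_mul]
  congr 2
  have : Finset.filter (fun k => k ≤ Multiset.count P (normalizedFactors I)) (Finset.Icc 1 n)
    = Finset.Icc 1 (Multiset.count P (normalizedFactors I)) := by
    ext k; simp only [Finset.mem_filter, Finset.mem_Icc]; omega
  rw [this]
  simp

/-- von Mangoldt function of K, summed over ideals of given norm -/
noncomputable def LK (a : ℕ) : ℝ := ∑ P ∈ Pr K a, ∑ k ∈ Finset.Icc 1 a,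
  if Ideal.absNorm P ^ k = a then Real.log (Ideal.absNorm P) else 0

lemma LK_eq {a n : ℕ} (h : a ≤ n) : LK K a = ∑ P ∈ Pr K n, ∑ k ∈ Finset.Icc 1 n,
    if Ideal.absNorm P ^ k = a then Real.log (Ideal.absNorm P) else 0 := by
  rw [LK]
  have hsub : Pr K a ⊆ Pr K n := fun P hP => by
    rw [mem_Pr] at hP ⊢
    exact ⟨hP.1.trans h, hP.2⟩
  rw [Finset.sum_subset hsub]
  · refine Finset.sum_congr rfl fun P hP => ?_
    refine Finset.sum_subset (Finset.Icc_subset_Icc le_rfl h) fun k hk hk2 => ?_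
    rw [if_neg]
    intro h1
    rw [mem_Pr] at hP
    have := (Nat.lt_pow_self (two_le_norm hP.2.1 hP.2.2) : k < _ ^ k)
    simp only [Finset.mem_Icc] at hk hk2
    omega
  · intro P hP hP2
    refine Finset.sum_eq_zero fun k hk => ?_
    rw [if_neg]
    intro h1
    rw [mem_Pr] at hP hP2
    apply hP2
    refine ⟨?_, hP.2⟩
    rw [← h1]
    have := (two_le_norm hP.2.1 hP.2.2)
    exact Nat.le_self_pow (by simp only [Finset.mem_Icc] at hk; omega) _

lemma LK_nonneg (a : ℕ) : 0 ≤ LK K a := by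
  refine Finset.sum_nonneg fun P _ => Finset.sum_nonneg fun k _ => ?_
  split_ifs
  · exact Real.log_natCast_nonneg _
  · rfl

variable {K} in
lemma card_dvd (n : ℕ) (hn : n ≠ 0) {J : Ideal (𝓞 K)} (hJ : J ≠ ⊥) :
    (((Sn K n).filter (fun I => J ∣ I)).card : ℝ) =
      ∑ x ∈ n.divisorsAntidiagonal, if Ideal.absNorm J = x.1 then rK K x.2 else 0 := by
  have hJ0 : Ideal.absNorm J ≠ 0 := by rwa [Ne, Ideal.absNorm_eq_zero_iff]
  by_cases h : Ideal.absNorm J ∣ n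
  · obtain ⟨m, rfl⟩ := h
    have hm : m ≠ 0 := by rintro rfl; simp at hn
    rw [Finset.sum_eq_single (Ideal.absNorm J, m)]
    · rw [if_pos rfl, rK_Sn K m hm]
      congr 1
      symm
      refine Finset.card_bij (fun I _ => J * I) ?_ ?_ ?_
      · intro I hI
        rw [mem_Sn] at hI
        rw [Finset.mem_filter, mem_Sn, map_mul, hI]
        exact ⟨rfl, dvd_mul_right _ _⟩
      · intro I _ I' _ h
        exact mul_left_cancel₀ hJ h
      · intro I hI
        rw [Finset.mem_filter, mem_Sn] at hI
        obtain ⟨h1, I', rfl⟩ := hI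
        refine ⟨I', ?_, rfl⟩
        rw [mem_Sn]
        rw [map_mul] at h1
        exact Nat.eq_of_mul_eq_mul_left (Nat.pos_of_ne_zero hJ0) h1
    · rintro ⟨x, y⟩ hx hne
      rw [Nat.mem_divisorsAntidiagonal] at hx
      rw [if_neg]
      rintro h1
      simp only at h1 hx
      apply hne
      rw [h1]
      congr 1
      rw [← h1] at hx
      exact Nat.eq_of_mul_eq_mul_left (Nat.pos_of_ne_zero hJ0) hx.1
    · intro h
      exact absurd (Nat.mem_divisorsAntidiagonal.2 ⟨rfl, hn⟩) h
  · rw [Finset.sum_eq_zero, Finset.filter_false_of_mem]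
    · simp
    · intro I hI h1
      rw [mem_Sn] at hI
      exact h (hI ▸ map_dvd Ideal.absNorm h1)
    · rintro ⟨x, y⟩ hx
      rw [if_neg]
      rintro rfl
      exact h (Dvd.intro _ (Nat.mem_divisorsAntidiagonal.1 hx).1)

lemma LK_conv (n : ℕ) : ∑ x ∈ n.divisorsAntidiagonal, LK K x.1 * rK K x.2 = Real.log n * rK K n := by
  by_cases hn : n = 0
  · subst hn; simp
  calc _ = ∑ x ∈ n.divisorsAntidiagonal, ∑ P ∈ Pr K n, ∑ k ∈ Finset.Icc 1 n,
      Real.log (Ideal.absNorm P) * (if Ideal.absNorm (P ^ k) = x.1 then rK K x.2 else 0) := by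
        refine Finset.sum_congr rfl fun x hx => ?_
        rw [LK_eq K (Nat.divisor_le (Nat.fst_mem_divisors_of_mem_antidiagonal hx)), Finset.sum_mul]
        refine Finset.sum_congr rfl fun P _ => ?_
        rw [Finset.sum_mul]
        refine Finset.sum_congr rfl fun k _ => ?_
        rw [map_pow]
        split_ifs <;> simp
    _ = ∑ P ∈ Pr K n, ∑ k ∈ Finset.Icc 1 n, Real.log (Ideal.absNorm P) *
        ((Sn K n).filter (fun I => P ^ k ∣ I)).card := by
        rw [Finset.sum_comm]
        refine Finset.sum_congr rfl fun P hP => ?_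
        rw [Finset.sum_comm]
        refine Finset.sum_congr rfl fun k _ => ?_
        rw [mem_Pr] at hP
        rw [card_dvd n hn (pow_ne_zero k hP.2.2), Finset.mul_sum]
    _ = ∑ I ∈ Sn K n, ∑ P ∈ Pr K n, ∑ k ∈ Finset.Icc 1 n,
        if P ^ k ∣ I then Real.log (Ideal.absNorm P) else 0 := by
        rw [Finset.sum_comm (s := Sn K n)]
        refine Finset.sum_congr rfl fun P hP => ?_
        rw [Finset.sum_comm (s := Sn K n)]
        refine Finset.sum_congr rfl fun k _ => ?_
        rw [← Finset.sum_filter, Finset.sum_const, nsmul_eq_mul, mul_comm]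
    _ = ∑ I ∈ Sn K n, Real.log n := by
        refine Finset.sum_congr rfl fun I hI => ?_
        rw [mem_Sn] at hI
        rw [← log_norm_sum (n := n) (by rintro rfl; simp at hI; exact hn hI.symm) hI.le, hI]
    _ = _ := by
        rw [Finset.sum_const, nsmul_eq_mul, rK_Sn K n hn, mul_comm]

lemma sum_log_le (p : ℕ) (hp : p.Prime) (S : Finset (Ideal (𝓞 K)))
    (hS : ∀ P ∈ S, P.IsPrime ∧ P ≠ ⊥ ∧ (p : 𝓞 K) ∈ P) :
    ∑ P ∈ S, Real.log (Ideal.absNorm P) ≤ finrank ℚ K * Real.log p := by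
  have h1 : ∏ P ∈ S, P ∣ Ideal.span {(p : 𝓞 K)} := by
    refine Finset.prod_primes_dvd _ (fun P hP => Ideal.prime_of_isPrime (hS P hP).2.1 (hS P hP).1) ?_
    intro P hP
    rw [Ideal.dvd_span_singleton]
    exact (hS P hP).2.2
  have h2 := map_dvd Ideal.absNorm h1
  have h3 : Ideal.absNorm (Ideal.span {(p : 𝓞 K)}) = p ^ finrank ℚ K := by
    rw [Ideal.absNorm_span_natCast, RingOfIntegers.rank]
  rw [h3, map_prod] at h2
  have h4 := Nat.le_of_dvd (pow_pos hp.pos _) h2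
  have hpos : ∀ P ∈ S, 2 ≤ Ideal.absNorm P := fun P hP => two_le_norm (hS P hP).1 (hS P hP).2.1
  rw [← Real.log_prod (fun P hP => by have := hpos P hP; positivity), ← Real.log_pow]
  apply Real.log_le_log
  · exact Finset.prod_pos fun P hP => by have := hpos P hP; positivity
  · exact_mod_cast h4

lemma exists_pp (P : Ideal (𝓞 K)) (hP : P.IsPrime) (h0 : P ≠ ⊥) :
    ∃ p i : ℕ, p.Prime ∧ 0 < i ∧ Ideal.absNorm P = p ^ i := by
  have : P.IsMaximal := hP.isMaximal h0
  obtain ⟨p, i, h1, _, h2, h3⟩ := Ideal.exists_prime_and_absNorm_eq_pow P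
  exact ⟨p, i, h2, h1, h3⟩

lemma LK_le (a : ℕ) : LK K a ≤ finrank ℚ K * ArithmeticFunction.vonMangoldt a := by
  by_cases ha : ∃ P ∈ Pr K a, ∃ k ∈ Finset.Icc 1 a, Ideal.absNorm P ^ k = a
  · obtain ⟨P₀, hP₀, k₀, hk₀, hk⟩ := ha
    have hP₁ := mem_Pr.1 hP₀
    have : P₀.IsMaximal := hP₁.2.1.isMaximal hP₁.2.2
    obtain ⟨p, i, hp, hi, hN⟩ := exists_pp K P₀ hP₁.2.1 hP₁.2.2
    have hk0 : 1 ≤ k₀ := (Finset.mem_Icc.1 hk₀).1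
    rw [hN, ← pow_mul] at hk
    have hL : ArithmeticFunction.vonMangoldt a = Real.log p := by
      rw [← hk, ArithmeticFunction.vonMangoldt_apply_pow (by positivity),
        ArithmeticFunction.vonMangoldt_apply_prime hp]
    rw [hL]
    refine le_trans ?_ (sum_log_le K p hp ((Pr K a).filter (fun P => (p : 𝓞 K) ∈ P)) ?_)
    · rw [LK, Finset.sum_filter]
      refine Finset.sum_le_sum fun P hP => ?_
      rw [mem_Pr] at hP
      have h2 := two_le_norm hP.2.1 hP.2.2
      by_cases hex : ∃ k ∈ Finset.Icc 1 a, Ideal.absNorm P ^ k = a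
      · obtain ⟨k, hk1, hk2⟩ := hex
        have hmem : (p : 𝓞 K) ∈ P := by
          have h3 : ((Ideal.absNorm P : ℕ) : 𝓞 K) ^ k ∈ P :=
            Ideal.pow_mem_of_mem P (Ideal.absNorm_mem P) k (by
              have := (Finset.mem_Icc.1 hk1).1; omega)
          rw [← Nat.cast_pow, hk2, ← hk, Nat.cast_pow] at h3
          exact hP.2.1.mem_of_pow_mem _ h3
        rw [if_pos hmem, Finset.sum_eq_single k]
        · rw [if_pos hk2]
        · intro k' _ hne
          rw [if_neg]
          intro h4
          exact hne (Nat.pow_right_injective h2 (h4.trans hk2.symm))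
        · exact fun h => absurd hk1 h
      · push Not at hex
        rw [Finset.sum_eq_zero fun k hk => if_neg (hex k hk)]
        split_ifs
        · exact Real.log_natCast_nonneg _
        · rfl
    · intro P hP
      rw [Finset.mem_filter, mem_Pr] at hP
      exact ⟨hP.1.2.1, hP.1.2.2, hP.2⟩
  · push Not at ha
    rw [LK, Finset.sum_eq_zero fun P hP => Finset.sum_eq_zero fun k hk => if_neg (ha P hP k hk)]
    exact mul_nonneg (Nat.cast_nonneg _) ArithmeticFunction.vonMangoldt_nonneg

lemma LK_prime (p : ℕ) (hp : p.Prime) : LK K p = rK K p * Real.log p := by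
  have h1 : ∀ P ∈ Pr K p, (∑ k ∈ Finset.Icc 1 p,
      if Ideal.absNorm P ^ k = p then Real.log (Ideal.absNorm P) else 0) =
      if Ideal.absNorm P = p then Real.log p else 0 := by
    intro P hP
    rw [Finset.sum_eq_single 1]
    · rw [pow_one]
      split_ifs with h
      · rw [h]
      · rfl
    · intro k hk hk1
      rw [if_neg]
      intro h
      exact hk1 (((Nat.Prime.pow_eq_iff hp).1 h).2)
    · intro h
      simp at h
      have := hp.pos
      omega
  rw [LK, Finset.sum_congr rfl h1, ← Finset.sum_filter, Finset.sum_const, nsmul_eq_mul,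
    rK_Sn K p hp.ne_zero]
  congr 3
  ext P
  rw [Finset.mem_filter, mem_Pr, mem_Sn]
  refine ⟨fun h => h.2, fun h => ⟨⟨h.le, ?_, ?_⟩, h⟩⟩
  · exact Ideal.isPrime_of_irreducible_absNorm (by rw [h]; exact hp)
  · rintro rfl
    simp at h
    exact hp.ne_zero h.symm

lemma LK_summable (s : ℂ) (hs : 1 < s.re) : LSeriesSummable (fun n => (LK K n : ℂ)) s := by
  have h := (ArithmeticFunction.LSeriesSummable_vonMangoldt hs).norm.mul_left (finrank ℚ K : ℝ)
  refine Summable.of_norm_bounded h fun n => ?_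
  rw [LSeries.norm_term_eq, LSeries.norm_term_eq]
  split_ifs with h0
  · simp
  · rw [← mul_div_assoc]
    gcongr
    rw [norm_real, norm_real, Real.norm_of_nonneg (LK_nonneg K n),
      Real.norm_of_nonneg ArithmeticFunction.vonMangoldt_nonneg]
    exact LK_le K n

lemma LK_LSeries (s : ℂ) (hs : 1 < s.re) :
    LSeries (fun n => (LK K n : ℂ)) s * LSeries (fun n => (rK K n : ℂ)) s =
      - deriv (LSeries (fun n => (rK K n : ℂ))) s := by
  rw [← LSeries_convolution' (LK_summable K s hs) (rK_summable K s hs), LSeries_deriv, neg_neg]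
  · refine LSeries_congr (fun {n} hn => ?_) s
    rw [LSeries.convolution_def, LSeries.logMul, ← natCast_log, ← ofReal_mul, ← LK_conv]
    push_cast
    rfl
  · refine lt_of_le_of_lt (LSeries.abscissaOfAbsConv_le_of_forall_lt_LSeriesSummable (x := 1) ?_)
      (by exact_mod_cast hs)
    intro y hy
    exact rK_summable K _ (by simpa using hy)

end
end PIT

end

section

namespace PIT
open Complex MeasureTheory Set Filter Topology NumberField Module
open scoped nonZeroDivisors

lemma order_lim {f : ℂ → ℂ} {z : ℂ} (hf : AnalyticAt ℂ f z) (hne : ¬ ∀ᶠ s in 𝓝 z, f s = 0) :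
    ∃ m : ℕ, Tendsto (fun s => (s - z) * logDeriv f s) (𝓝[≠] z) (𝓝 m) ∧ (m = 0 → f z ≠ 0) ∧
      ∀ᶠ s in 𝓝[≠] z, f s ≠ 0 := by
  obtain ⟨m, g, hg, hg0, hfg⟩ := hf.exists_eventuallyEq_pow_smul_nonzero_iff.2 hne
  refine ⟨m, ?_, ?_, ?_⟩
  · have hgd : ∀ᶠ s in 𝓝 z, AnalyticAt ℂ g s := hg.eventually_analyticAt
    have hgn : ∀ᶠ s in 𝓝 z, g s ≠ 0 := hg.continuousAt.eventually_ne hg0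
    have hlim : Tendsto (fun s => (m : ℂ) + (s - z) * logDeriv g s) (𝓝 z) (𝓝 (m + (z - z) * logDeriv g z)) := by
      have : ContinuousAt (fun s => (m : ℂ) + (s - z) * logDeriv g s) z := by
        have h1 : ContinuousAt (logDeriv g) z := by
          have : ContinuousAt (fun s => deriv g s / g s) z := hg.deriv.continuousAt.div hg.continuousAt hg0
          exact this
        fun_prop
      exact this.tendsto
    rw [sub_self, zero_mul, add_zero] at hlim
    refine (hlim.mono_left nhdsWithin_le_nhds).congr' ?_
    have hfg2 : ∀ᶠ s in 𝓝 z, f =ᶠ[𝓝 s] fun s => (s - z) ^ m • g s := hfg.eventually_nhds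
    filter_upwards [self_mem_nhdsWithin, nhdsWithin_le_nhds hgd, nhdsWithin_le_nhds hgn,
      nhdsWithin_le_nhds hfg2] with s hs h1 h2 h3
    have hs' : s - z ≠ 0 := sub_ne_zero.2 hs
    have h4 : logDeriv f s = logDeriv (fun s => (s - z) ^ m * g s) s := by
      rw [logDeriv_apply, logDeriv_apply, h3.deriv_eq, h3.eq_of_nhds]
      rfl
    rw [h4, logDeriv_mul (f := fun s => (s - z) ^ m) s (pow_ne_zero _ hs') h2 (by fun_prop) h1.differentiableAt,
      mul_add]
    congr 1
    rw [logDeriv_fun_pow (by fun_prop), logDeriv_apply]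
    simp
    field_simp
  · rintro rfl
    have hfg' := hfg.self_of_nhds
    rw [hfg']
    simpa using hg0
  · have hgn : ∀ᶠ s in 𝓝 z, g s ≠ 0 := hg.continuousAt.eventually_ne hg0
    filter_upwards [self_mem_nhdsWithin, nhdsWithin_le_nhds hgn, nhdsWithin_le_nhds hfg] with s hs h1 h2
    rw [h2]
    exact smul_ne_zero (pow_ne_zero _ (sub_ne_zero.2 hs)) h1

/-- real part of 3-4-1 -/
lemma three_four_one (a : ℕ → ℝ) (ha : ∀ n, 0 ≤ a n)
    (hs : ∀ s : ℂ, 1 < s.re → LSeriesSummable (fun n => (a n : ℂ)) s) (σ t : ℝ) (hσ : 1 < σ) :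
    0 ≤ 3 * (LSeries (fun n => (a n : ℂ)) σ).re + 4 * (LSeries (fun n => (a n : ℂ)) (σ + t * I)).re
      + (LSeries (fun n => (a n : ℂ)) (σ + 2 * t * I)).re := by
  have h0 := hs σ (by simpa using hσ)
  have h1 := hs (σ + t * I) (by simpa using hσ)
  have h2 := hs (σ + 2 * t * I) (by simpa using hσ)
  have s0 := (hasSum_re h0.hasSum).summable.mul_left 3
  have s1 := (hasSum_re h1.hasSum).summable.mul_left 4
  have s2 := (hasSum_re h2.hasSum).summable
  rw [LSeries, LSeries, LSeries, re_tsum h0, re_tsum h1, re_tsum h2, ← tsum_mul_left, ← tsum_mul_left,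
    ← Summable.tsum_add, ← Summable.tsum_add]
  · refine tsum_nonneg fun n => ?_
    by_cases hn : n = 0
    · simp [hn]
    have hn' : (0 : ℝ) < n := by positivity
    have key : ∀ u : ℝ, (LSeries.term (fun n => (a n : ℂ)) (σ + u * I) n).re
        = a n * n ^ (-σ) * Real.cos (u * Real.log n) := by
      intro u
      rw [LSeries.term_of_ne_zero hn, div_eq_mul_inv, ← cpow_neg, neg_add, cpow_add _ _ (by exact_mod_cast hn)]
      have e1 : (n : ℂ) ^ (-(σ : ℂ)) = ((n ^ (-σ) : ℝ) : ℂ) := by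
        rw [ofReal_cpow hn'.le]; simp
      have e2 : (n : ℂ) ^ (-((u : ℂ) * I)) = exp ((-(u * Real.log n) : ℝ) * I) := by
        rw [cpow_def_of_ne_zero (by exact_mod_cast hn), ← natCast_log]
        congr 1
        push_cast
        ring
      rw [e1, e2, ← mul_assoc, ← ofReal_mul, re_ofReal_mul, exp_ofReal_mul_I_re, Real.cos_neg]
    have k0 := key 0
    have k1 := key t
    have k2 := key (2 * t)
    simp only [ofReal_zero, zero_mul, add_zero, Real.cos_zero, mul_one] at k0
    push_cast at k2
    rw [k0, k1, k2]
    have e3 : Real.cos (2 * t * Real.log n) = 2 * Real.cos (t * Real.log n) ^ 2 - 1 := by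
      rw [mul_assoc, Real.cos_two_mul]
    rw [e3]
    have e4 : 0 ≤ a n * (n : ℝ) ^ (-σ) := mul_nonneg (ha n) (by positivity)
    nlinarith [mul_nonneg e4 (sq_nonneg (1 + Real.cos (t * Real.log n)))]
  · exact s0.add s1
  · exact s2
  · exact s0
  · exact s1

theorem LK_continuation (K : Type*) [Field K] [NumberField K] :
    ∃ G : ℂ → ℂ, (∀ s, 1 ≤ s.re → ContinuousAt G s) ∧
      ∀ s : ℂ, 1 < s.re → LSeries (fun n => (LK K n : ℂ)) s = 1 / (s - 1) + G s := by
  obtain ⟨F, hF1, hF2, hF3⟩ := zeta_analytic K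
  set Z := LSeries (fun n => (rK K n : ℂ)) with hZ
  set L := LSeries (fun n => (LK K n : ℂ)) with hL
  have hd3 : 0 < 1 / (finrank ℚ K : ℝ) := by
    have : 0 < finrank ℚ K := finrank_pos
    positivity
  set α := 1 - 1 / (finrank ℚ K : ℝ) with hα
  have hα1 : α < 1 := by linarith
  have hU : IsOpen {s : ℂ | α < s.re} := isOpen_lt continuous_const continuous_re
  have hFa : ∀ s : ℂ, α < s.re → AnalyticAt ℂ F s := fun s hs => by
    have : DifferentiableOn ℂ F {s : ℂ | α < s.re} := fun z hz => (hF1 z hz).differentiableWithinAt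
    exact this.analyticAt (hU.mem_nhds hs)
  have hne : ∀ s : ℂ, α < s.re → ¬ ∀ᶠ w in 𝓝 s, F w = 0 := by
    intro s hs h
    have hpc : IsPreconnected {s : ℂ | α < s.re} := (convex_halfSpace_re_gt α).isPreconnected
    have h1 := AnalyticOnNhd.eqOn_zero_of_preconnected_of_eventuallyEq_zero
      (f := F) (U := {s : ℂ | α < s.re}) (fun s hs => hFa s hs) hpc hs h
    exact hF3 (h1 (by simpa using hα1))
  have hop : IsOpen {s : ℂ | 1 < s.re} := isOpen_lt continuous_const continuous_re
  -- relation
  have hrel : ∀ s : ℂ, 1 < s.re → F s ≠ 0 → L s = 1 / (s - 1) - logDeriv F s := by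
    intro s hs h0
    have hs1 : s - 1 ≠ 0 := by
      intro h
      rw [sub_eq_zero.1 h] at hs
      simp at hs
    have hZ0 : Z s ≠ 0 := by
      intro h
      apply h0
      rw [← hF2 s hs, h, mul_zero]
    have hZF : Z =ᶠ[𝓝 s] fun s => F s / (s - 1) := by
      filter_upwards [hop.mem_nhds hs] with w hw
      rw [← hF2 w hw, mul_div_cancel_left₀]
      intro h
      rw [sub_eq_zero.1 h] at hw
      simp at hw
    have h1 := LK_LSeries K s hs
    have h2 : L s = - logDeriv Z s := by
      rw [logDeriv_apply, ← neg_div, eq_div_iff hZ0]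
      exact h1
    have h3 : logDeriv Z s = logDeriv (fun s => F s / (s - 1)) s := by
      rw [logDeriv_apply, logDeriv_apply, hZF.deriv_eq, hZF.eq_of_nhds]
    rw [h2, h3, logDeriv_div (f := F) (g := fun s => s - 1) s h0 hs1 (hF1 s (by linarith)) (by fun_prop)]
    rw [logDeriv_apply (fun s => s - 1)]
    simp
  -- no zeros to the right of 1
  have hnz1 : ∀ s : ℂ, 1 < s.re → F s ≠ 0 := by
    intro s hs
    obtain ⟨m, hm1, hm2, hm3⟩ := order_lim (hFa s (by linarith)) (hne s (by linarith))
    apply hm2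
    have hLc : ContinuousAt L s := by
      refine (LSeries_hasDerivAt ?_).continuousAt
      refine lt_of_le_of_lt (LSeries.abscissaOfAbsConv_le_of_forall_lt_LSeriesSummable (x := 1) ?_)
        (by exact_mod_cast hs)
      intro y hy
      exact LK_summable K _ (by simpa using hy)
    have hs1 : s - 1 ≠ 0 := by
      intro h
      rw [sub_eq_zero.1 h] at hs
      simp at hs
    have h1 : Tendsto (fun w => (w - s) * (1 / (w - 1) - L w)) (𝓝[≠] s) (𝓝 ((s - s) * (1 / (s - 1) - L s))) := by
      have : ContinuousAt (fun w => (w - s) * (1 / (w - 1) - L w)) s := by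
        have h2 : ContinuousAt (fun w : ℂ => 1 / (w - 1)) s := continuousAt_const.div (by fun_prop) hs1
        exact ContinuousAt.mul (by fun_prop) (h2.sub hLc)
      exact this.tendsto.mono_left nhdsWithin_le_nhds
    have h2 := hm1.congr' (f₂ := fun w => (w - s) * (1 / (w - 1) - L w)) (by
      filter_upwards [hm3, nhdsWithin_le_nhds (hop.mem_nhds hs)] with w hw1 hw2
      rw [hrel w hw2 hw1]
      ring)
    have h3 := tendsto_nhds_unique h1 h2
    rw [sub_self, zero_mul] at h3
    exact_mod_cast h3.symm
  -- limits on vertical approach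
  have hvert : ∀ t : ℝ, ∃ m : ℕ, (m = 0 → F (1 + t * I) ≠ 0) ∧
      Tendsto (fun σ : ℝ => ((σ : ℂ) - 1) * (1 / (σ + t * I - 1) - L (σ + t * I))) (𝓝[>] 1) (𝓝 m) := by
    intro t
    obtain ⟨m, hm1, hm2, hm3⟩ := order_lim (hFa (1 + t * I) (by simpa using hα1)) (hne _ (by simpa using hα1))
    refine ⟨m, hm2, ?_⟩
    have h1 : Tendsto (fun σ : ℝ => (σ : ℂ) + t * I) (𝓝[>] 1) (𝓝[≠] (1 + t * I)) := by
      rw [tendsto_nhdsWithin_iff]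
      constructor
      · have : ContinuousAt (fun σ : ℝ => (σ : ℂ) + t * I) 1 := by fun_prop
        have h2 := this.tendsto.mono_left (nhdsWithin_le_nhds (s := Ioi 1))
        simpa using h2
      · filter_upwards [self_mem_nhdsWithin] with σ hσ
        intro h
        have := congrArg re h
        simp at this
        rw [mem_Ioi, this] at hσ
        exact lt_irrefl _ hσ
    refine (hm1.comp h1).congr' ?_
    filter_upwards [self_mem_nhdsWithin] with σ hσ
    have hσ' : 1 < ((σ : ℂ) + t * I).re := by simpa using hσ
    simp only [Function.comp_apply]
    rw [hrel _ hσ' (hnz1 _ hσ')]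
    ring
  have hpole : ∀ t : ℝ, t ≠ 0 → Tendsto (fun σ : ℝ => ((σ : ℂ) - 1) * (1 / (σ + t * I - 1))) (𝓝[>] 1) (𝓝 0) := by
    intro t ht
    have : ContinuousAt (fun σ : ℝ => ((σ : ℂ) - 1) * (1 / (σ + t * I - 1))) 1 := by
      refine ContinuousAt.mul (by fun_prop) (continuousAt_const.div (by fun_prop) ?_)
      simpa using ht
    have h2 := this.tendsto.mono_left (nhdsWithin_le_nhds (s := Ioi 1))
    simpa using h2
  have hlimL : ∀ t : ℝ, t ≠ 0 → ∃ m : ℕ, (m = 0 → F (1 + t * I) ≠ 0) ∧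
      Tendsto (fun σ : ℝ => (σ - 1) * (L (σ + t * I)).re) (𝓝[>] 1) (𝓝 (-m)) := by
    intro t ht
    obtain ⟨m, h1, h2⟩ := hvert t
    refine ⟨m, h1, ?_⟩
    have h3 := (continuous_re.tendsto _).comp ((hpole t ht).sub h2)
    simp only [zero_sub, neg_re, natCast_re] at h3
    refine h3.congr fun σ => ?_
    simp only [Function.comp_apply]
    rw [← mul_sub, sub_sub_cancel, ← ofReal_one, ← ofReal_sub, re_ofReal_mul]
  have hlim1 : Tendsto (fun σ : ℝ => (σ - 1) * (L σ).re) (𝓝[>] 1) (𝓝 1) := by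
    have h1 : Tendsto (fun σ : ℝ => ((σ : ℂ) - 1) * logDeriv F σ) (𝓝[>] 1) (𝓝 ((1 - 1) * logDeriv F 1)) := by
      have h2 : ContinuousAt (logDeriv F) ((1 : ℝ) : ℂ) := by
        have h3 := hFa 1 (by simpa using hα1)
        have : ContinuousAt (fun s => deriv F s / F s) 1 := h3.deriv.continuousAt.div h3.continuousAt hF3
        rw [ofReal_one]
        exact this
      have h4 : ContinuousAt (fun σ : ℝ => ((σ : ℂ) - 1) * logDeriv F σ) 1 := by
        refine ContinuousAt.mul (by fun_prop) ?_
        exact ContinuousAt.comp (f := fun s : ℝ => (s : ℂ)) h2 (by fun_prop)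
      have h5 := h4.tendsto.mono_left (nhdsWithin_le_nhds (s := Ioi 1))
      simpa using h5
    have h2 := (continuous_re.tendsto _).comp (h1.const_sub 1)
    simp only [sub_self, zero_mul, sub_zero, one_re] at h2
    refine h2.congr' ?_
    filter_upwards [self_mem_nhdsWithin] with σ hσ
    have hσ' : 1 < (σ : ℂ).re := by simpa using hσ
    have hσ0 : (σ : ℂ) - 1 ≠ 0 := by
      rw [sub_ne_zero]
      exact_mod_cast (ne_of_gt hσ : σ ≠ 1)
    simp only [Function.comp_apply]
    rw [← re_ofReal_mul, hrel _ hσ' (hnz1 _ hσ')]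
    push_cast
    congr 1
    field_simp
  have hnz : ∀ s : ℂ, 1 ≤ s.re → F s ≠ 0 := by
    intro s hs
    rcases hs.lt_or_eq with hs | hs
    · exact hnz1 s hs
    obtain ⟨t, rfl⟩ : ∃ t : ℝ, s = 1 + t * I := ⟨s.im, by
      apply Complex.ext <;> simp [← hs]⟩
    by_cases ht : t = 0
    · simpa [ht] using hF3
    obtain ⟨m, hm, hl⟩ := hlimL t ht
    obtain ⟨m2, _, hl2⟩ := hlimL (2 * t) (by simpa using ht)
    apply hm
    have h1 := ((hlim1.const_mul 3).add (hl.const_mul 4)).add hl2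
    have h2 : 0 ≤ 3 * (1 : ℝ) + 4 * (-(m : ℝ)) + -(m2 : ℝ) := by
      refine ge_of_tendsto h1 ?_
      filter_upwards [self_mem_nhdsWithin] with σ hσ
      have h3 := three_four_one (LK K) (LK_nonneg K) (LK_summable K) σ t hσ
      have h4 : 0 ≤ (σ - 1) := by rw [mem_Ioi] at hσ; linarith
      have h5 := mul_nonneg h4 h3
      push_cast
      rw [← hL] at h5
      linarith
    by_contra hm0
    have : (1 : ℝ) ≤ m := by exact_mod_cast Nat.one_le_iff_ne_zero.2 hm0
    have : (0 : ℝ) ≤ m2 := Nat.cast_nonneg _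
    linarith
  refine ⟨fun s => - logDeriv F s, fun s hs => ?_, fun s hs => ?_⟩
  · have h3 := hFa s (by linarith)
    have : ContinuousAt (fun s => deriv F s / F s) s := h3.deriv.continuousAt.div h3.continuousAt (hnz s hs)
    exact this.neg
  · rw [hrel s hs (hnz s hs.le), sub_eq_add_neg]

end PIT

end

section

namespace PIT
open Complex MeasureTheory Set Filter Topology

/-- Fejer kernel -/
noncomputable def kap (x : ℝ) : ℝ := (2 - 2 * Real.cos x) / x ^ 2

lemma kap_nonneg (x : ℝ) : 0 ≤ kap x := by
  unfold kap
  have := Real.cos_le_one x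
  apply div_nonneg _ (sq_nonneg _)
  linarith

lemma kap_le (x : ℝ) : kap x ≤ 5 * (1 + x ^ 2)⁻¹ := by
  unfold kap
  by_cases hx : x = 0
  · simp [hx]
  have h2 : 0 < x ^ 2 := by positivity
  have h1 := Real.one_sub_sq_div_two_le_cos (x := x)
  have h3 := Real.neg_one_le_cos x
  rw [← div_eq_mul_inv, div_le_div_iff₀ h2 (by positivity)]
  nlinarith

lemma kap_le' (x : ℝ) : kap x ≤ 4 / x ^ 2 := by
  unfold kap
  have h3 := Real.neg_one_le_cos x
  gcongr
  linarith

lemma kap_meas : Measurable kap := by unfold kap; fun_prop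

lemma kap_integrable : Integrable kap := by
  refine (integrable_inv_one_add_sq.const_mul 5).mono' kap_meas.aestronglyMeasurable ?_
  filter_upwards with x
  rw [Real.norm_of_nonneg (kap_nonneg x)]
  exact kap_le x

lemma kap_int_pos : 0 < ∫ x, kap x := by
  rw [integral_pos_iff_support_of_nonneg kap_nonneg kap_integrable]
  refine lt_of_lt_of_le (b := volume (Ioo (1 : ℝ) 2)) (by simp) (measure_mono ?_)
  intro x hx
  rw [Function.mem_support]
  have h1 : Real.cos x < 1 := by
    refine lt_of_le_of_ne (Real.cos_le_one x) fun h => ?_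
    have := (Real.cos_eq_one_iff_of_lt_of_lt (by linarith [hx.1, Real.pi_gt_three]) (by linarith [hx.2, Real.pi_gt_three])).1 h
    linarith [hx.1]
  unfold kap
  have : 0 < x := by linarith [hx.1]
  have h2 : 0 < 2 - 2 * Real.cos x := by linarith
  positivity

lemma kap_eq (x : ℝ) (hx : x ≠ 0) : ∫ v : ℝ, (hat v : ℂ) * cexp (x * I * v) = kap x := by
  rw [tri_int _ (by simpa using hx), kap, neg_mul_eq_neg_mul, ← ofReal_neg]
  rw [exp_mul_I, exp_mul_I]
  push_cast
  rw [Complex.cos_neg, Complex.sin_neg, mul_pow, I_sq]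
  have : (x : ℂ) ≠ 0 := by exact_mod_cast hx
  field_simp
  ring

lemma hat_integrable : Integrable hat :=
  hat_cont.integrable_of_hasCompactSupport (HasCompactSupport.intro (K := Icc (-1) 1) isCompact_Icc
    fun x hx => hat_eq_zero (by
      by_contra h
      push Not at h
      exact hx ⟨(abs_lt.1 h).1.le, (abs_lt.1 h).2.le⟩))

section
lemma phi_exp_integrable (φ : ℝ → ℝ) (hφm : Measurable φ) (M : ℝ) (hφb : ∀ v, |φ v| ≤ M) (hφ0 : ∀ v ≤ 0, φ v = 0)
    (ε : ℝ) (hε : 0 < ε) : Integrable (fun v => φ v * Real.exp (-ε * v)) := by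
  have h1 : IntegrableOn (fun v => φ v * Real.exp (-ε * v)) (Ioi 0) := by
    refine ((exp_neg_integrableOn_Ioi 0 hε).const_mul M).mono' (by fun_prop) ?_
    filter_upwards with v
    rw [norm_mul, Real.norm_of_nonneg (Real.exp_pos _).le, Real.norm_eq_abs]
    gcongr
    exact hφb v
  refine (integrableOn_iff_integrable_of_support_subset ?_).1 h1
  intro v hv
  by_contra h
  rw [mem_Ioi, not_lt] at h
  apply hv
  simp [hφ0 v h]

lemma fubini_step (φ : ℝ → ℝ) (hφm : Measurable φ) (M : ℝ) (hφb : ∀ v, |φ v| ≤ M) (hφ0 : ∀ v ≤ 0, φ v = 0)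
    (H : ℂ → ℂ) (hH : ∀ s : ℂ, 0 < s.re → ∫ v, (φ v : ℂ) * cexp (-s * v) = H s)
    (lam u ε : ℝ) (hl : 0 < lam) (hε : 0 < ε) :
    ∫ v, ((φ v * Real.exp (-ε * v) * kap (lam * (v - u)) : ℝ) : ℂ) =
      ∫ τ, (hat τ : ℂ) * cexp (-(lam * u * τ : ℝ) * I) * H (ε - lam * τ * I) := by
  have hi := phi_exp_integrable φ hφm M hφb hφ0 ε hε
  have hprod := (hi.ofReal (𝕜 := ℂ)).mul_prod (hat_integrable.ofReal (𝕜 := ℂ))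
  have hprod2 : Integrable (fun z : ℝ × ℝ => ((φ z.1 * Real.exp (-ε * z.1) : ℝ) : ℂ) * (hat z.2 : ℂ) *
      cexp ((lam * (z.1 - u) * z.2 : ℝ) * I)) (volume.prod volume) := by
    refine hprod.mul_bdd (c := 1) (by fun_prop) ?_
    filter_upwards with z
    rw [norm_exp_ofReal_mul_I]
  calc _ = ∫ v, ∫ τ, ((φ v * Real.exp (-ε * v) : ℝ) : ℂ) * (hat τ : ℂ) *
      cexp ((lam * (v - u) * τ : ℝ) * I) := by
        refine integral_congr_ae ?_
        have : ∀ᵐ v : ℝ, v ≠ u := by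
          rw [ae_iff]; simp
        filter_upwards [this] with v hv
        rw [ofReal_mul, ← kap_eq _ (mul_ne_zero hl.ne' (sub_ne_zero.2 hv)), ← integral_const_mul]
        congr 1
        funext τ
        have e : ((lam * (v - u) : ℝ) : ℂ) * I * τ = ((lam * (v - u) * τ : ℝ) : ℂ) * I := by
          push_cast
          ring
        rw [e]
        ring
    _ = ∫ τ, ∫ v, ((φ v * Real.exp (-ε * v) : ℝ) : ℂ) * (hat τ : ℂ) *
      cexp ((lam * (v - u) * τ : ℝ) * I) := integral_integral_swap hprod2
    _ = _ := by
        congr 1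
        funext τ
        rw [← hH _ (by simpa using hε), ← integral_const_mul]
        congr 1
        funext v
        push_cast
        have : cexp (-(ε - lam * τ * I) * v) * cexp (-(lam * u * τ) * I) = cexp (-ε * v) * cexp (lam * (v - u) * τ * I) := by
          rw [← Complex.exp_add, ← Complex.exp_add]
          congr 1
          ring
        linear_combination (-(φ v : ℂ)) * (hat τ : ℂ) * this

lemma limit_step (φ : ℝ → ℝ) (hφm : Measurable φ) (M : ℝ) (hφb : ∀ v, |φ v| ≤ M) (hφ0 : ∀ v ≤ 0, φ v = 0)
    (H : ℂ → ℂ) (hHc : ∀ s : ℂ, 0 ≤ s.re → ContinuousAt H s)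
    (hH : ∀ s : ℂ, 0 < s.re → ∫ v, (φ v : ℂ) * cexp (-s * v) = H s)
    (lam u : ℝ) (hl : 0 < lam) :
    ∫ v, ((φ v * kap (lam * (v - u)) : ℝ) : ℂ) =
      ∫ τ, (hat τ : ℂ) * cexp (-(lam * u * τ : ℝ) * I) * H (- lam * τ * I) := by
  have hM : 0 ≤ M := (abs_nonneg _).trans (hφb 0)
  have hki : Integrable (fun v => M * kap (lam * (v - u))) :=
    ((kap_integrable.comp_mul_left' hl.ne').comp_sub_right u).const_mul M
  have h1 : Tendsto (fun ε : ℝ => ∫ v, ((φ v * Real.exp (-ε * v) * kap (lam * (v - u)) : ℝ) : ℂ)) (𝓝[>] 0)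
      (𝓝 (∫ v, ((φ v * kap (lam * (v - u)) : ℝ) : ℂ))) := by
    refine tendsto_integral_filter_of_dominated_convergence (fun v => M * kap (lam * (v - u))) ?_ ?_ hki ?_
    · filter_upwards with ε
      have := kap_meas
      fun_prop
    · filter_upwards [self_mem_nhdsWithin] with ε hε
      filter_upwards with v
      rw [norm_real, norm_mul, norm_mul, Real.norm_of_nonneg (kap_nonneg _)]
      refine mul_le_mul_of_nonneg_right ?_ (kap_nonneg _)
      by_cases hv : v ≤ 0
      · rw [hφ0 v hv]; simpa using hM
      · have : Real.exp (-ε * v) ≤ 1 := by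
          rw [Real.exp_le_one_iff]
          rw [mem_Ioi] at hε
          push Not at hv
          nlinarith
        rw [Real.norm_of_nonneg (Real.exp_pos _).le, Real.norm_eq_abs]
        nlinarith [hφb v, abs_nonneg (φ v)]
    · filter_upwards with v
      have : ContinuousAt (fun ε : ℝ => ((φ v * Real.exp (-ε * v) * kap (lam * (v - u)) : ℝ) : ℂ)) 0 := by fun_prop
      have h2 := this.tendsto.mono_left (nhdsWithin_le_nhds (s := Ioi 0))
      simpa using h2
  obtain ⟨B, hB⟩ : ∃ B : ℝ, ∀ ε ∈ Icc (0 : ℝ) 1, ∀ τ ∈ Icc (-1 : ℝ) 1, ‖H (ε - lam * τ * I)‖ ≤ B := by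
    have hc : ContinuousOn (fun z : ℝ × ℝ => H (z.1 - lam * z.2 * I)) (Icc (0 : ℝ) 1 ×ˢ Icc (-1 : ℝ) 1) := by
      intro z hz
      refine ContinuousAt.continuousWithinAt ?_
      refine ContinuousAt.comp (f := fun z : ℝ × ℝ => (z.1 : ℂ) - lam * z.2 * I) (hHc _ ?_) (by fun_prop)
      simpa using hz.1.1
    obtain ⟨B, hB⟩ := (isCompact_Icc.prod isCompact_Icc).exists_bound_of_continuousOn hc
    exact ⟨B, fun ε hε τ hτ => hB (ε, τ) ⟨hε, hτ⟩⟩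
  have hHt : ∀ ε : ℝ, 0 ≤ ε → Continuous (fun τ : ℝ => H (ε - lam * τ * I)) := by
    intro ε hε
    rw [continuous_iff_continuousAt]
    intro τ
    exact ContinuousAt.comp (f := fun τ : ℝ => (ε : ℂ) - lam * τ * I) (hHc _ (by simpa using hε)) (by fun_prop)
  have h2 : Tendsto (fun ε : ℝ => ∫ τ, (hat τ : ℂ) * cexp (-(lam * u * τ : ℝ) * I) * H (ε - lam * τ * I)) (𝓝[>] 0)
      (𝓝 (∫ τ, (hat τ : ℂ) * cexp (-(lam * u * τ : ℝ) * I) * H (- lam * τ * I))) := by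
    refine tendsto_integral_filter_of_dominated_convergence (fun τ => hat τ * B) ?_ ?_
      (hat_integrable.mul_const B) ?_
    · filter_upwards [self_mem_nhdsWithin] with ε hε
      have h5 := hHt ε (le_of_lt hε)
      have h6 := hat_cont
      exact Continuous.aestronglyMeasurable (Continuous.mul (by fun_prop) h5)
    · filter_upwards [self_mem_nhdsWithin, nhdsWithin_le_nhds (Iio_mem_nhds (zero_lt_one))] with ε hε hε1
      filter_upwards with τ
      rw [norm_mul, norm_mul, ← ofReal_neg, norm_exp_ofReal_mul_I, mul_one, norm_real, Real.norm_of_nonneg (hat_nonneg τ)]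
      by_cases hτ : hat τ = 0
      · rw [hτ]; simp
      · have := abs_lt.1 (abs_lt_of_hat hτ)
        exact mul_le_mul_of_nonneg_left (hB ε ⟨le_of_lt hε, le_of_lt hε1⟩ τ ⟨this.1.le, this.2.le⟩) (hat_nonneg τ)
    · filter_upwards with τ
      refine Tendsto.const_mul _ ?_
      have h3 : ContinuousAt (fun ε : ℝ => H (ε - lam * τ * I)) 0 :=
        ContinuousAt.comp (f := fun ε : ℝ => (ε : ℂ) - lam * τ * I) (hHc _ (by simp)) (by fun_prop)
      have h4 := h3.tendsto.mono_left (nhdsWithin_le_nhds (s := Ioi 0))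
      simpa using h4
  refine tendsto_nhds_unique h1 (h2.congr' ?_)
  filter_upwards [self_mem_nhdsWithin] with ε hε
  rw [fubini_step φ hφm M hφb hφ0 H hH lam u ε hl hε]

theorem tauber (φ : ℝ → ℝ) (hφm : Measurable φ) (M : ℝ) (hφb : ∀ v, |φ v| ≤ M) (hφ0 : ∀ v ≤ 0, φ v = 0)
    (H : ℂ → ℂ) (hHc : ∀ s : ℂ, 0 ≤ s.re → ContinuousAt H s)
    (hH : ∀ s : ℂ, 0 < s.re → ∫ v, (φ v : ℂ) * cexp (-s * v) = H s)
    (lam : ℝ) (hl : 0 < lam) :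
    Tendsto (fun u : ℝ => ∫ v, φ v * kap (lam * (v - u))) atTop (𝓝 0) := by
  have h1 := Real.tendsto_integral_exp_smul_cocompact (fun τ : ℝ => (hat τ : ℂ) * H (- lam * τ * I))
  have h2 : Tendsto (fun u : ℝ => lam * u / (2 * Real.pi)) atTop (cocompact ℝ) := by
    have h3 : Tendsto (fun u : ℝ => lam / (2 * Real.pi) * u) atTop atTop :=
      tendsto_id.const_mul_atTop (by positivity)
    refine (h3.mono_right atTop_le_cocompact).congr fun u => by ring
  have h3 := h1.comp h2
  have h4 : Tendsto (fun u : ℝ => ((∫ v, φ v * kap (lam * (v - u)) : ℝ) : ℂ)) atTop (𝓝 0) := by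
    refine h3.congr fun u => ?_
    have h6 : ((∫ v, φ v * kap (lam * (v - u)) : ℝ) : ℂ) = ∫ v, ((φ v * kap (lam * (v - u)) : ℝ) : ℂ) :=
      integral_ofReal.symm
    rw [h6]
    have h5 := limit_step φ hφm M hφb hφ0 H hHc hH lam u hl
    refine Eq.trans ?_ h5.symm
    simp only [Function.comp_apply]
    congr 1
    funext τ
    rw [Circle.smul_def, Real.fourierChar_apply, smul_eq_mul]
    have : cexp (2 * Real.pi * (-(τ * (lam * u / (2 * Real.pi))) : ℝ) * I) = cexp (-(lam * u * τ : ℝ) * I) := by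
      congr 1
      push_cast
      have : (Real.pi : ℂ) ≠ 0 := by exact_mod_cast Real.pi_ne_zero
      field_simp
    push_cast at this ⊢
    rw [this]
    ring
  have h5 := (continuous_re.tendsto _).comp h4
  simpa [Function.comp_def] using h5

end
end PIT

end

section

namespace PIT
open Complex MeasureTheory Set Filter Topology

/-- summatory function -/
noncomputable def psc (c : ℕ → ℝ) (x : ℝ) : ℝ := ∑ k ∈ Finset.Icc 1 ⌊x⌋₊, c k

section
variable (c : ℕ → ℝ)

lemma psc_le (C : ℝ) (hc : ∀ n, |c n| ≤ C * ArithmeticFunction.vonMangoldt n)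
    (hC : 0 ≤ C) (x : ℝ) (hx : 0 ≤ x) : |psc c x| ≤ C * (Real.log 4 + 4) * x := by
  calc |psc c x| ≤ ∑ k ∈ Finset.Icc 1 ⌊x⌋₊, |c k| := Finset.abs_sum_le_sum_abs _ _
    _ ≤ ∑ k ∈ Finset.Icc 1 ⌊x⌋₊, C * ArithmeticFunction.vonMangoldt k := Finset.sum_le_sum fun k _ => hc k
    _ = C * Chebyshev.psi x := by
      rw [← Finset.mul_sum, Chebyshev.psi]
      rfl
    _ ≤ C * ((Real.log 4 + 4) * x) := by
      gcongr
      exact Chebyshev.psi_le_const_mul_self hx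
    _ = _ := by ring

lemma psc_mono (C : ℝ) (hc : ∀ n, |c n| ≤ C * ArithmeticFunction.vonMangoldt n)
    (hC : 0 ≤ C) (n : ℕ) (hn : 1 ≤ n) (hp : ∀ p : ℕ, p.Prime → n < 2 * p → p ≤ n → 0 ≤ c p)
    (x y : ℝ) (hx : (n : ℝ) / 2 ≤ x) (hxy : x ≤ y) (hy : y ≤ n) :
    -(C * (2 * √n * Real.log n)) ≤ psc c y - psc c x := by
  have hx0 : 0 ≤ x := le_trans (by positivity) hx
  have hfl : ⌊x⌋₊ ≤ ⌊y⌋₊ := Nat.floor_mono hxy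
  have hfn : ⌊y⌋₊ ≤ n := by
    have := Nat.floor_mono hy
    simpa using this
  have h1 : psc c y - psc c x = ∑ k ∈ Finset.Ioc ⌊x⌋₊ ⌊y⌋₊, c k := by
    have e : ∀ m : ℕ, Finset.Icc 1 m = Finset.Ioc 0 m := fun m => rfl
    rw [psc, psc, sub_eq_iff_eq_add', e, e, Finset.sum_Ioc_consecutive _ (Nat.zero_le _) hfl]
  rw [h1]
  calc -(C * (2 * √n * Real.log n)) ≤ - (C * (Chebyshev.psi n - Chebyshev.theta n)) := by
        have := Chebyshev.psi_sub_theta_le (x := (n : ℝ)) (by exact_mod_cast hn)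
        gcongr
    _ = ∑ k ∈ Finset.Ioc 0 n with ¬ k.Prime, - (C * ArithmeticFunction.vonMangoldt k) := by
        rw [Chebyshev.psi_sub_theta_eq_sum_not_prime, Nat.floor_natCast, Finset.mul_sum, Finset.sum_neg_distrib]
    _ ≤ ∑ k ∈ Finset.Ioc ⌊x⌋₊ ⌊y⌋₊ with ¬ k.Prime, - (C * ArithmeticFunction.vonMangoldt k) := by
        rw [Finset.sum_neg_distrib, Finset.sum_neg_distrib, neg_le_neg_iff]
        refine Finset.sum_le_sum_of_subset_of_nonneg ?_ fun k _ _ =>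
          mul_nonneg hC ArithmeticFunction.vonMangoldt_nonneg
        refine Finset.filter_subset_filter _ (Finset.Ioc_subset_Ioc (Nat.zero_le _) hfn)
    _ ≤ ∑ k ∈ Finset.Ioc ⌊x⌋₊ ⌊y⌋₊, c k := by
        rw [Finset.sum_filter]
        refine Finset.sum_le_sum fun k hk => ?_
        rw [Finset.mem_Ioc] at hk
        split_ifs with h
        · refine hp k h ?_ (hk.2.trans hfn)
          have h2 := (Nat.floor_lt hx0).1 hk.1
          have : (n : ℝ) < 2 * k := by linarith
          exact_mod_cast this
        · have := (abs_le.1 (hc k)).1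
          linarith

/-- normalised error -/
noncomputable def phi (δ : ℝ) (v : ℝ) : ℝ := if v ≤ 0 then 0 else Real.exp (-v) * psc c (Real.exp v) + δ

lemma phi_meas (δ : ℝ) : Measurable (phi c δ) := by
  unfold phi
  refine Measurable.ite measurableSet_Iic measurable_const ?_
  have h1 : Measurable (fun x : ℝ => psc c x) := by
    have : Measurable (fun n : ℕ => ∑ k ∈ Finset.Icc 1 n, c k) := measurable_from_nat
    exact this.comp Nat.measurable_floor
  have := h1.comp Real.measurable_exp
  exact ((by fun_prop : Measurable (fun v : ℝ => Real.exp (-v))).mul this).add_const δ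

lemma phi_bd (C : ℝ) (hc : ∀ n, |c n| ≤ C * ArithmeticFunction.vonMangoldt n)
    (hC : 0 ≤ C) (δ : ℝ) (hδ : 0 ≤ δ) (v : ℝ) : |phi c δ v| ≤ C * (Real.log 4 + 4) + δ := by
  have h4 : 0 ≤ Real.log 4 := Real.log_nonneg (by norm_num)
  unfold phi
  split_ifs
  · rw [abs_zero]; positivity
  · refine (abs_add_le _ _).trans ?_
    rw [abs_mul, abs_of_pos (Real.exp_pos _), abs_of_nonneg hδ]
    refine add_le_add ?_ le_rfl
    have := psc_le c C hc hC (Real.exp v) (Real.exp_pos v).le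
    calc _ ≤ Real.exp (-v) * (C * (Real.log 4 + 4) * Real.exp v) := by gcongr
      _ = C * (Real.log 4 + 4) := by
        rw [mul_left_comm, ← Real.exp_add]; simp

lemma phi_laplace (C : ℝ) (hc : ∀ n, |c n| ≤ C * ArithmeticFunction.vonMangoldt n)
    (hC : 0 ≤ C) (δ : ℝ) (G : ℂ → ℂ)
    (hG : ∀ s : ℂ, 1 < s.re → LSeries (fun n => (c n : ℂ)) s = - δ / (s - 1) + G s) (s : ℂ) (hs : 0 < s.re) :
    ∫ v, (phi c δ v : ℂ) * cexp (-s * v) = (G (1 + s) + δ) / (1 + s) := by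
  have hs0 : s ≠ 0 := by rintro rfl; simp at hs
  have hs1 : 1 + s ≠ 0 := by
    intro h
    have := congrArg re h
    simp at this
    linarith
  have h1re : 1 < (1 + s).re := by simpa using hs
  have h4 : 0 ≤ Real.log 4 := Real.log_nonneg (by norm_num)
  have hL := LSeries_eq_mul_integral' (fun n => (c n : ℂ)) (r := 1) zero_le_one h1re (by
    simp only [Real.rpow_one]
    refine Asymptotics.IsBigO.of_bound (C * (Real.log 4 + 4)) ?_
    filter_upwards with n
    have hps := psc_le (fun n => |c n|) C (fun n => by rw [abs_abs]; exact hc n) hC n (Nat.cast_nonneg n)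
    simp only [psc, Nat.floor_natCast] at hps
    simpa using hps)
  rw [hG _ h1re] at hL
  have hchg := integral_comp_exp_Ioi (fun t : ℝ => (∑ k ∈ Finset.Icc 1 ⌊t⌋₊, (c k : ℂ)) * (t : ℂ) ^ (-((1 + s) + 1))) 0
  rw [Real.exp_zero] at hchg
  rw [← hchg] at hL
  have hA : ∀ v : ℝ, Real.exp v • ((∑ k ∈ Finset.Icc 1 ⌊Real.exp v⌋₊, (c k : ℂ)) * (Real.exp v : ℂ) ^ (-((1 + s) + 1)))
      = ((Real.exp (-v) * psc c (Real.exp v) : ℝ) : ℂ) * cexp (-s * v) := by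
    intro v
    have e1 : (Real.exp v : ℂ) ^ (-((1 + s) + 1)) = cexp (-v) * cexp (-v) * cexp (-s * v) := by
      rw [cpow_def_of_ne_zero (by exact_mod_cast (Real.exp_pos v).ne'), ← ofReal_log (Real.exp_pos v).le, Real.log_exp,
        ← Complex.exp_add, ← Complex.exp_add]
      congr 1
      ring
    rw [e1, real_smul, psc]
    push_cast
    have e2 : cexp v * cexp (-v) = 1 := by rw [← Complex.exp_add]; simp
    linear_combination (∑ k ∈ Finset.Icc 1 ⌊Real.exp v⌋₊, (c k : ℂ)) * cexp (-v) * cexp (-s * v) * e2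
  simp only [hA] at hL
  have hB : ∫ v, (phi c δ v : ℂ) * cexp (-s * v) = ∫ v in Ioi 0, (phi c δ v : ℂ) * cexp (-s * v) := by
    rw [setIntegral_eq_integral_of_forall_compl_eq_zero]
    intro v hv
    rw [mem_Ioi, not_lt] at hv
    simp [phi, hv]
  have hD : ∫ v in Ioi 0, (phi c δ v : ℂ) * cexp (-s * v) =
      ∫ v in Ioi (0 : ℝ), (((Real.exp (-v) * psc c (Real.exp v) : ℝ) : ℂ) * cexp (-s * v) + δ * cexp (-s * v)) := by
    refine setIntegral_congr_fun measurableSet_Ioi fun v hv => ?_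
    have hv' : ¬ v ≤ 0 := not_le.2 hv
    simp only [phi, if_neg hv']
    push_cast
    ring
  have hint2 : IntegrableOn (fun v : ℝ => (δ : ℂ) * cexp (-s * v)) (Ioi 0) :=
    (integrableOn_exp_mul_complex_Ioi (by simpa using hs) 0).const_mul _
  have hint1 : IntegrableOn (fun v : ℝ => ((Real.exp (-v) * psc c (Real.exp v) : ℝ) : ℂ) * cexp (-s * v)) (Ioi 0) := by
    refine (integrableOn_exp_mul_complex_Ioi (a := -s) (by simpa using hs) 0).bdd_mul
      (c := C * (Real.log 4 + 4)) ?_ ?_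
    · have h1 : Measurable (fun x : ℝ => psc c x) := by
        have : Measurable (fun n : ℕ => ∑ k ∈ Finset.Icc 1 n, c k) := measurable_from_nat
        exact this.comp Nat.measurable_floor
      have := h1.comp Real.measurable_exp
      exact (((by fun_prop : Measurable (fun v : ℝ => Real.exp (-v))).mul this).complex_ofReal).aestronglyMeasurable
    · filter_upwards with v
      rw [norm_real, norm_mul, Real.norm_of_nonneg (Real.exp_pos _).le]
      have := psc_le c C hc hC (Real.exp v) (Real.exp_pos v).le
      calc _ ≤ Real.exp (-v) * (C * (Real.log 4 + 4) * Real.exp v) := by gcongr; exact this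
        _ = C * (Real.log 4 + 4) := by
          rw [mul_left_comm, ← Real.exp_add]; simp
  rw [hB, hD, integral_add hint1 hint2, integral_const_mul, integral_exp_mul_complex_Ioi (by simpa using hs)]
  rw [add_sub_cancel_left] at hL
  rw [eq_div_iff hs1]
  simp only [ofReal_zero, mul_zero, Complex.exp_zero]
  generalize (∫ v in Ioi (0 : ℝ), ((Real.exp (-v) * psc c (Real.exp v) : ℝ) : ℂ) * cexp (-s * v)) = J at hL ⊢
  field_simp at hL ⊢
  linear_combination -hL

end
end PIT

end

section

namespace PIT
open Complex MeasureTheory Set Filter Topology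

lemma kap_far (h lam w : ℝ) (hh0 : 0 < h) (hlam0 : 0 < lam) (hw2 : h ^ 2 ≤ w ^ 2) :
    kap (lam * w) ≤ 4 * (1 + (h ^ 2)⁻¹) / lam ^ 2 * (1 + w ^ 2)⁻¹ := by
  have hwp : 0 < w ^ 2 := lt_of_lt_of_le (by positivity) hw2
  refine (kap_le' _).trans ?_
  have : 1 ≤ (h ^ 2)⁻¹ * w ^ 2 := by
    rw [inv_mul_eq_div, one_le_div (by positivity)]; exact hw2
  rw [mul_pow, div_mul_eq_mul_div, ← div_eq_mul_inv, div_div, div_le_div_iff₀ (by positivity) (by positivity)]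
  have h2 : 0 < lam ^ 2 := by positivity
  have h3 : 1 + w ^ 2 ≤ (1 + (h ^ 2)⁻¹) * w ^ 2 := by linarith
  have h4 := mul_le_mul_of_nonneg_left h3 h2.le
  nlinarith

set_option maxHeartbeats 2000000 in
theorem exists_prime_neg (c : ℕ → ℝ) (C : ℝ) (hC : 0 ≤ C)
    (hc : ∀ n, |c n| ≤ C * ArithmeticFunction.vonMangoldt n) (δ : ℝ) (hδ : 0 < δ) (G : ℂ → ℂ)
    (hGc : ∀ s : ℂ, 1 ≤ s.re → ContinuousAt G s)
    (hG : ∀ s : ℂ, 1 < s.re → LSeries (fun n => (c n : ℂ)) s = - δ / (s - 1) + G s) :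
    ∃ N : ℕ, ∀ n ≥ N, ∃ p : ℕ, p.Prime ∧ n < 2 * p ∧ p ≤ n ∧ c p < 0 := by
  set M := C * (Real.log 4 + 4) + δ with hM
  set φ := phi c δ with hφ
  have hφb : ∀ v, |φ v| ≤ M := phi_bd c C hc hC δ hδ.le
  have hM0 : 0 ≤ M := (abs_nonneg _).trans (hφb 0)
  set l := Real.log 2 with hl
  have hl0 : 0 < l := Real.log_pos (by norm_num)
  set h := l / 4 with hh
  have hh0 : 0 < h := by positivity
  set q := Real.exp (-(2 * h)) with hq
  have hq0 : 0 < q := Real.exp_pos _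
  have hq1 : q < 1 := by rw [hq, Real.exp_lt_one_iff]; linarith
  set m0 := ∫ x, kap x with hm0
  have hm0p : 0 < m0 := kap_int_pos
  set B := 4 * (1 + (h ^ 2)⁻¹) with hB
  have hB0 : 0 < B := by positivity
  -- choose lam
  set η := δ * (1 - q) / 2 with hη
  have hη0 : 0 < η := by have : 0 < 1 - q := by linarith
                         positivity
  set lam := (2 * M + 2 * η + 1) * B * Real.pi / (η * m0) + 1 with hlam
  have hlam0 : 0 < lam := by positivity
  have hlam1 : (2 * M + 2 * η + 1) * B * Real.pi < lam * (η * m0) := by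
    have : 0 < η * m0 := by positivity
    have e : lam * (η * m0) = (2 * M + 2 * η + 1) * B * Real.pi + η * m0 := by
      rw [hlam]
      field_simp
    linarith
  clear_value lam η B m0 q h l
  set J : ℝ → ℝ := fun u => ∫ v, φ v * kap (lam * (v - u)) with hJ
  have hJ0 : Tendsto J atTop (𝓝 0) := tauber φ (phi_meas c δ) M hφb (fun v hv => by simp [hφ, phi, hv])
    (fun s => (G (1 + s) + δ) / (1 + s)) (fun s hs => by
      have h1 : ContinuousAt (fun s => G (1 + s)) s :=
        ContinuousAt.comp (f := fun s => 1 + s) (hGc _ (by simpa using hs)) (by fun_prop)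
      refine (h1.add continuousAt_const).div (by fun_prop) ?_
      intro h
      have := congrArg re h
      simp at this
      linarith) (phi_laplace c C hc hC δ G hG) lam hlam0
  have hu : Tendsto (fun n : ℕ => Real.log n) atTop atTop := Real.tendsto_log_atTop.comp tendsto_natCast_atTop_atTop
  have hlim : Tendsto (fun n : ℕ => J (Real.log n - h) - q * J (Real.log n - 3 * h)) atTop (𝓝 (0 - q * 0)) :=
    (hJ0.comp (tendsto_atTop_add_const_right _ (-h) hu)).sub
      ((hJ0.comp (tendsto_atTop_add_const_right _ (-(3 * h)) hu)).const_mul q)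
  rw [mul_zero, sub_zero] at hlim
  have hrho : Tendsto (fun n : ℕ => 2 / (n : ℝ) * (C * (2 * √n * Real.log n))) atTop (𝓝 0) := by
    have h1 := (isLittleO_log_rpow_atTop (r := 1 / 2) (by norm_num)).tendsto_div_nhds_zero
    have h2 := ((h1.comp tendsto_natCast_atTop_atTop).const_mul (4 * C))
    rw [mul_zero] at h2
    refine h2.congr' ?_
    filter_upwards [eventually_gt_atTop 0] with n hn
    have hn' : (0 : ℝ) < n := by exact_mod_cast hn
    simp only [Function.comp_apply]
    rw [← Real.sqrt_eq_rpow]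
    have h3 : √(n : ℝ) * √n = n := Real.mul_self_sqrt hn'.le
    have h4 : 0 < √(n : ℝ) := Real.sqrt_pos.2 hn'
    field_simp
    rw [Real.sq_sqrt hn'.le]
    ring
  have hev1 := hrho.eventually (Iio_mem_nhds hη0)
  have hpos : 0 < η * m0 / lam - (2 * M + 2 * η) * (B * Real.pi) / lam ^ 2 := by
    rw [sub_pos, div_lt_div_iff₀ (by positivity) hlam0]
    have : 0 < B * Real.pi := by positivity
    nlinarith [mul_pos hlam0 hlam0]
  have hev2 := hlim.eventually (Iio_mem_nhds hpos)
  obtain ⟨N, hN⟩ := eventually_atTop.1 (hev1.and (hev2.and (eventually_gt_atTop 2)))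
  refine ⟨N, fun n hn => ?_⟩
  obtain ⟨hn1, hn2, hn3⟩ := hN n hn
  by_contra hcon
  push Not at hcon
  refine absurd hn2 (not_lt.2 ?_)
  have hn0 : (0 : ℝ) < n := by positivity
  have hn3' : (2 : ℝ) < n := by exact_mod_cast hn3
  -- shift
  have hshift : ∀ u, J u = ∫ w, φ (u + w) * kap (lam * w) := by
    intro u
    rw [hJ]
    simp only
    rw [← integral_add_left_eq_self _ u]
    simp
  have hkl : Integrable (fun w => kap (lam * w)) := kap_integrable.comp_mul_left' hlam0.ne'
  have hJi : ∀ u, Integrable (fun w => φ (u + w) * kap (lam * w)) := by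
    intro u
    refine hkl.bdd_mul (c := M) ?_ ?_
    · have := (phi_meas c δ).comp (measurable_const_add u)
      exact this.aestronglyMeasurable
    · filter_upwards with w
      exact hφb _
  have hkint : ∫ w, kap (lam * w) = m0 / lam := by
    rw [Measure.integral_comp_mul_left, abs_of_pos (inv_pos.2 hlam0), smul_eq_mul]
    field_simp
    rw [hm0]
  have hpt : ∀ w, η * kap (lam * w) - (2 * M + 2 * η) * B / lam ^ 2 * (1 + w ^ 2)⁻¹ ≤
      φ (Real.log n - h + w) * kap (lam * w) - q * (φ (Real.log n - 3 * h + w) * kap (lam * w)) := by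
    intro w
    have hk0 := kap_nonneg (lam * w)
    by_cases hw : |w| ≤ h
    · obtain ⟨hw1, hw2⟩ := abs_le.1 hw
      have hx1 : Real.log (n / 2) ≤ Real.log n - 3 * h + w := by
        rw [Real.log_div hn0.ne' (by norm_num)]; linarith
      have hx0 : 0 < Real.log (n / 2) := Real.log_pos (by linarith)
      have hx2 : Real.log n - h + w ≤ Real.log n := by linarith
      set v1 := Real.log n - 3 * h + w with hv1
      have hv2 : Real.log n - h + w = v1 + 2 * h := by ring
      rw [hv2] at hx2 ⊢
      have e1 : (n : ℝ) / 2 ≤ Real.exp v1 := by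
        rw [← Real.exp_log (show (0 : ℝ) < n / 2 by linarith)]
        exact Real.exp_le_exp.2 hx1
      have e2 : Real.exp (v1 + 2 * h) ≤ n := by
        have := Real.exp_le_exp.2 hx2
        rwa [Real.exp_log hn0] at this
      have hmono := psc_mono c C hc hC n (by omega) (fun p hp h1 h2 => hcon p hp h1 h2) (Real.exp v1)
        (Real.exp (v1 + 2 * h)) e1 (Real.exp_le_exp.2 (by linarith)) e2
      have f1 : φ v1 = Real.exp (-v1) * psc c (Real.exp v1) + δ := by
        rw [hφ, phi, if_neg (by linarith)]
      have f2 : φ (v1 + 2 * h) = Real.exp (-(v1 + 2 * h)) * psc c (Real.exp (v1 + 2 * h)) + δ := by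
        rw [hφ, phi, if_neg (by linarith)]
      have f3 : Real.exp (-(v1 + 2 * h)) = q * Real.exp (-v1) := by
        rw [hq, ← Real.exp_add]; congr 1; ring
      have hE : Real.exp (-(v1 + 2 * h)) ≤ 2 / n := by
        rw [Real.exp_neg, show (2 : ℝ) / n = ((n : ℝ) / 2)⁻¹ by rw [inv_div]]
        refine inv_anti₀ (by linarith) (e1.trans (Real.exp_le_exp.2 (by linarith)))
      have hS : 0 ≤ C * (2 * √n * Real.log n) := by
        have := Real.log_nonneg (show (1 : ℝ) ≤ n by linarith)
        positivity
      have key : η ≤ φ (v1 + 2 * h) - q * φ v1 := by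
        have g1 : φ (v1 + 2 * h) - q * φ v1 = Real.exp (-(v1 + 2 * h)) *
            (psc c (Real.exp (v1 + 2 * h)) - psc c (Real.exp v1)) + 2 * η := by
          rw [f1, f2, f3, hη]; ring
        have g2 : -(2 / n * (C * (2 * √n * Real.log n))) ≤ Real.exp (-(v1 + 2 * h)) *
            (psc c (Real.exp (v1 + 2 * h)) - psc c (Real.exp v1)) := by
          have g3 := mul_le_mul_of_nonneg_left hmono (Real.exp_pos (-(v1 + 2 * h))).le
          have g4 := mul_le_mul_of_nonneg_right hE hS
          linarith
        linarith
      have g5 : 0 ≤ (2 * M + 2 * η) * B / lam ^ 2 * (1 + w ^ 2)⁻¹ := by positivity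
      nlinarith [mul_le_mul_of_nonneg_right key hk0]
    · push Not at hw
      have hw2 : h ^ 2 ≤ w ^ 2 := by
        rw [← sq_abs w]; gcongr
      have hwp : 0 < w ^ 2 := lt_of_lt_of_le (by positivity) hw2
      have hk : kap (lam * w) ≤ B / lam ^ 2 * (1 + w ^ 2)⁻¹ := by
        rw [hB]; exact kap_far h lam w hh0 hlam0 hw2
      have a1 := (abs_le.1 (hφb (Real.log n - h + w))).1
      have a2 := (abs_le.1 (hφb (Real.log n - 3 * h + w))).2
      have a3 : -(2 * M) ≤ φ (Real.log n - h + w) - q * φ (Real.log n - 3 * h + w) := by nlinarith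
      have a4 := mul_le_mul_of_nonneg_right a3 hk0
      have a5 := mul_le_mul_of_nonneg_left hk (show 0 ≤ 2 * M + 2 * η by positivity)
      have a6 : (2 * M + 2 * η) * (B / lam ^ 2 * (1 + w ^ 2)⁻¹) = (2 * M + 2 * η) * B / lam ^ 2 * (1 + w ^ 2)⁻¹ := by ring
      nlinarith [mul_nonneg hη0.le hk0]
  have hI := integral_mono ((hkl.const_mul η).sub (integrable_inv_one_add_sq.const_mul ((2 * M + 2 * η) * B / lam ^ 2)))
    ((hJi (Real.log n - h)).sub ((hJi (Real.log n - 3 * h)).const_mul q)) hpt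
  simp only [Pi.sub_apply] at hI
  rw [integral_sub (hkl.const_mul η) (integrable_inv_one_add_sq.const_mul _),
    integral_sub (hJi _) ((hJi _).const_mul q), integral_const_mul, integral_const_mul, integral_const_mul,
    hkint, integral_univ_inv_one_add_sq, ← hshift, ← hshift] at hI
  refine le_trans (le_of_eq ?_) hI
  ring

end PIT

end

section

namespace PIT
open Polynomial NumberField Module

/-- Irreducibility over `ℚ` of the integral normalization. -/
lemma irr_normalization (g : ℤ[X]) (hirr : Irreducible g) (hd : 1 ≤ g.natDegree) :
    Irreducible (g.integralNormalization.map (Int.castRingHom ℚ)) := by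
  have hg0 : g ≠ 0 := hirr.ne_zero
  have hprim : g.IsPrimitive := hirr.isPrimitive (by omega)
  have h1 : Irreducible (g.map (Int.castRingHom ℚ)) :=
    (hprim.irreducible_iff_irreducible_map_fraction_map (K := ℚ)).1 hirr
  set lc := g.leadingCoeff with hlc
  have hlc0 : lc ≠ 0 := leadingCoeff_ne_zero.2 hg0
  have hlcQ : (Int.castRingHom ℚ) lc ≠ 0 := by simpa using hlc0
  set u : ℚ := (Int.castRingHom ℚ) lc with hu
  have h2 : g.integralNormalization.map (Int.castRingHom ℚ) * C u =
      scaleRoots (g.map (Int.castRingHom ℚ)) u := by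
    rw [hu, ← map_scaleRoots _ _ _ hlcQ, hlc, ← integralNormalization_mul_C_leadingCoeff, Polynomial.map_mul,
      map_C]
  have h3 : Irreducible (scaleRoots (g.map (Int.castRingHom ℚ)) u) := by
    set P := g.map (Int.castRingHom ℚ) with hP
    have hPd : 0 < (scaleRoots P u).natDegree := by
      rw [natDegree_scaleRoots]
      exact h1.natDegree_pos
    refine ⟨fun hunit => ?_, fun a b hab => ?_⟩
    · have := natDegree_eq_zero_of_isUnit hunit
      omega
    · have e : P = scaleRoots a u⁻¹ * scaleRoots b u⁻¹ := by
        rw [← mul_scaleRoots_of_noZeroDivisors, ← hab, ← scaleRoots_mul, mul_inv_cancel₀ hlcQ, scaleRoots_one]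
      have ha0 : a ≠ 0 := by rintro rfl; rw [zero_mul] at hab; rw [hab] at hPd; simp at hPd
      have hb0 : b ≠ 0 := by rintro rfl; rw [mul_zero] at hab; rw [hab] at hPd; simp at hPd
      rcases h1.isUnit_or_isUnit e with h | h
      · left
        have := degree_eq_zero_of_isUnit h
        rw [degree_scaleRoots] at this
        exact isUnit_iff_degree_eq_zero.2 this
      · right
        have := degree_eq_zero_of_isUnit h
        rw [degree_scaleRoots] at this
        exact isUnit_iff_degree_eq_zero.2 this
  rw [← h2] at h3
  exact (irreducible_mul_isUnit (isUnit_C.2 (isUnit_iff_ne_zero.2 hlcQ))).1 h3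

/-- ideals of prime norm from a root mod p -/
lemma exists_ideal_of_root (K : Type*) [Field K] [NumberField K] (θ : 𝓞 K) (p : ℕ) (hp : p.Prime)
    (hpe : ¬ p ∣ RingOfIntegers.exponent θ) (b : ℤ) (hb : (p : ℤ) ∣ (minpoly ℤ θ).eval b) :
    ∃ P : Ideal (𝓞 K), Ideal.absNorm P = p := by
  have : Fact p.Prime := ⟨hp⟩
  have hm : (minpoly ℤ θ).Monic := minpoly.monic θ.isIntegral
  have hQ : (X - C b : ℤ[X]).map (Int.castRingHom (ZMod p)) ∈ RingOfIntegers.monicFactorsMod θ p := by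
    have h0 : (minpoly ℤ θ).map (Int.castRingHom (ZMod p)) ≠ 0 := (hm.map _).ne_zero
    rw [Multiset.mem_toFinset, Polynomial.mem_normalizedFactors_iff h0]
    simp only [Polynomial.map_sub, map_X, map_C]
    refine ⟨irreducible_X_sub_C _, monic_X_sub_C _, ?_⟩
    rw [dvd_iff_isRoot, IsRoot, eval_map, eval₂_at_apply]
    exact (ZMod.intCast_zmod_eq_zero_iff_dvd _ _).2 hb
  have e := RingOfIntegers.ZModXQuotSpanEquivQuotSpanPair hpe hQ
  refine ⟨Ideal.span {(p : 𝓞 K), (aeval θ) (X - C b)}, ?_⟩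
  rw [Ideal.absNorm_apply, Submodule.cardQuot_apply]
  rw [← Nat.card_congr e.toEquiv]
  have e2 := quotientSpanXSubCAlgEquiv ((b : ZMod p))
  have : Ideal.span {Polynomial.map (Int.castRingHom (ZMod p)) (X - C b)} = Ideal.span {(X - C (b : ZMod p))} := by
    simp
  rw [this, Nat.card_congr e2.toEquiv, Nat.card_zmod]

lemma exponent_ne_zero (K : Type*) [Field K] [NumberField K] (θ : 𝓞 K) (B : PowerBasis ℚ K)
    (hB : B.gen = (θ : K)) : RingOfIntegers.exponent θ ≠ 0 := by
  have hintg : IsIntegral ℤ B.gen := by rw [hB]; exact θ.isIntegral_coe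
  have hD : IsIntegral ℤ (Algebra.discr ℚ B.basis) := by
    refine Algebra.discr_isIntegral ℚ (fun i => ?_)
    rw [B.basis_eq_pow]
    exact hintg.pow _
  obtain ⟨D, hD⟩ := IsIntegrallyClosed.isIntegral_iff.1 hD
  have hD0 : D ≠ 0 := by
    rintro rfl
    have := Algebra.discr_not_zero_of_basis ℚ B.basis
    rw [map_zero] at hD
    exact this hD.symm
  have hmem : ∀ z : 𝓞 K, (D : 𝓞 K) * z ∈ Algebra.adjoin ℤ {θ} := by
    intro z
    have h := Algebra.discr_mul_isIntegral_mem_adjoin ℚ hintg z.isIntegral_coe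
    rw [hB, ← hD] at h
    have e : ((algebraMap ℤ ℚ) D • (z : K)) = ((((D : 𝓞 K) * z : 𝓞 K)) : K) := by
      simp [Algebra.smul_def]
    rw [e] at h
    have h2 : Algebra.adjoin ℤ {(θ : K)} = (Algebra.adjoin ℤ {θ}).map (IsScalarTower.toAlgHom ℤ (𝓞 K) K) := by
      rw [AlgHom.map_adjoin]; simp
    rw [h2] at h
    obtain ⟨y, hy, hy2⟩ := h
    have : y = (D : 𝓞 K) * z := RingOfIntegers.coe_injective hy2
    rwa [← this]
  rw [RingOfIntegers.exponent_eq_sInf]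
  have hne : {d : ℕ | 0 < d ∧ (d : 𝓞 K) ∈ conductor ℤ θ}.Nonempty := by
    refine ⟨D.natAbs, Int.natAbs_pos.2 hD0, ?_⟩
    rw [mem_conductor_iff]
    intro z
    rcases Int.natAbs_eq D with h | h
    · have := hmem z
      rw [h] at this
      simpa using this
    · have := hmem (-z)
      rw [h] at this
      simpa using this
  exact (Nat.sInf_mem hne).1.ne'

/-- Two ideals of norm p in `K` from one in `L`. -/
lemma two_ideals (K L : Type*) [Field K] [NumberField K] [Field L] [NumberField L] (σ τ : K →+* L)
    (θ : 𝓞 K) (hθ : σ θ ≠ τ θ) : ∃ N : ℕ, ∀ p : ℕ, p.Prime → N < p → ∀ Q : Ideal (𝓞 L), Ideal.absNorm Q = p →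
      ∃ P₁ P₂ : Ideal (𝓞 K), P₁ ≠ P₂ ∧ Ideal.absNorm P₁ = p ∧ Ideal.absNorm P₂ = p := by
  set s := RingOfIntegers.mapRingHom σ with hs
  set t := RingOfIntegers.mapRingHom τ with ht
  have hne : s θ - t θ ≠ 0 := by
    intro h
    apply hθ
    have := congrArg (fun x : 𝓞 L => (x : L)) (sub_eq_zero.1 h)
    simpa [hs, ht] using this
  refine ⟨Ideal.absNorm (Ideal.span {s θ - t θ}), fun p hp hN Q hQ => ?_⟩
  have hQt : Q ≠ ⊤ := by
    rintro rfl
    rw [Ideal.absNorm_top] at hQ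
    exact hp.one_lt.ne hQ
  have hcardQ : Nat.card (𝓞 L ⧸ Q) = p := by rw [← hQ, Ideal.absNorm_apply, Submodule.cardQuot_apply]
  have key : ∀ w : 𝓞 K →+* 𝓞 L, Ideal.absNorm (Q.comap w) = p := by
    intro w
    rw [Ideal.absNorm_apply, Submodule.cardQuot_apply]
    have hinj : Function.Injective (Ideal.quotientMap Q w (le_refl (Q.comap w))) := Ideal.quotientMap_injective
    have hfin : Finite (𝓞 L ⧸ Q) := Nat.finite_of_card_ne_zero (by rw [hcardQ]; exact hp.ne_zero)
    have hdvd := AddSubgroup.card_dvd_of_injective (Ideal.quotientMap Q w (le_refl (Q.comap w))).toAddMonoidHom hinj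
    rw [hcardQ] at hdvd
    rcases (Nat.dvd_prime hp).1 hdvd with h | h
    · exfalso
      have hn : Nontrivial (𝓞 K ⧸ Q.comap w) := Ideal.Quotient.nontrivial_iff.2 (Ideal.comap_ne_top w hQt)
      have := (Nat.card_eq_one_iff_unique.1 h).1
      exact not_subsingleton _ this
    · exact h
  refine ⟨Q.comap s, Q.comap t, fun heq => ?_, key s, key t⟩
  -- θ is congruent to an integer
  have hP : Nat.card (𝓞 K ⧸ Q.comap s) = p := by
    rw [← key s, Ideal.absNorm_apply, Submodule.cardQuot_apply]
  have : Fact p.Prime := ⟨hp⟩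
  obtain ⟨m, hm⟩ : ∃ m : ℤ, θ - m ∈ Q.comap s := by
    have hn : Nontrivial (𝓞 K ⧸ Q.comap s) := Ideal.Quotient.nontrivial_iff.2 (Ideal.comap_ne_top s hQt)
    have h1 := mem_zmultiples_of_prime_card hP (g := (1 : 𝓞 K ⧸ Q.comap s))
      (g' := Ideal.Quotient.mk _ θ) one_ne_zero
    obtain ⟨m, hm⟩ := AddSubgroup.mem_zmultiples_iff.1 h1
    refine ⟨m, ?_⟩
    rw [← Ideal.Quotient.eq, ← hm]
    simp
  have hm2 : θ - m ∈ Q.comap t := heq ▸ hm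
  have hmem : s θ - t θ ∈ Q := by
    have := Q.sub_mem (Ideal.mem_comap.1 hm) (Ideal.mem_comap.1 hm2)
    simpa using this
  have hle : Ideal.span {s θ - t θ} ≤ Q := (Ideal.span_singleton_le_iff_mem Q).2 hmem
  have hd := Ideal.absNorm_dvd_absNorm_of_le hle
  rw [hQ] at hd
  have hpos : Ideal.absNorm (Ideal.span {s θ - t θ}) ≠ 0 := by
    rw [Ne, Ideal.absNorm_eq_zero_iff, Ideal.span_singleton_eq_bot]; exact hne
  exact absurd (Nat.le_of_dvd (Nat.pos_of_ne_zero hpos) hd) (by omega)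

end PIT

end

section

namespace PIT
open Polynomial NumberField Module

lemma neg_primes (K L : Type) [Field K] [NumberField K] [Field L] [NumberField L] :
    ∃ N : ℕ, ∀ n ≥ N, ∃ p : ℕ, p.Prime ∧ n < 2 * p ∧ p ≤ n ∧
      LK K p - LK ℚ p - (1 / finrank ℚ L : ℝ) * LK L p < 0 := by
  obtain ⟨G1, hc1, h1⟩ := LK_continuation K
  obtain ⟨G2, hc2, h2⟩ := LK_continuation ℚ
  obtain ⟨G3, hc3, h3⟩ := LK_continuation L
  have hL : (0 : ℝ) < finrank ℚ L := by exact_mod_cast finrank_pos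
  set δ : ℝ := 1 / finrank ℚ L with hδ
  have hδ0 : 0 < δ := by positivity
  refine exists_prime_neg (fun n => LK K n - LK ℚ n - δ * LK L n) (finrank ℚ K + 2) (by positivity) ?_ δ hδ0
    (fun s => G1 s - G2 s - δ * G3 s) ?_ ?_
  · intro n
    have a1 := LK_nonneg K n
    have a2 := LK_nonneg ℚ n
    have a3 := LK_nonneg L n
    have b1 := LK_le K n
    have b2 := LK_le ℚ n
    have b3 := LK_le L n
    rw [finrank_self, Nat.cast_one, one_mul] at b2
    have b4 : δ * LK L n ≤ ArithmeticFunction.vonMangoldt n := by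
      calc δ * LK L n ≤ δ * (finrank ℚ L * ArithmeticFunction.vonMangoldt n) := by gcongr
        _ = ArithmeticFunction.vonMangoldt n := by rw [hδ]; field_simp
    have a4 : 0 ≤ δ * LK L n := by positivity
    have a5 : 0 ≤ ArithmeticFunction.vonMangoldt n := a2.trans b2
    rw [abs_le]
    constructor <;> nlinarith [mul_nonneg (Nat.cast_nonneg (α := ℝ) (finrank ℚ K)) a5]
  · intro s hs
    exact ((hc1 s hs).sub (hc2 s hs)).sub (continuousAt_const.mul (hc3 s hs))
  · intro s hs
    have e : (fun n => ((LK K n - LK ℚ n - δ * LK L n : ℝ) : ℂ)) =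
        (fun n => (LK K n : ℂ)) - (fun n => (LK ℚ n : ℂ)) - (δ : ℂ) • (fun n => (LK L n : ℂ)) := by
      ext n; simp
    rw [e, LSeries_sub ((LK_summable K s hs).sub (LK_summable ℚ s hs)) ((LK_summable L s hs).smul _),
      LSeries_sub (LK_summable K s hs) (LK_summable ℚ s hs), LSeries_smul, h1 s hs, h2 s hs, h3 s hs]
    ring

lemma rK_pos_of {K : Type*} [Field K] [NumberField K] {p : ℕ} (hp : p ≠ 0) (P : Ideal (𝓞 K))
    (hP : Ideal.absNorm P = p) : 1 ≤ rK K p := by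
  rw [rK_Sn K p hp]
  exact_mod_cast Finset.card_pos.2 ⟨P, mem_Sn.2 hP⟩

lemma rK_two_of {K : Type*} [Field K] [NumberField K] {p : ℕ} (hp : p ≠ 0) (P₁ P₂ : Ideal (𝓞 K))
    (hne : P₁ ≠ P₂) (h1 : Ideal.absNorm P₁ = p) (h2 : Ideal.absNorm P₂ = p) : 2 ≤ rK K p := by
  rw [rK_Sn K p hp]
  exact_mod_cast Finset.one_lt_card.2 ⟨P₁, mem_Sn.2 h1, P₂, mem_Sn.2 h2, hne⟩

lemma rK_le_finrank (K : Type*) [Field K] [NumberField K] {p : ℕ} (hp : p.Prime) : rK K p ≤ finrank ℚ K := by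
  have h := LK_le K p
  rw [LK_prime K p hp, ArithmeticFunction.vonMangoldt_apply_prime hp] at h
  exact le_of_mul_le_mul_right h (Real.log_pos (by exact_mod_cast hp.one_lt))

lemma noroot_aux (K L : Type) [Field K] [NumberField K] [Field L] [NumberField L] (σ τ : K →+* L)
    (θ : 𝓞 K) (hθ : σ θ ≠ τ θ) (he : RingOfIntegers.exponent θ ≠ 0) :
    ∃ N : ℕ, ∀ n ≥ N, ∃ p : ℕ, p.Prime ∧ n < 2 * p ∧ p ≤ n ∧ ∀ b : ℤ, ¬ (p : ℤ) ∣ (minpoly ℤ θ).eval b := by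
  obtain ⟨N1, h1⟩ := neg_primes K L
  obtain ⟨N2, h2⟩ := two_ideals K L σ τ θ hθ
  refine ⟨N1 + 2 * N2 + 2 * RingOfIntegers.exponent θ, fun n hn => ?_⟩
  obtain ⟨p, hp, hp1, hp2, hneg⟩ := h1 n (by omega)
  refine ⟨p, hp, hp1, hp2, fun b hb => ?_⟩
  have hpe : ¬ p ∣ RingOfIntegers.exponent θ := fun h => by
    have := Nat.le_of_dvd (Nat.pos_of_ne_zero he) h
    omega
  obtain ⟨P, hP⟩ := exists_ideal_of_root K θ p hp hpe b hb
  have r1 := rK_pos_of hp.ne_zero P hP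
  have r2 := rK_le_finrank ℚ hp
  rw [finrank_self, Nat.cast_one] at r2
  have r3 := rK_le_finrank L hp
  have hL : (0 : ℝ) < finrank ℚ L := by exact_mod_cast finrank_pos
  have hlog : 0 < Real.log p := Real.log_pos (by exact_mod_cast hp.one_lt)
  rw [LK_prime K p hp, LK_prime ℚ p hp, LK_prime L p hp] at hneg
  have hneg2 : rK K p - rK ℚ p - 1 / finrank ℚ L * rK L p < 0 := by
    by_contra hcon
    push Not at hcon
    have := mul_nonneg hcon hlog.le
    linarith
  by_cases hr : rK L p = 0
  · rw [hr] at hneg2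
    linarith
  · have hne : (Sn L p).Nonempty := by
      rw [Finset.nonempty_iff_ne_empty]
      intro h
      rw [rK_Sn L p hp.ne_zero, h] at hr
      simp at hr
    obtain ⟨Q, hQ⟩ := hne
    obtain ⟨P₁, P₂, hP, hP1, hP2⟩ := h2 p hp (by omega) Q (mem_Sn.1 hQ)
    have r4 := rK_two_of hp.ne_zero P₁ P₂ hP hP1 hP2
    have r5 : 1 / finrank ℚ L * rK L p ≤ 1 := by
      rw [one_div, inv_mul_le_one₀ hL]; exact r3
    linarith

lemma transport_pb {K : Type} [Field K] [CharZero K] (a : Algebra ℚ K) (B : @PowerBasis ℚ K _ _ a) :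
    ∃ B' : @PowerBasis ℚ K _ _ DivisionRing.toRatAlgebra,
      @minpoly ℚ K _ _ DivisionRing.toRatAlgebra
        (@PowerBasis.gen ℚ K _ _ DivisionRing.toRatAlgebra B') = @minpoly ℚ K _ _ a B.gen := by
  obtain rfl : a = DivisionRing.toRatAlgebra := Subsingleton.elim _ _
  exact ⟨B, rfl⟩

lemma transport_roots {K : Type} [Field K] [CharZero K] (a : Algebra ℚ K) (f : ℚ[X]) (x y : K)
    (hfin : @FiniteDimensional ℚ K _ _ a.toModule) (hx : f.eval₂ a.algebraMap x = 0) (hy : f.eval₂ a.algebraMap y = 0) :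
    NumberField K ∧ @aeval ℚ K _ _ DivisionRing.toRatAlgebra x f = 0 ∧
      @aeval ℚ K _ _ DivisionRing.toRatAlgebra y f = 0 := by
  obtain rfl : a = DivisionRing.toRatAlgebra := Subsingleton.elim _ _
  exact ⟨{ to_charZero := inferInstance, to_finiteDimensional := hfin }, hx, hy⟩

lemma exists_K (f : ℚ[X]) (hirr : Irreducible f) (hfm : f.Monic) :
    ∃ (K : Type) (_ : Field K) (_ : NumberField K) (B : PowerBasis ℚ K), minpoly ℚ B.gen = f := by
  have : Fact (Irreducible f) := ⟨hirr⟩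
  have : CharZero (AdjoinRoot f) := charZero_of_injective_algebraMap (AdjoinRoot.of f).injective
  obtain ⟨B, hB⟩ := transport_pb _ (AdjoinRoot.powerBasis hirr.ne_zero)
  refine ⟨AdjoinRoot f, AdjoinRoot.instField, { to_charZero := inferInstance, to_finiteDimensional := B.finite }, B, ?_⟩
  refine hB.trans ?_
  rw [AdjoinRoot.powerBasis_gen, AdjoinRoot.minpoly_root hirr.ne_zero, hfm.leadingCoeff, inv_one, C_1, mul_one]

lemma exists_two {F : Type} [Field F] (f : F[X]) (hirr : Irreducible f) (hsep : f.Separable) (hd : 2 ≤ f.natDegree) :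
    ∃ (L : Type) (_ : Field L) (a : Algebra F L) (_ : FiniteDimensional F L) (x y : L), x ≠ y ∧
      f.eval₂ a.algebraMap x = 0 ∧ f.eval₂ a.algebraMap y = 0 := by
  classical
  have hcard : 1 < (f.aroots f.SplittingField).toFinset.card := by
    rw [Multiset.toFinset_card_of_nodup (nodup_aroots_iff_of_splits hirr.ne_zero (SplittingField.splits f) |>.2 hsep)]
    have := (SplittingField.splits f).natDegree_eq_card_roots
    rw [natDegree_map] at this
    rw [aroots, ← this]
    omega
  obtain ⟨x, hx, y, hy, hxy⟩ := Finset.one_lt_card.1 hcard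
  rw [Multiset.mem_toFinset, mem_aroots'] at hx hy
  exact ⟨f.SplittingField, inferInstance, inferInstance, inferInstance, x, y, hxy, hx.2, hy.2⟩

lemma exists_L (f : ℚ[X]) (hirr : Irreducible f) (hd : 2 ≤ f.natDegree) :
    ∃ (L : Type) (_ : Field L) (_ : NumberField L) (x y : L), x ≠ y ∧ aeval x f = 0 ∧ aeval y f = 0 := by
  obtain ⟨L, hL, a, hfin, x, y, hxy, hx, hy⟩ := exists_two f hirr hirr.separable hd
  have : CharZero L := charZero_of_injective_algebraMap (R := ℚ) a.algebraMap.injective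
  obtain ⟨h1, h2, h3⟩ := transport_roots a f x y hfin hx hy
  exact ⟨L, hL, h1, x, y, hxy, h2, h3⟩

lemma noroot_monic (h : ℤ[X]) (hm : h.Monic) (hirr : Irreducible (h.map (Int.castRingHom ℚ)))
    (hd : 2 ≤ h.natDegree) :
    ∃ N : ℕ, ∀ n ≥ N, ∃ p : ℕ, p.Prime ∧ n < 2 * p ∧ p ≤ n ∧ ∀ b : ℤ, ¬ (p : ℤ) ∣ h.eval b := by
  set f := h.map (Int.castRingHom ℚ) with hf
  have hfm : f.Monic := hm.map _
  have hfd : f.natDegree = h.natDegree := hm.natDegree_map _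
  obtain ⟨K, _, _, B, hB⟩ := exists_K f hirr hfm
  obtain ⟨L, _, _, x, y, hxy, hx, hy⟩ := exists_L f hirr (by omega)
  have hintg : IsIntegral ℤ B.gen := by
    refine ⟨h, hm, ?_⟩
    have := minpoly.aeval ℚ B.gen
    rw [hB, aeval_def, hf, eval₂_map] at this
    rwa [RingHom.ext_int (algebraMap ℤ K) ((algebraMap ℚ K).comp (Int.castRingHom ℚ))]
  set θ : 𝓞 K := ⟨B.gen, hintg⟩ with hθ
  have hθc : (θ : K) = B.gen := rfl
  have hmin : minpoly ℤ θ = h := by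
    have e1 : minpoly ℚ B.gen = (minpoly ℤ B.gen).map (algebraMap ℤ ℚ) :=
      minpoly.isIntegrallyClosed_eq_field_fractions' ℚ hintg
    rw [hB] at e1
    have e2 : minpoly ℤ B.gen = h :=
      (map_injective (Int.castRingHom ℚ) Int.cast_injective (by rw [← hf]; exact e1)).symm
    rw [← e2, ← hθc]
    exact (RingOfIntegers.minpoly_coe θ).symm
  have := noroot_aux K L (B.lift x (by rw [hB]; exact hx)).toRingHom (B.lift y (by rw [hB]; exact hy)).toRingHom θ (by
      rw [hθc]
      simpa [PowerBasis.lift_gen] using hxy)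
    (exponent_ne_zero _ θ B hθc.symm)
  rwa [hmin] at this

theorem noroot (g : ℤ[X]) (hirr : Irreducible g) (hd : 2 ≤ g.natDegree) :
    ∃ N : ℕ, ∀ n ≥ N, ∃ p : ℕ, p.Prime ∧ n < 2 * p ∧ p ≤ n ∧ ∀ b : ℤ, ¬ (p : ℤ) ∣ g.eval b := by
  obtain ⟨N, hN⟩ := noroot_monic g.integralNormalization (monic_integralNormalization hirr.ne_zero)
    (irr_normalization g hirr (by omega)) (by rw [natDegree_integralNormalization]; exact hd)
  refine ⟨N, fun n hn => ?_⟩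
  obtain ⟨p, hp, h1, h2, h3⟩ := hN n hn
  refine ⟨p, hp, h1, h2, fun b hb => h3 (g.leadingCoeff * b) ?_⟩
  have := integralNormalization_eval₂_leadingCoeff_mul (p := g) (by omega) (RingHom.id ℤ) b
  simp only [eval₂_id, RingHom.id_apply] at this
  rw [this]
  exact hb.mul_left _

end PIT

end

section

namespace Fin5
open Polynomial

/-- dehomogenization -/
noncomputable def dh : MvPolynomial (Fin 2) ℤ →ₐ[ℤ] ℤ[X] := MvPolynomial.aeval ![X, 1]

/-- homogenization -/
noncomputable def H (n : ℕ) (a : ℤ[X]) : MvPolynomial (Fin 2) ℤ :=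
  ∑ i ∈ Finset.range (n + 1), MvPolynomial.C (a.coeff i) * MvPolynomial.X 0 ^ i * MvPolynomial.X 1 ^ (n - i)

lemma H_hom (n : ℕ) (a : ℤ[X]) : (H n a).IsHomogeneous n := by
  refine MvPolynomial.IsHomogeneous.sum _ _ _ fun i hi => ?_
  have hi' : i ≤ n := Nat.lt_succ_iff.1 (Finset.mem_range.1 hi)
  have := ((MvPolynomial.isHomogeneous_C (Fin 2) (a.coeff i)).mul
    ((MvPolynomial.isHomogeneous_X ℤ (0 : Fin 2)).pow i)).mul ((MvPolynomial.isHomogeneous_X ℤ (1 : Fin 2)).pow (n - i))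
  convert this using 1
  omega

lemma dh_H (n : ℕ) (a : ℤ[X]) (h : a.natDegree ≤ n) : dh (H n a) = a := by
  conv_rhs => rw [a.as_sum_range' (n + 1) (by omega)]
  simp only [dh, H, map_sum]
  refine Finset.sum_congr rfl fun i _ => ?_
  rw [← C_mul_X_pow_eq_monomial]
  simp

lemma dh_eq (F : MvPolynomial (Fin 2) ℤ) : dh F = ∑ m ∈ F.support, C (F.coeff m) * X ^ (m 0) := by
  rw [dh, MvPolynomial.aeval_def, MvPolynomial.eval₂_eq']
  refine Finset.sum_congr rfl fun m _ => ?_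
  simp

lemma hom_add {F : MvPolynomial (Fin 2) ℤ} {n : ℕ} (hF : F.IsHomogeneous n) {m : Fin 2 →₀ ℕ} (hm : m ∈ F.support) :
    m 0 + m 1 = n := by
  have := hF (MvPolynomial.mem_support_iff.1 hm)
  rw [Finsupp.weight_apply, Finsupp.sum_fintype _ _ (by simp)] at this
  simpa using this

lemma dh_coeff {F : MvPolynomial (Fin 2) ℤ} {n : ℕ} (hF : F.IsHomogeneous n) {m : Fin 2 →₀ ℕ} (hm : m ∈ F.support) :
    (dh F).coeff (m 0) = F.coeff m := by
  rw [dh_eq, finsetSum_coeff, Finset.sum_eq_single m]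
  · simp
  · intro m' hm' hne
    rw [coeff_C_mul_X_pow, if_neg]
    intro h
    apply hne
    have h1 := hom_add hF hm
    have h2 := hom_add hF hm'
    ext i
    fin_cases i
    · exact h.symm
    · simp; omega
  · exact fun h => absurd hm h

lemma dh_inj {F G : MvPolynomial (Fin 2) ℤ} {n : ℕ} (hF : F.IsHomogeneous n) (hG : G.IsHomogeneous n)
    (h : dh F = dh G) : F = G := by
  rw [← sub_eq_zero]
  by_contra hne
  obtain ⟨m, hm⟩ := MvPolynomial.support_nonempty.2 hne
  have h1 := dh_coeff (hF.sub hG) hm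
  rw [map_sub, h, sub_self, coeff_zero] at h1
  exact MvPolynomial.mem_support_iff.1 hm h1.symm

lemma dh_natDegree_le {F : MvPolynomial (Fin 2) ℤ} {n : ℕ} (hF : F.IsHomogeneous n) : (dh F).natDegree ≤ n := by
  rw [dh_eq]
  refine natDegree_sum_le_of_forall_le _ _ fun m hm => (natDegree_C_mul_X_pow_le _ _).trans ?_
  have := hom_add hF hm
  omega

lemma H_dh {F : MvPolynomial (Fin 2) ℤ} {n : ℕ} (hF : F.IsHomogeneous n) : H n (dh F) = F :=
  dh_inj (H_hom _ _) hF (dh_H _ _ (dh_natDegree_le hF))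

lemma dh_natDegree {F : MvPolynomial (Fin 2) ℤ} {n : ℕ} (hn : 2 ≤ n) (hF : F.IsHomogeneous n) (hirr : Irreducible F) :
    (dh F).natDegree = n := by
  by_contra hne
  have hlt : (dh F).natDegree < n := lt_of_le_of_ne (dh_natDegree_le hF) hne
  have e : F = MvPolynomial.X 1 * H (n - 1) (dh F) := by
    refine dh_inj hF ?_ ?_
    · have := (MvPolynomial.isHomogeneous_X ℤ (1 : Fin 2)).mul (H_hom (n - 1) (dh F))
      rwa [show 1 + (n - 1) = n by omega] at this
    · rw [map_mul, dh_H _ _ (by omega)]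
      simp [dh]
  rcases hirr.isUnit_or_isUnit e with h | h
  · have := h.map (MvPolynomial.eval (fun _ : Fin 2 => (0 : ℤ)))
    simp at this
  · have := h.map (MvPolynomial.eval (fun _ : Fin 2 => (0 : ℤ)))
    rw [H, map_sum, Finset.sum_eq_zero] at this
    · simp at this
    · intro i hi
      rcases Nat.eq_zero_or_pos i with rfl | hi
      · simp; omega
      · simp [hi.ne']

lemma dh_irr {F : MvPolynomial (Fin 2) ℤ} {n : ℕ} (hn : 2 ≤ n) (hF : F.IsHomogeneous n) (hirr : Irreducible F) :
    Irreducible (dh F) := by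
  have hdeg := dh_natDegree hn hF hirr
  refine ⟨fun h => ?_, fun a b hab => ?_⟩
  · have := natDegree_eq_zero_of_isUnit h
    omega
  · have hne : a * b ≠ 0 := by
      intro h; rw [hab, h] at hdeg; simp at hdeg; omega
    have hd2 : a.natDegree + b.natDegree = n := by
      rw [← natDegree_mul (left_ne_zero_of_mul hne) (right_ne_zero_of_mul hne), ← hab, hdeg]
    have e : F = H a.natDegree a * H b.natDegree b := by
      refine dh_inj hF ?_ ?_
      · have := (H_hom a.natDegree a).mul (H_hom b.natDegree b)
        rwa [hd2] at this
      · rw [map_mul, dh_H _ _ le_rfl, dh_H _ _ le_rfl, hab]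
    rcases hirr.isUnit_or_isUnit e with h | h
    · left; have := h.map dh; rwa [dh_H _ _ le_rfl] at this
    · right; have := h.map dh; rwa [dh_H _ _ le_rfl] at this

lemma eval_form {F : MvPolynomial (Fin 2) ℤ} {n : ℕ} (hn : 2 ≤ n) (hF : F.IsHomogeneous n) (hirr : Irreducible F)
    (x y : ℤ) : MvPolynomial.eval ![x, y] F = Thue.form (dh F) x y := by
  conv_lhs => rw [← H_dh hF]
  rw [H, Thue.form, dh_natDegree hn hF hirr, map_sum]
  simp

lemma form_root (g : ℤ[X]) (hd : 1 ≤ g.natDegree) (p : ℕ) (hp : p.Prime) (hlc : ¬ (p : ℤ) ∣ g.leadingCoeff)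
    (hno : ∀ b : ℤ, ¬ (p : ℤ) ∣ g.eval b) (x y : ℤ) (h : (p : ℤ) ∣ Thue.form g x y) :
    (p : ℤ) ∣ x ∧ (p : ℤ) ∣ y := by
  have : Fact p.Prime := ⟨hp⟩
  have hpz : Prime (p : ℤ) := Nat.prime_iff_prime_int.1 hp
  by_cases hy : (p : ℤ) ∣ y
  · refine ⟨?_, hy⟩
    rw [Thue.form, Finset.sum_range_succ] at h
    have h1 : (p : ℤ) ∣ ∑ i ∈ Finset.range g.natDegree, g.coeff i * x ^ i * y ^ (g.natDegree - i) := by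
      refine Finset.dvd_sum fun i hi => ?_
      have := Finset.mem_range.1 hi
      exact Dvd.dvd.mul_left (dvd_pow hy (by omega)) _
    have h2 := (dvd_add_right h1).1 h
    rw [Nat.sub_self, pow_zero, mul_one] at h2
    exact hpz.dvd_of_dvd_pow ((hpz.dvd_or_dvd h2).resolve_left hlc)
  · exfalso
    have hy' : (y : ZMod p) ≠ 0 := fun h => hy ((ZMod.intCast_zmod_eq_zero_iff_dvd _ _).1 h)
    obtain ⟨b, hb⟩ := ZMod.intCast_surjective ((x : ZMod p) / (y : ZMod p))
    apply hno b
    rw [← ZMod.intCast_zmod_eq_zero_iff_dvd] at h ⊢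
    have e : ((Thue.form g x y : ℤ) : ZMod p) = (y : ZMod p) ^ g.natDegree * ((g.eval b : ℤ) : ZMod p) := by
      rw [eval_eq_sum_range, Thue.form]
      push_cast
      rw [hb, Finset.mul_sum]
      refine Finset.sum_congr rfl fun i hi => ?_
      have := Finset.mem_range.1 hi
      have e2 : (y : ZMod p) ^ g.natDegree = y ^ (g.natDegree - i) * y ^ i := by
        rw [← pow_add]; congr 1; omega
      rw [e2, div_pow]
      field_simp
    rw [e] at h
    exact (mul_eq_zero.1 h).resolve_left (pow_ne_zero _ hy')

lemma form_pow (g : ℤ[X]) (p x y : ℤ) (hx : p ∣ x) (hy : p ∣ y) : p ^ g.natDegree ∣ Thue.form g x y := by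
  rw [Thue.form]
  refine Finset.dvd_sum fun i hi => ?_
  have := Finset.mem_range.1 hi
  rw [show p ^ g.natDegree = p ^ i * p ^ (g.natDegree - i) by rw [← pow_add]; congr 1; omega, mul_assoc]
  exact Dvd.dvd.mul_left (mul_dvd_mul (pow_dvd_pow_of_dvd hx _) (pow_dvd_pow_of_dvd hy _)) _

lemma fact_fact (p n : ℕ) (hp : p.Prime) (hn : n < 2 * p) : (n.factorial).factorization p ≤ 1 := by
  have h2 := hp.two_le
  rw [Nat.factorization_factorial hp (b := 2) (Nat.log_lt_of_lt_pow' (by norm_num) (by nlinarith))]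
  simp only [Nat.Ico_succ_singleton, Finset.sum_singleton, pow_one]
  exact Nat.lt_succ_iff.1 ((Nat.div_lt_iff_lt_mul hp.pos).2 (by omega))

lemma not_pow_dvd (r : ℕ) (b : ℤ) (hb : b ≠ 0) (A : Fin r → ℕ) (hA : ∀ i, 0 < A i) (n : Fin r → ℕ) (p : ℕ)
    (hp : p.Prime) (hpb : b.natAbs < p) (hpA : ∀ i, A i < p) (hn : ∀ i, n i < 2 * p) (d : ℕ) (hd : r < d) :
    ¬ (p : ℤ) ^ d ∣ b * ∏ i, (((n i).factorial : ℤ) * (A i : ℤ) ^ (n i)) := by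
  intro h
  have h1 : p ^ d ∣ b.natAbs * ∏ i, ((n i).factorial * A i ^ n i) := by
    have := Int.natAbs_dvd_natAbs.2 h
    rw [Int.natAbs_mul, Int.natAbs_pow, Int.natAbs_natCast] at this
    convert this using 2
    have e : (∏ i, (((n i).factorial : ℤ) * (A i : ℤ) ^ (n i))) = ((∏ i, ((n i).factorial * A i ^ n i) : ℕ) : ℤ) := by
      push_cast; rfl
    rw [e, Int.natAbs_natCast]
  have hne : ∀ i, (n i).factorial * A i ^ n i ≠ 0 := fun i =>
    mul_ne_zero (Nat.factorial_ne_zero _) (pow_ne_zero _ (hA i).ne')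
  have hb' : b.natAbs ≠ 0 := Int.natAbs_ne_zero.2 hb
  have hprod : ∏ i, ((n i).factorial * A i ^ n i) ≠ 0 := Finset.prod_ne_zero_iff.2 fun i _ => hne i
  rw [hp.pow_dvd_iff_le_factorization (mul_ne_zero hb' hprod), Nat.factorization_mul hb' hprod,
    Finsupp.add_apply, Nat.factorization_eq_zero_of_lt hpb, zero_add,
    Nat.factorization_prod (fun i _ => hne i), Finsupp.finsetSum_apply] at h1
  have h2 : ∑ i, ((n i).factorial * A i ^ n i).factorization p ≤ ∑ i : Fin r, 1 := by
    refine Finset.sum_le_sum fun i _ => ?_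
    rw [Nat.factorization_mul (Nat.factorial_ne_zero _) (pow_ne_zero _ (hA i).ne'), Finsupp.add_apply,
      Nat.factorization_pow, Finsupp.smul_apply, Nat.factorization_eq_zero_of_lt (hpA i), smul_zero, add_zero]
    exact fact_fact p (n i) hp (hn i)
  simp at h2
  omega

end Fin5

theorem stmt_5 (d : ℕ) (f : MvPolynomial (Fin 2) ℤ) (hirr : Irreducible f)
    (hhom : f.IsHomogeneous d) (r : ℕ) (hr : 2 ≤ r) (b : ℤ) (hb : b ≠ 0)
    (A : Fin r → ℕ) (hA : ∀ i, 0 < A i) (hd : r < d) :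
    {p : (Fin r → ℕ) × ℤ × ℤ | (∀ i, 0 < p.1 i) ∧
      b * ∏ i, (((p.1 i).factorial : ℤ) * (A i : ℤ) ^ (p.1 i)) =
        MvPolynomial.eval ![p.2.1, p.2.2] f}.Finite := by
  have hd2 : 2 ≤ d := by omega
  set g := Fin5.dh f with hg
  have hgd : g.natDegree = d := Fin5.dh_natDegree hd2 hhom hirr
  have hgi : Irreducible g := Fin5.dh_irr hd2 hhom hirr
  have hlc0 : g.leadingCoeff ≠ 0 := Polynomial.leadingCoeff_ne_zero.2 hgi.ne_zero
  obtain ⟨N, hN⟩ := PIT.noroot g hgi (by omega)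
  set M := N + 2 * g.leadingCoeff.natAbs + 2 * b.natAbs + 2 * ∑ i, A i with hM
  have hbd : ∀ (n : Fin r → ℕ) (x y : ℤ), b * ∏ i, (((n i).factorial : ℤ) * (A i : ℤ) ^ (n i)) = Thue.form g x y →
      ∀ i, n i ≤ M := by
    intro n x y heq
    by_contra hcon
    push Not at hcon
    obtain ⟨i₀, hi₀⟩ := hcon
    obtain ⟨j, _, hj⟩ := Finset.exists_max_image Finset.univ n ⟨i₀, Finset.mem_univ _⟩
    have hjM : M < n j := lt_of_lt_of_le hi₀ (hj i₀ (Finset.mem_univ _))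
    obtain ⟨p, hp, hp1, hp2, hno⟩ := hN (n j) (by omega)
    have hpl : ¬ (p : ℤ) ∣ g.leadingCoeff := fun h => by
      have := Nat.le_of_dvd (Int.natAbs_pos.2 hlc0) (Int.natCast_dvd.1 h)
      omega
    have hpA : ∀ i, A i < p := fun i => by
      have := Finset.single_le_sum (f := A) (fun _ _ => Nat.zero_le _) (Finset.mem_univ i)
      omega
    have hdvd : (p : ℤ) ∣ Thue.form g x y := by
      rw [← heq]
      refine Dvd.dvd.mul_left ((Dvd.dvd.mul_right ?_ _).trans (Finset.dvd_prod_of_mem _ (Finset.mem_univ j))) _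
      exact_mod_cast (hp.dvd_factorial).2 hp2
    obtain ⟨hx, hy⟩ := Fin5.form_root g (by omega) p hp hpl hno x y hdvd
    have hpow := Fin5.form_pow g p x y hx hy
    rw [hgd, ← heq] at hpow
    exact Fin5.not_pow_dvd r b hb A hA n p hp (by omega) hpA
      (fun i => lt_of_le_of_lt (hj i (Finset.mem_univ _)) hp1) d hd hpow
  have hfin : (⋃ n ∈ Set.Iic (fun _ : Fin r => M), (fun q : ℤ × ℤ => (n, q)) ''
      {q : ℤ × ℤ | Thue.form g q.1 q.2 = b * ∏ i, (((n i).factorial : ℤ) * (A i : ℤ) ^ (n i))}).Finite :=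
    (Set.finite_Iic _).biUnion fun n _ => (Thue.thue g hgi (by omega) _).image _
  refine hfin.subset ?_
  rintro ⟨n, x, y⟩ ⟨_, heq⟩
  simp only at heq
  rw [Fin5.eval_form hd2 hhom hirr] at heq
  simp only [Set.mem_iUnion]
  exact ⟨n, fun i => hbd n x y heq i, (x, y), heq.symm, rfl⟩

end
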